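/- arXiv:2405.11463 — 5 statements merged into one kernel-verified Lean document; each statement's English description precedes it below -/
import Mathlib

section
/- Let q be an odd prime power, n ≥ 5, m a positive integer, f ∈ R_{q,n}(m), and a, b ∈ F_q^* with a = b^2. Let k, P be positive integers with gcd(k,P) = 1 and kP | q^n − 1, and let g, G, g', G' be monic polynomials over F_q with gcd(g,G) = gcd(g',G') = 1, gG dividing the largest divisor L of x^n − 1 not divisible by x − 1, and g'G' | x^n − 1. Let p_1, ..., p_r be the distinct prime factors of P, g_1, ..., g_s the distinct monic irreducible factors of G, and g'_1, ..., g'_t the distinct monic irreducible factors of G'. Then C_{f,a,b}(kP, kP, gG, g'G') ≥ Σ_{i=1}^r C_{f,a,b}(p_i k, k, g, g') + Σ_{i=1}^r C_{f,a,b}(k, p_i k, g, g') + Σ_{j=1}^s C_{f,a,b}(k, k, g_j g, g') + Σ_{j=1}^t C_{f,a,b}(k, k, g, g'_j g') − (2r + s + t − 1) · C_{f,a,b}(k, k, g, g'). -/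
open Polynomial

noncomputable section PrimitiveNormalSubtrace

/-- `q` is an odd prime power. -/
def IsOddPrimePow (q : ℕ) : Prop := ∃ p k : ℕ, p.Prime ∧ Odd p ∧ 0 < k ∧ q = p ^ k

/-- The trace `Tr_{q^n/q}(ε) = ∑_{i<n} ε^{q^i}`. -/
def traceQ (q n : ℕ) {F : Type*} [Field F] (ε : F) : F := ∑ i ∈ Finset.range n, ε ^ q ^ i

/-- The subtrace `STr_{q^n/q}(ε) = ∑_{0 ≤ i < j ≤ n-1} ε^{q^i + q^j}`. -/
def subtraceQ (q n : ℕ) {F : Type*} [Field F] (ε : F) : F :=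
  ∑ i ∈ Finset.range n, ∑ j ∈ Finset.Ico (i + 1) n, ε ^ (q ^ i + q ^ j)

/-- `ε` is `l`-free: if `ε = δ^j` with `j ∣ l` then `j = 1`. -/
def LFree (l : ℕ) {F : Type*} [Field F] (ε : F) : Prop :=
  ∀ (δ : F) (j : ℕ), j ∣ l → ε = δ ^ j → j = 1

/-- The `F_q[x]`-module action `h ∘ ε = ∑ a_i ε^{q^i}`. -/
def polyAct (q : ℕ) {Fq F : Type*} [Field Fq] [Field F] [Algebra Fq F]
    (h : Polynomial Fq) (ε : F) : F :=
  ∑ i ∈ Finset.range (h.natDegree + 1), algebraMap Fq F (h.coeff i) * ε ^ q ^ i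

/-- `ε` is `g`-free: if `ε = h ∘ δ` with `h` a monic divisor of `g` then `h = 1`. -/
def GFree (q : ℕ) {Fq F : Type*} [Field Fq] [Field F] [Algebra Fq F]
    (g : Polynomial Fq) (ε : F) : Prop :=
  ∀ (h : Polynomial Fq) (δ : F), h.Monic → h ∣ g → ε = polyAct q h δ → h = 1

/-- `f` is an irreducible polynomial or a nonzero constant. -/
def IrredOrConst {F : Type*} [Field F] (f : Polynomial F) : Prop :=
  f ≠ 0 ∧ (Irreducible f ∨ f.natDegree = 0)

/-- `f1/f2` belongs to `R_{q,n}(m)`: both numerator and denominator are irreducible or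
nonzero constants, coprime, and the degrees sum to `m`. -/
def InRat {F : Type*} [Field F] (m : ℕ) (f1 f2 : Polynomial F) : Prop :=
  IrredOrConst f1 ∧ IrredOrConst f2 ∧ IsCoprime f1 f2 ∧ f1.natDegree + f2.natDegree = m

/-- `ε` is a primitive element of the field with `q^n` elements. -/
def IsPrimitiveElem (q n : ℕ) {F : Type*} [Field F] (ε : F) : Prop := orderOf ε = q ^ n - 1

/-- `ε` is normal over `F_q`: its conjugates `ε, ε^q, …, ε^{q^{n-1}}` form an `F_q`-basis. -/
def IsNormalElem (q n : ℕ) (Fq : Type*) {F : Type*} [Field Fq] [Field F] [Algebra Fq F]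
    (ε : F) : Prop :=
  LinearIndependent Fq (fun i : Fin n => ε ^ q ^ (i : ℕ)) ∧
    Submodule.span Fq (Set.range fun i : Fin n => ε ^ q ^ (i : ℕ)) = ⊤

/-- The counting function `C_{f,a,b}(l1,l2,g1,g2)`. -/
def Ccount (q n : ℕ) {Fq F : Type*} [Field Fq] [Field F] [Algebra Fq F]
    (f1 f2 : Polynomial F) (a b : Fq) (l1 l2 : ℕ) (g1 g2 : Polynomial Fq) : ℕ :=
  Nat.card {ε : F // ε ≠ 0 ∧ f1.eval ε ≠ 0 ∧ f2.eval ε ≠ 0 ∧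
    LFree l1 ε ∧ GFree q g1 ε ∧
    LFree l2 (f1.eval ε / f2.eval ε) ∧ GFree q g2 (f1.eval ε / f2.eval ε) ∧
    traceQ q n ε = algebraMap Fq F b ∧ traceQ q n (ε ^ 2) = algebraMap Fq F (-a)}

/-- `(q,n) ∈ D_m`. -/
def memD (q n m : ℕ) : Prop :=
  ∀ (Fq F : Type) [Field Fq] [Field F] [Fintype Fq] [Fintype F] [Algebra Fq F],
    Fintype.card Fq = q → Fintype.card F = q ^ n →
    ∀ f1 f2 : Polynomial F, InRat m f1 f2 →
    ∀ a b : Fq, a ≠ 0 → b ≠ 0 → a = b ^ 2 →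
    ∃ ε : F, ε ≠ 0 ∧ f1.eval ε ≠ 0 ∧ f2.eval ε ≠ 0 ∧
      IsPrimitiveElem q n ε ∧ IsNormalElem q n Fq ε ∧
      IsPrimitiveElem q n (f1.eval ε / f2.eval ε) ∧
      IsNormalElem q n Fq (f1.eval ε / f2.eval ε) ∧
      traceQ q n ε = algebraMap Fq F b ∧ traceQ q n (ε ^ 2) = algebraMap Fq F (-a)

/-- `W(l) = 2^{ω(l)}`, the number of squarefree divisors of a positive integer. -/
def Wnat (l : ℕ) : ℕ := 2 ^ l.primeFactors.card

/-- `ω(g)`: the number of distinct monic irreducible factors of a polynomial. -/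
def omegaPoly {Fq : Type*} [Field Fq] (g : Polynomial Fq) : ℕ :=
  {p : Polynomial Fq | p.Monic ∧ Irreducible p ∧ p ∣ g}.ncard

/-- `W(g) = 2^{ω(g)}`, the number of (monic) squarefree factors of a polynomial. -/
def Wpoly {Fq : Type*} [Field Fq] (g : Polynomial Fq) : ℕ := 2 ^ omegaPoly g

/-- `θ(l) = φ(l)/l`. -/
def thetaN (l : ℕ) : ℝ := (Nat.totient l : ℝ) / l

/-- `Φ_q(g)`: the order of the unit group of `F_q[x]/(g)`. -/
def PhiQ {Fq : Type*} [Field Fq] (g : Polynomial Fq) : ℕ :=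
  Nat.card (Polynomial Fq ⧸ Ideal.span ({g} : Set (Polynomial Fq)))ˣ

/-- `Θ(g) = Φ_q(g)/q^{deg g}`. -/
def ThetaP (q : ℕ) {Fq : Type*} [Field Fq] (g : Polynomial Fq) : ℝ :=
  (PhiQ g : ℝ) / (q : ℝ) ^ g.natDegree

/-- `L` is the largest divisor of `Gg` that is not divisible by `x - 1`. -/
def IsMaxDivisorPrimeToXsub1 {Fq : Type*} [Field Fq] (Gg L : Polynomial Fq) : Prop :=
  L.Monic ∧ L ∣ Gg ∧ ¬ (X - 1 : Polynomial Fq) ∣ L ∧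
    ∀ h : Polynomial Fq, h ∣ Gg → ¬ (X - 1 : Polynomial Fq) ∣ h → h ∣ L

end PrimitiveNormalSubtrace

theorem LFree_mul_iff (k P : ℕ) (hP : 0 < P) {F : Type*} [Field F] (ε : F) :
    LFree (k * P) ε ↔ LFree k ε ∧ ∀ p ∈ P.primeFactors, LFree (p * k) ε := by
  constructor
  · intro h
    refine ⟨fun δ j hj => h δ j (hj.mul_right P), fun p hp δ j hj => h δ j (hj.trans ?_)⟩
    rw [mul_comm p k]
    exact mul_dvd_mul_left k (Nat.dvd_of_mem_primeFactors hp)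
  · rintro ⟨h1, h2⟩ δ j hj he
    by_contra hne
    obtain ⟨l, hl, c, rfl⟩ := Nat.exists_prime_and_dvd hne
    have he' : ε = (δ ^ c) ^ l := by rw [he, ← pow_mul, mul_comm]
    have hd : l ∣ k * P := (Dvd.intro _ rfl).trans hj
    rcases (Nat.Prime.dvd_mul hl).1 hd with h | h
    · exact hl.one_lt.ne' (h1 _ _ h he')
    · exact hl.one_lt.ne' (h2 l (Nat.mem_primeFactors.2 ⟨hl, h, hP.ne'⟩) _ _
        (Dvd.intro _ rfl) he')

theorem LFree_of_dvd {l l' : ℕ} (h : l ∣ l') {F : Type*} [Field F] {ε : F}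
    (hε : LFree l' ε) : LFree l ε := fun δ j hj => hε δ j (hj.trans h)

theorem GFree_of_dvd (q : ℕ) {Fq F : Type*} [Field Fq] [Field F] [Algebra Fq F]
    {g g' : Polynomial Fq} (h : g ∣ g') {ε : F}
    (hε : GFree q g' ε) : GFree q g ε := fun u δ hu hj => hε u δ hu (hj.trans h)

theorem polyAct_eq {Fq F : Type*} [Field Fq] [Field F] [Fintype Fq] [Algebra Fq F]
    (h : Polynomial Fq) (ε : F) :
    polyAct (Fintype.card Fq) h ε =
      (aeval (FiniteField.frobeniusAlgHom Fq F).toLinearMap h) ε := by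
  have key : ∀ i : ℕ, ((FiniteField.frobeniusAlgHom Fq F).toLinearMap ^ i) ε
      = ε ^ Fintype.card Fq ^ i := by
    intro i
    induction i with
    | zero => simp
    | succ i ih =>
      rw [pow_succ', Module.End.mul_apply, ih]
      simp [FiniteField.frobeniusAlgHom_apply, pow_succ, pow_mul]
  rw [aeval_eq_sum_range, LinearMap.sum_apply]
  unfold polyAct
  refine Finset.sum_congr rfl fun i _ => ?_
  rw [LinearMap.smul_apply, key, Algebra.smul_def]

theorem polyAct_mul {Fq F : Type*} [Field Fq] [Field F] [Fintype Fq] [Algebra Fq F]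
    (u v : Polynomial Fq) (ε : F) :
    polyAct (Fintype.card Fq) (u * v) ε =
      polyAct (Fintype.card Fq) u (polyAct (Fintype.card Fq) v ε) := by
  simp only [polyAct_eq, map_mul, Module.End.mul_apply]

theorem GFree_mul_iff {Fq F : Type*} [Field Fq] [Field F] [Fintype Fq] [Algebra Fq F]
    (g G : Polynomial Fq) (GF : Finset (Polynomial Fq))
    (hGF : ∀ p : Polynomial Fq, p ∈ GF ↔ p.Monic ∧ Irreducible p ∧ p ∣ G) (ε : F) :
    GFree (Fintype.card Fq) (g * G) ε ↔ GFree (Fintype.card Fq) g ε ∧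
      ∀ p ∈ GF, GFree (Fintype.card Fq) (p * g) ε := by
  constructor
  · intro h
    refine ⟨GFree_of_dvd _ (Dvd.intro _ rfl) h, fun p hp => GFree_of_dvd _ ?_ h⟩
    rw [mul_comm p g]
    exact mul_dvd_mul_left g ((hGF p).1 hp).2.2
  · rintro ⟨h1, h2⟩ u δ hu hj he
    by_contra hne
    have hnu : ¬ IsUnit u := fun h => hne (hu.eq_one_of_isUnit h)
    obtain ⟨l, hlm, hl, c, rfl⟩ := Polynomial.exists_monic_irreducible_factor u hnu
    rw [polyAct_mul] at he
    have hd : l ∣ g * G := (Dvd.intro _ rfl).trans hj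
    have hl1 : l ≠ 1 := hl.ne_one
    rcases hl.prime.dvd_or_dvd hd with h | h
    · exact hl1 (h1 _ _ hlm h he)
    · exact hl1 (h2 l ((hGF l).2 ⟨hlm, hl, h⟩) _ _ hlm (Dvd.intro _ rfl) he)

theorem sieve_step {F ι : Type*} [Fintype F] (I : Finset ι) (A B : Set F) (hAB : A ⊆ B)
    (Q : ι → Set F) :
    ((A ∩ {x | ∀ i ∈ I, x ∈ Q i}).ncard : ℤ) ≥
      A.ncard - ∑ i ∈ I, ((B.ncard : ℤ) - ((B ∩ Q i).ncard : ℤ)) := by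
  classical
  induction I using Finset.induction_on with
  | empty => simp
  | insert i I hi ih =>
    rw [Finset.sum_insert hi]
    set S := A ∩ {x | ∀ i ∈ I, x ∈ Q i} with hS
    have e : A ∩ {x | ∀ j ∈ insert i I, x ∈ Q j} = S ∩ (B ∩ Q i) := by
      ext x
      simp only [hS, Set.mem_inter_iff, Set.mem_ofPred_eq, Finset.forall_mem_insert]
      constructor
      · rintro ⟨h1, h2, h3⟩
        exact ⟨⟨h1, h3⟩, hAB h1, h2⟩
      · rintro ⟨⟨h1, h3⟩, _, h2⟩
        exact ⟨h1, h2, h3⟩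
    have h1 := Set.ncard_union_add_ncard_inter S (B ∩ Q i) (Set.toFinite _) (Set.toFinite _)
    have h2 : (S ∪ (B ∩ Q i)).ncard ≤ B.ncard := by
      refine Set.ncard_le_ncard ?_ (Set.toFinite _)
      exact Set.union_subset (Set.inter_subset_left.trans hAB) Set.inter_subset_left
    rw [e]
    omega

/-- The set counted by `Ccount`. -/
def Cset (q n : ℕ) {Fq F : Type*} [Field Fq] [Field F] [Algebra Fq F]
    (f1 f2 : Polynomial F) (a b : Fq) (l1 l2 : ℕ) (g1 g2 : Polynomial Fq) : Set F :=
  {ε : F | ε ≠ 0 ∧ f1.eval ε ≠ 0 ∧ f2.eval ε ≠ 0 ∧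
    LFree l1 ε ∧ GFree q g1 ε ∧
    LFree l2 (f1.eval ε / f2.eval ε) ∧ GFree q g2 (f1.eval ε / f2.eval ε) ∧
    traceQ q n ε = algebraMap Fq F b ∧ traceQ q n (ε ^ 2) = algebraMap Fq F (-a)}

theorem Ccount_eq (q n : ℕ) {Fq F : Type*} [Field Fq] [Field F] [Algebra Fq F]
    (f1 f2 : Polynomial F) (a b : Fq) (l1 l2 : ℕ) (g1 g2 : Polynomial Fq) :
    Ccount q n f1 f2 a b l1 l2 g1 g2 = (Cset q n f1 f2 a b l1 l2 g1 g2).ncard := rfl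

theorem Ccount_sieve_inequality (q n m : ℕ) (hq : IsOddPrimePow q) (hn : 5 ≤ n) (hm : 0 < m)
    (Fq F : Type) [Field Fq] [Field F] [Fintype Fq] [Fintype F] [Algebra Fq F]
    (hcard : Fintype.card Fq = q) (hcardF : Fintype.card F = q ^ n)
    (f1 f2 : Polynomial F) (hf : InRat m f1 f2)
    (a b : Fq) (ha : a ≠ 0) (hb : b ≠ 0) (hab : a = b ^ 2)
    (k P : ℕ) (hk : 0 < k) (hP : 0 < P) (hkP : Nat.Coprime k P)
    (hkPd : k * P ∣ q ^ n - 1)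
    (L : Polynomial Fq) (hL : IsMaxDivisorPrimeToXsub1 (X ^ n - 1) L)
    (g G g' G' : Polynomial Fq)
    (hgm : g.Monic) (hGm : G.Monic) (hg'm : g'.Monic) (hG'm : G'.Monic)
    (hgG : IsCoprime g G) (hg'G' : IsCoprime g' G')
    (hgGd : g * G ∣ L) (hg'G'd : g' * G' ∣ (X ^ n - 1 : Polynomial Fq))
    (GF G'F : Finset (Polynomial Fq))
    (hGF : ∀ p : Polynomial Fq, p ∈ GF ↔ p.Monic ∧ Irreducible p ∧ p ∣ G)
    (hG'F : ∀ p : Polynomial Fq, p ∈ G'F ↔ p.Monic ∧ Irreducible p ∧ p ∣ G') :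
    (Ccount q n f1 f2 a b (k * P) (k * P) (g * G) (g' * G') : ℤ) ≥
      (∑ p ∈ P.primeFactors, (Ccount q n f1 f2 a b (p * k) k g g' : ℤ)) +
      (∑ p ∈ P.primeFactors, (Ccount q n f1 f2 a b k (p * k) g g' : ℤ)) +
      (∑ gj ∈ GF, (Ccount q n f1 f2 a b k k (gj * g) g' : ℤ)) +
      (∑ gj ∈ G'F, (Ccount q n f1 f2 a b k k g (gj * g') : ℤ)) -
      ((2 * P.primeFactors.card + GF.card + G'F.card : ℤ) - 1) *
        (Ccount q n f1 f2 a b k k g g' : ℤ) := by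
  subst hcard
  simp only [Ccount_eq]
  set q := Fintype.card Fq
  set B := Cset q n f1 f2 a b k k g g' with hB
  have s1 := sieve_step P.primeFactors B B subset_rfl
    (fun p => {ε : F | LFree (p * k) ε})
  set A1 := B ∩ {x | ∀ p ∈ P.primeFactors, x ∈ {ε : F | LFree (p * k) ε}} with hA1
  have hA1B : A1 ⊆ B := Set.inter_subset_left
  have s2 := sieve_step P.primeFactors A1 B hA1B
    (fun p => {ε : F | LFree (p * k) (f1.eval ε / f2.eval ε)})
  set A2 := A1 ∩ {x | ∀ p ∈ P.primeFactors,
    x ∈ {ε : F | LFree (p * k) (f1.eval ε / f2.eval ε)}} with hA2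
  have hA2B : A2 ⊆ B := Set.inter_subset_left.trans hA1B
  have s3 := sieve_step GF A2 B hA2B (fun p => {ε : F | GFree q (p * g) ε})
  set A3 := A2 ∩ {x | ∀ p ∈ GF, x ∈ {ε : F | GFree q (p * g) ε}} with hA3
  have hA3B : A3 ⊆ B := Set.inter_subset_left.trans hA2B
  have s4 := sieve_step G'F A3 B hA3B
    (fun p => {ε : F | GFree q (p * g') (f1.eval ε / f2.eval ε)})
  have e0 : Cset q n f1 f2 a b (k * P) (k * P) (g * G) (g' * G') =
      A3 ∩ {x | ∀ p ∈ G'F, x ∈ {ε : F | GFree q (p * g') (f1.eval ε / f2.eval ε)}} := by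
    ext ε
    simp only [hA3, hA2, hA1, hB, Cset, Set.mem_inter_iff, Set.mem_ofPred_eq,
      LFree_mul_iff k P hP, q, GFree_mul_iff g G GF hGF, GFree_mul_iff g' G' G'F hG'F]
    tauto
  have e1 : ∀ p, Cset q n f1 f2 a b (p * k) k g g' = B ∩ {ε : F | LFree (p * k) ε} := by
    intro p
    ext ε
    have := @LFree_of_dvd k (p * k) (Dvd.intro_left _ rfl) F _ ε
    simp only [hB, Cset, Set.mem_inter_iff, Set.mem_ofPred_eq]
    tauto
  have e2 : ∀ p, Cset q n f1 f2 a b k (p * k) g g' =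
      B ∩ {ε : F | LFree (p * k) (f1.eval ε / f2.eval ε)} := by
    intro p
    ext ε
    have := @LFree_of_dvd k (p * k) (Dvd.intro_left _ rfl) F _ (f1.eval ε / f2.eval ε)
    simp only [hB, Cset, Set.mem_inter_iff, Set.mem_ofPred_eq]
    tauto
  have e3 : ∀ p, Cset q n f1 f2 a b k k (p * g) g' = B ∩ {ε : F | GFree q (p * g) ε} := by
    intro p
    ext ε
    have := @GFree_of_dvd q Fq F _ _ _ g (p * g) (Dvd.intro_left _ rfl) ε
    simp only [hB, Cset, Set.mem_inter_iff, Set.mem_ofPred_eq]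
    tauto
  have e4 : ∀ p, Cset q n f1 f2 a b k k g (p * g') =
      B ∩ {ε : F | GFree q (p * g') (f1.eval ε / f2.eval ε)} := by
    intro p
    ext ε
    have := @GFree_of_dvd q Fq F _ _ _ g' (p * g') (Dvd.intro_left _ rfl)
      (f1.eval ε / f2.eval ε)
    simp only [hB, Cset, Set.mem_inter_iff, Set.mem_ofPred_eq]
    tauto
  simp only [e0, e1, e2, e3, e4]
  simp only [Finset.sum_sub_distrib, Finset.sum_const, nsmul_eq_mul] at s1 s2 s3 s4
  linarith
end

section
/- Let M be a positive integer such that ω(M) ≥ 2828, where ω(M) is the number of distinct prime divisors of M. Then 2^{ω(M)} < M^{1/13}. -/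
open Polynomial

def bigQ : ℕ := 2004401576545302577599591653441552787812849977066285969791842909503537700391898214353410600501293996807267197132074467682448564494675371562796423038301229264886150247730010662205704969956173185881152129393638460096840367667292791327201696065980922331136000000000000000000000000000000000000000

def candQ (n : ℕ) : Bool :=
  bif Nat.ble n 13 then
    Nat.beq n 2 || Nat.beq n 3 || Nat.beq n 5 || Nat.beq n 7 || Nat.beq n 11 || Nat.beq n 13
  else bif Nat.ble n 163 then Nat.beq (Nat.gcd n 6227020800) 1
  else bif Nat.ble n 25673 then Nat.beq (Nat.gcd n bigQ) 1 else false

def prodQ (k : ℕ) : ℕ → ℕ :=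
  Nat.rec (fun lo => bif candQ lo then lo else 1)
    (fun k ih lo => Nat.mul (ih lo) (ih (Nat.add lo (Nat.pow 2 k)))) k

def cntQ (k : ℕ) : ℕ → ℕ :=
  Nat.rec (fun lo => bif candQ lo then 1 else 0)
    (fun k ih lo => Nat.add (ih lo) (ih (Nat.add lo (Nat.pow 2 k)))) k

theorem cntQ_val : Nat.beq (cntQ 15 0) 2828 = true := by decide +kernel

def checkQ (N : ℕ) : Bool := Nat.ble (Nat.add (Nat.pow 8192 N) 1) (prodQ 15 0)

theorem prodQ_val : checkQ 2828 = true := by decide +kernel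

theorem prodQ_eq (k lo : ℕ) :
    prodQ k lo = ∏ i ∈ Finset.range (2 ^ k), (bif candQ (lo + i) then lo + i else 1) := by
  induction k generalizing lo with
  | zero => simp [prodQ]
  | succ k ih =>
    have h : prodQ (k + 1) lo = prodQ k lo * prodQ k (lo + 2 ^ k) := rfl
    rw [h, ih, ih, pow_succ, mul_two, Finset.prod_range_add]
    simp only [add_assoc]

theorem cntQ_eq (k lo : ℕ) :
    cntQ k lo = ∑ i ∈ Finset.range (2 ^ k), (bif candQ (lo + i) then 1 else 0) := by
  induction k generalizing lo with
  | zero => simp [cntQ]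
  | succ k ih =>
    have h : cntQ (k + 1) lo = cntQ k lo + cntQ k (lo + 2 ^ k) := rfl
    rw [h, ih, ih, pow_succ, mul_two, Finset.sum_range_add]
    simp only [add_assoc]

def setQ : Finset ℕ := (Finset.range (2 ^ 15)).filter (fun n => candQ n = true)

theorem card_setQ : setQ.card = 2828 := by
  have h := Nat.eq_of_beq_eq_true cntQ_val
  rw [cntQ_eq] at h
  rw [setQ, Finset.card_filter, ← h]
  refine Finset.sum_congr rfl fun i _ => ?_
  rw [zero_add]
  cases candQ i <;> rfl

theorem prodQ_lt (N : ℕ) (h : checkQ N = true) : 8192 ^ N < prodQ 15 0 :=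
  Nat.le_of_ble_eq_true h

theorem prod_setQ : 8192 ^ 2828 < ∏ p ∈ setQ, p := by
  have h : 8192 ^ 2828 < prodQ 15 0 := prodQ_lt 2828 prodQ_val
  rw [prodQ_eq] at h
  refine lt_of_lt_of_eq h ?_
  rw [setQ, Finset.prod_filter]
  refine Finset.prod_congr rfl fun i _ => ?_
  rw [zero_add]
  cases candQ i <;> rfl

theorem bigQ_eq : bigQ = Nat.factorial 163 := by decide +kernel

theorem le_of_mem_setQ {n : ℕ} (h : n ∈ setQ) : n ≤ 25673 := by
  have h2 := (Finset.mem_filter.mp h).2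
  by_contra hn
  have e1 : Nat.ble n 13 = false := by
    rw [← Bool.not_eq_true, Nat.ble_eq]; omega
  have e2 : Nat.ble n 163 = false := by
    rw [← Bool.not_eq_true, Nat.ble_eq]; omega
  have e3 : Nat.ble n 25673 = false := by
    rw [← Bool.not_eq_true, Nat.ble_eq]; omega
  rw [candQ, e1, e2, e3] at h2
  exact absurd h2 Bool.false_ne_true

theorem mem_setQ {p : ℕ} (hp : p.Prime) (hle : p ≤ 25673) : p ∈ setQ := by
  refine Finset.mem_filter.mpr ⟨Finset.mem_range.mpr (by norm_num; omega), ?_⟩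
  by_cases h1 : p ≤ 13
  · interval_cases p <;> first | rfl | (exfalso; revert hp; norm_num)
  have e1 : Nat.ble p 13 = false := by
    rw [← Bool.not_eq_true, Nat.ble_eq]; omega
  by_cases h2 : p ≤ 163
  · have e2 : Nat.ble p 163 = true := Nat.ble_eq.mpr h2
    rw [candQ, e1, e2]
    have : Nat.gcd p (Nat.factorial 13) = 1 :=
      (Nat.Prime.coprime_iff_not_dvd hp).mpr (fun h => h1 ((Nat.Prime.dvd_factorial hp).mp h))
    have e : Nat.factorial 13 = 6227020800 := by decide +kernel
    rw [e] at this
    rw [this]; rfl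
  · have e2 : Nat.ble p 163 = false := by
      rw [← Bool.not_eq_true, Nat.ble_eq]; omega
    have e3 : Nat.ble p 25673 = true := Nat.ble_eq.mpr hle
    rw [candQ, e1, e2, e3]
    have : Nat.gcd p (Nat.factorial 163) = 1 :=
      (Nat.Prime.coprime_iff_not_dvd hp).mpr (fun h => h2 ((Nat.Prime.dvd_factorial hp).mp h))
    rw [← bigQ_eq] at this
    rw [this]; rfl

theorem exchangeQ (S P : Finset ℕ) (c : ℕ) (hP : ∀ p ∈ P, p ≤ c)
    (hS : ∀ p ∈ S, p ∉ P → c ≤ p) :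
    (∏ p ∈ P, p) * c ^ S.card ≤ (∏ p ∈ S, p) * c ^ P.card := by
  have a1 : ∏ p ∈ P \ S, p ≤ c ^ (P \ S).card :=
    Finset.prod_le_pow_card _ _ _ (fun p hp => hP p (Finset.mem_sdiff.mp hp).1)
  have a2 : c ^ (S \ P).card ≤ ∏ p ∈ S \ P, p :=
    Finset.pow_card_le_prod _ _ _ (fun p hp =>
      hS p (Finset.mem_sdiff.mp hp).1 (Finset.mem_sdiff.mp hp).2)
  have b1 := Finset.prod_inter_mul_prod_sdiff P S (fun p : ℕ => p)
  have b2 := Finset.prod_inter_mul_prod_sdiff S P (fun p : ℕ => p)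
  have c1 := Finset.card_inter_add_card_sdiff P S
  have c2 := Finset.card_inter_add_card_sdiff S P
  rw [Finset.inter_comm S P] at b2 c2
  rw [← b1, ← b2, ← c1, ← c2, pow_add, pow_add]
  calc _ = (∏ p ∈ P ∩ S, p) * c ^ (P ∩ S).card * ((∏ p ∈ P \ S, p) * c ^ (S \ P).card) := by ring
    _ ≤ (∏ p ∈ P ∩ S, p) * c ^ (P ∩ S).card * (c ^ (P \ S).card * ∏ p ∈ S \ P, p) :=
        Nat.mul_le_mul_left _ (Nat.mul_le_mul a1 a2)
    _ = _ := by ring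

theorem keyQ (M : ℕ) (hM : 0 < M) (hω : 2828 ≤ M.primeFactors.card) :
    8192 ^ M.primeFactors.card < M := by
  have h := exchangeQ M.primeFactors setQ 25673 (fun p hp => le_of_mem_setQ hp)
    (fun p hp hn => by
      by_contra hlt
      exact hn (mem_setQ (Nat.prime_of_mem_primeFactors hp) (by omega)))
  have hd : ∏ p ∈ M.primeFactors, p ≤ M := Nat.le_of_dvd hM (Nat.prod_primeFactors_dvd M)
  have hp := prod_setQ
  rw [card_setQ] at h
  obtain ⟨d, hd'⟩ := Nat.exists_eq_add_of_le hω
  rw [hd'] at h ⊢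
  generalize (∏ p ∈ setQ, p) = A at h hp
  generalize (∏ p ∈ M.primeFactors, p) = B at h hd
  generalize 2828 = N at h hp ⊢
  rw [pow_add] at h ⊢
  have h3 : A * 25673 ^ d ≤ B := by
    refine Nat.le_of_mul_le_mul_right (c := 25673 ^ N) ?_ (by positivity)
    calc _ = _ := by ring
      _ ≤ _ := h
  calc 8192 ^ N * 8192 ^ d < A * 8192 ^ d := Nat.mul_lt_mul_of_pos_right hp (by positivity)
    _ ≤ A * 25673 ^ d := Nat.mul_le_mul_left _ (Nat.pow_le_pow_left (by norm_num) d)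
    _ ≤ B := h3
    _ ≤ M := hd

theorem W_lt_rpow_of_many_primeFactors (M : ℕ) (hM : 0 < M)
    (h : 2828 ≤ M.primeFactors.card) :
    ((Wnat M : ℝ)) < (M : ℝ) ^ ((1 : ℝ) / 13) := by
  
  have h := keyQ M (by omega) (by assumption)
  have h' : ((8192 : ℝ)) ^ M.primeFactors.card < (M : ℝ) := by exact_mod_cast h
  have h2 : ((2 : ℝ) ^ M.primeFactors.card) = ((8192 : ℝ) ^ M.primeFactors.card) ^ ((1 : ℝ) / 13) := by
    have : (8192 : ℝ) ^ M.primeFactors.card = ((2 : ℝ) ^ M.primeFactors.card) ^ (13 : ℕ) := by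
      rw [← pow_mul, mul_comm, pow_mul]; norm_num
    rw [this, ← Real.rpow_natCast _ 13, ← Real.rpow_mul (by positivity)]
    norm_num
  have h3 : ((2 : ℝ) ^ M.primeFactors.card) < (M : ℝ) ^ ((1 : ℝ) / 13) := by
    rw [h2]
    exact Real.rpow_lt_rpow (by positivity) h' (by norm_num)
  simpa [Wnat] using h3
end

section
/- Let q be a prime power, n a positive integer, and n' = gcd(n, q−1). Then W(x^n − 1) ≤ 2^{(n+n')/2}, and in particular W(x^n − 1) ≤ 2^n. Moreover, W(x^n − 1) = 2^n if and only if n | q − 1; and if n ∤ q − 1, then W(x^n − 1) ≤ 2^{3n/4}. -/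
open Polynomial

theorem aux_finite {Fq : Type} [Field Fq] {g : Polynomial Fq} (hg : g ≠ 0) :
    {p : Polynomial Fq | p.Monic ∧ Irreducible p ∧ p ∣ g}.Finite := by
  classical
  refine Set.Finite.subset (UniqueFactorizationMonoid.normalizedFactors g).toFinset.finite_toSet ?_
  rintro p ⟨h1, h2, h3⟩
  simp only [Finset.mem_coe, Multiset.mem_toFinset]
  rw [UniqueFactorizationMonoid.mem_normalizedFactors_iff' hg]
  exact ⟨h2, h1.normalize_eq_self, h3⟩

theorem aux_linear {Fq : Type} [Field Fq] [Fintype Fq] {n : ℕ} (hn : 0 < n) :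
    {p : Polynomial Fq | (p.Monic ∧ Irreducible p ∧ p ∣ X ^ n - 1) ∧ p.natDegree = 1}.ncard
      = Nat.gcd n (Fintype.card Fq - 1) := by
  classical
  have h : {p : Polynomial Fq | (p.Monic ∧ Irreducible p ∧ p ∣ X ^ n - 1) ∧ p.natDegree = 1}
      = (fun u : Fqˣ => (X - C (u : Fq) : Polynomial Fq)) ''
        ((powMonoidHom n : Fqˣ →* Fqˣ).ker : Set Fqˣ) := by
    ext p
    simp only [Set.mem_setOf_eq, Set.mem_image, SetLike.mem_coe, MonoidHom.mem_ker,
      powMonoidHom_apply]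
    constructor
    · rintro ⟨⟨h1, h2, h3⟩, h4⟩
      have hp : p = X - C (-p.coeff 0) := by
        rw [C_neg, sub_neg_eq_add]; exact h1.eq_X_add_C h4
      rw [hp, dvd_iff_isRoot] at h3
      have h5 : (-p.coeff 0) ^ n = 1 := by
        simpa [IsRoot, sub_eq_zero] using h3
      have h6 : -p.coeff 0 ≠ 0 := by
        intro h0
        rw [h0, zero_pow hn.ne'] at h5
        exact zero_ne_one h5
      refine ⟨Units.mk0 _ h6, ?_, ?_⟩
      · ext; simpa using h5
      · simpa using hp.symm
    · rintro ⟨u, hu, rfl⟩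
      refine ⟨⟨monic_X_sub_C _, irreducible_X_sub_C _, ?_⟩, natDegree_X_sub_C _⟩
      rw [dvd_iff_isRoot]
      have : (u : Fq) ^ n = 1 := by rw [← Units.val_pow_eq_pow_val, hu]; rfl
      simp [IsRoot, this]
  rw [h, Set.ncard_image_of_injective]
  · have := IsCyclic.card_powMonoidHom_ker Fqˣ n
    rw [Nat.card_units, Nat.card_eq_fintype_card (α := Fq), Nat.gcd_comm] at this
    rw [← this]; rfl
  · intro u v huv
    have : C (u : Fq) = C (v : Fq) := sub_right_injective huv
    exact Units.ext (C_injective this)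

theorem aux_bound {Fq : Type} [Field Fq] [Fintype Fq] {n : ℕ} (hn : 0 < n) :
    2 * omegaPoly (X ^ n - 1 : Polynomial Fq) ≤ n + Nat.gcd n (Fintype.card Fq - 1) ∧
    Nat.gcd n (Fintype.card Fq - 1) ≤ omegaPoly (X ^ n - 1 : Polynomial Fq) := by
  classical
  have hg : (X ^ n - 1 : Polynomial Fq) ≠ 0 := (monic_X_pow_sub_C (1 : Fq) hn.ne').ne_zero
  have hf := aux_finite hg
  rw [← aux_linear (Fq := Fq) hn]
  unfold omegaPoly
  refine ⟨?_, Set.ncard_le_ncard (fun p hp => hp.1) hf⟩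
  obtain ⟨S, hS⟩ := hf.exists_finset
  have e1 : {p : Polynomial Fq | p.Monic ∧ Irreducible p ∧ p ∣ X ^ n - 1} = S := by
    ext p; simp [hS]
  have e2 : {p : Polynomial Fq | (p.Monic ∧ Irreducible p ∧ p ∣ X ^ n - 1) ∧ p.natDegree = 1}
      = ((S.filter fun p => p.natDegree = 1 : Finset _) : Set (Polynomial Fq)) := by
    ext p; simp [hS]
  rw [e1, e2, Set.ncard_coe_finset, Set.ncard_coe_finset]
  have hd : (∏ p ∈ S, p) ∣ X ^ n - 1 := by
    refine Finset.prod_dvd_of_coprime ?_ (fun p hp => ((hS p).1 hp).2.2)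
    intro p hp r hr hpr
    have h1 := (hS p).1 hp
    have h2 := (hS r).1 hr
    refine (h1.2.1.coprime_iff_not_dvd).2 fun h => hpr ?_
    exact eq_of_monic_of_associated h1.1 h2.1 (h1.2.1.associated_of_dvd h2.2.1 h)
  have hdeg := natDegree_le_of_dvd hd hg
  rw [natDegree_prod_of_monic _ _ (fun p hp => ((hS p).1 hp).1)] at hdeg
  have e3 : (X ^ n - 1 : Polynomial Fq).natDegree = n := natDegree_X_pow_sub_C (r := (1 : Fq))
  rw [e3] at hdeg
  have key : ∑ p ∈ S, 2 ≤ ∑ p ∈ S, (p.natDegree + if p.natDegree = 1 then 1 else 0) := by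
    refine Finset.sum_le_sum fun p hp => ?_
    have := ((hS p).1 hp).2.1.natDegree_pos
    split_ifs <;> omega
  rw [Finset.sum_add_distrib, ← Finset.card_filter, Finset.sum_const, smul_eq_mul] at key
  omega

theorem Wpoly_X_pow_sub_one_bounds (q n : ℕ)
    (hq : ∃ p k : ℕ, p.Prime ∧ 0 < k ∧ q = p ^ k) (hn : 0 < n)
    (Fq : Type) [Field Fq] [Fintype Fq] (hcard : Fintype.card Fq = q)
    (n' : ℕ) (hn' : n' = Nat.gcd n (q - 1)) :
    (Wpoly (X ^ n - 1 : Polynomial Fq) : ℝ) ≤ (2 : ℝ) ^ (((n : ℝ) + (n' : ℝ)) / 2) ∧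
    Wpoly (X ^ n - 1 : Polynomial Fq) ≤ 2 ^ n ∧
    (Wpoly (X ^ n - 1 : Polynomial Fq) = 2 ^ n ↔ n ∣ q - 1) ∧
    (¬ n ∣ q - 1 →
      (Wpoly (X ^ n - 1 : Polynomial Fq) : ℝ) ≤ (2 : ℝ) ^ (3 * (n : ℝ) / 4)) := by
  obtain ⟨h1, h2⟩ := aux_bound (Fq := Fq) hn
  rw [hcard, ← hn'] at h1 h2
  have hle : n' ≤ n := hn' ▸ Nat.gcd_le_left _ hn
  have hhalf : ¬ n ∣ q - 1 → 2 * n' ≤ n := by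
    intro h
    obtain ⟨c, hc⟩ : n' ∣ n := hn' ▸ Nat.gcd_dvd_left _ _
    have hne : n' ≠ n := fun h' => h (by rw [← h', hn']; exact Nat.gcd_dvd_right _ _)
    rcases c with _ | _ | c
    · omega
    · exact absurd (by rw [hc]; simp) hne
    · rw [hc]; nlinarith [Nat.zero_le (n' * c)]
  unfold Wpoly
  generalize omegaPoly (X ^ n - 1 : Polynomial Fq) = w at *
  have hcast : ((2 ^ w : ℕ) : ℝ) = (2 : ℝ) ^ (w : ℝ) := by
    rw [Real.rpow_natCast]; push_cast; rfl
  rw [hcast]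
  refine ⟨?_, ?_, ?_, ?_⟩
  · refine Real.rpow_le_rpow_of_exponent_le one_le_two ?_
    have : (2 * w : ℝ) ≤ n + n' := by exact_mod_cast h1
    linarith
  · exact Nat.pow_le_pow_right two_pos (by omega)
  · constructor
    · intro h
      have hw := Nat.pow_right_injective le_rfl h
      by_contra hnd
      have := hhalf hnd
      omega
    · intro h
      have : n' = n := by rw [hn']; exact Nat.gcd_eq_left h
      have : w = n := by omega
      rw [this]
  · intro h
    refine Real.rpow_le_rpow_of_exponent_le one_le_two ?_
    have h3 := hhalf h
    have : (4 * w : ℝ) ≤ 3 * n := by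
      have : 4 * w ≤ 3 * n := by omega
      exact_mod_cast this
    linarith
end

section
/- (Weil bound for multiplicative character sums of rational functions) Let F_{q^n} be a finite field with q^n elements, and let f(x) = Π_{i=1}^r f_i(x)^{a_i} ∈ F_{q^n}(x) where the f_i are distinct irreducible polynomials over F_{q^n} and the a_i are nonzero integers. Let χ be a multiplicative character of F_{q^n} of order d, extended to 0 by χ(0) = 0 if χ is nontrivial and χ(0) = 1 if χ is trivial. If f is not of the form c·h(x)^d for any c ∈ F_{q^n}^* and h(x) ∈ F_{q^n}(x), then |Σ_{ε ∈ F_{q^n}, f(ε) ≠ ∞} χ(f(ε))| ≤ (Σ_{i=1}^r deg(f_i) − 1) · q^{n/2}, where the sum ranges over those ε ∈ F_{q^n} that are not poles of f. -/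
open Polynomial

theorem kummer_irred {E : Type*} [Field E] {d : ℕ} (hd : 0 < d) {ζ : E} (hζ : IsPrimitiveRoot ζ d)
    {a : E} (ha : a ≠ 0) (h : ∀ l, l ∣ d → l ≠ 1 → ∀ b : E, b ^ l ≠ a) :
    Irreducible (X ^ d - C a : E[X]) := by
  obtain ⟨y, hy⟩ := IsAlgClosed.exists_pow_nat_eq (algebraMap E (AlgebraicClosure E) a) hd
  have hint : IsIntegral E y := Algebra.IsIntegral.isIntegral y
  have hy0 : y ≠ 0 := by
    rintro rfl
    rw [zero_pow hd.ne'] at hy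
    exact ha ((map_eq_zero _).1 hy.symm)
  have hdvd : minpoly E y ∣ (X ^ d - C a : E[X]) := by
    apply minpoly.dvd
    simp [hy]
  have hmon : (X ^ d - C a : E[X]).Monic := monic_X_pow_sub_C a hd.ne'
  have hdeg : (X ^ d - C a : E[X]).natDegree = d := natDegree_X_pow_sub_C
  have hle : (minpoly E y).natDegree ≤ d := by
    rw [← hdeg]; exact natDegree_le_of_dvd hdvd hmon.ne_zero
  rcases hle.lt_or_eq with hlt | heq
  · exfalso
    set s := (minpoly E y).natDegree with hs
    have hspos : 0 < s := minpoly.natDegree_pos hint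
    have hroot : ∀ r ∈ ((minpoly E y).map (algebraMap E (AlgebraicClosure E))).roots,
        ∃ t : E, r = algebraMap E _ t * y := by
      intro r hr
      have hr' : r ^ d = y ^ d := by
        have := (mem_roots'.1 hr).2
        rw [IsRoot, eval_map_algebraMap] at this
        have h2 : aeval r (X ^ d - C a : E[X]) = 0 := by
          obtain ⟨w, hw⟩ := hdvd
          rw [hw, map_mul, this, zero_mul]
        rw [hy]
        simpa [sub_eq_zero] using h2
      have : (r / y) ^ d = 1 := by
        rw [div_pow, hr', div_self (pow_ne_zero _ hy0)]
      have hζ' : IsPrimitiveRoot (algebraMap E (AlgebraicClosure E) ζ) d :=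
        hζ.map_of_injective (algebraMap E _).injective
      have _inst : NeZero d := ⟨hd.ne'⟩
      obtain ⟨i, -, hi⟩ := hζ'.eq_pow_of_pow_eq_one this
      exact ⟨ζ ^ i, by rw [map_pow, hi, div_mul_cancel₀ _ hy0]⟩
    have hprod : ∀ m : Multiset (AlgebraicClosure E),
        (∀ r ∈ m, ∃ t : E, r = algebraMap E _ t * y) →
        ∃ t : E, m.prod = algebraMap E _ t * y ^ (Multiset.card m) := by
      intro m
      induction m using Multiset.induction_on with
      | empty => intro _; exact ⟨1, by simp⟩
      | cons r m ih =>
        intro hm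
        obtain ⟨t, ht⟩ := hm r (Multiset.mem_cons_self _ _)
        obtain ⟨t', ht'⟩ := ih fun r hr => hm r (Multiset.mem_cons_of_mem hr)
        exact ⟨t * t', by rw [Multiset.prod_cons, ht, ht', Multiset.card_cons, map_mul]; ring⟩
    obtain ⟨t, ht⟩ := hprod _ hroot
    have hsplit := IsAlgClosed.splits ((minpoly E y).map (algebraMap E (AlgebraicClosure E)))
    have hcard := hsplit.natDegree_eq_card_roots
    rw [natDegree_map] at hcard
    have hc0 := hsplit.coeff_zero_eq_prod_roots_of_monic ((minpoly.monic hint).map _)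
    rw [← hcard, ← hs] at ht
    rw [ht, coeff_map] at hc0
    have hys : y ^ s ∈ (algebraMap E (AlgebraicClosure E)).fieldRange := by
      have hne : (minpoly E y).coeff 0 ≠ 0 := minpoly.coeff_zero_ne_zero hint hy0
      have ht0 : algebraMap E (AlgebraicClosure E) t ≠ 0 := by
        intro h0
        rw [h0] at hc0
        simp at hc0
        exact hne hc0
      have : y ^ s = algebraMap E _ ((minpoly E y).coeff 0 * (-1) ^ s / t) := by
        rw [map_div₀, map_mul, hc0, natDegree_map, ← hs]
        simp only [map_pow, map_neg, map_one]
        field_simp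
        rw [← pow_mul, mul_comm, pow_mul]; simp
      rw [this]; exact ⟨_, rfl⟩
    have hyd : y ^ d ∈ (algebraMap E (AlgebraicClosure E)).fieldRange := ⟨a, hy.symm⟩
    have hyg : y ^ (Nat.gcd s d) ∈ (algebraMap E (AlgebraicClosure E)).fieldRange := by
      have hb := Nat.gcd_eq_gcd_ab s d
      have : y ^ (Nat.gcd s d) = (y ^ s) ^ (Nat.gcdA s d) * (y ^ d) ^ (Nat.gcdB s d) := by
        rw [← zpow_natCast, hb, zpow_add₀ hy0, zpow_mul, zpow_mul, zpow_natCast, zpow_natCast]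
      rw [this]
      exact mul_mem (zpow_mem hys _) (zpow_mem hyd _)
    obtain ⟨b, hb⟩ := hyg
    have hg : Nat.gcd s d ∣ d := Nat.gcd_dvd_right s d
    obtain ⟨l, hl⟩ := hg
    refine h l ⟨Nat.gcd s d, by rw [mul_comm]; exact hl⟩ ?_ b ?_
    · rintro rfl
      have := Nat.gcd_le_left d hspos
      omega
    · apply (algebraMap E (AlgebraicClosure E)).injective
      rw [map_pow, hb, ← pow_mul, ← hl, hy]
  · have : X ^ d - C a = minpoly E y :=
      eq_of_monic_of_dvd_of_natDegree_le (minpoly.monic hint) hmon hdvd (by rw [hdeg, heq])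
    rw [this]
    exact minpoly.irreducible hint

theorem kummer_prime {K : Type*} [Field K] [IsAlgClosed K] {d : ℕ} (hd : 0 < d) (hdK : (d : K) ≠ 0)
    {h : K[X]} (hmon : h.Monic) (hpow : ∀ l, l ∣ d → l ≠ 1 → ∀ b : K[X], b.Monic → b ^ l ≠ h)
    {c : K} (hc : c ≠ 0) :
    Prime (X ^ d - C (C c * h ^ (d - 1)) : K[X][X]) := by
  rw [← UniqueFactorizationMonoid.irreducible_iff_prime]
  have hm : (X ^ d - C (C c * h ^ (d - 1)) : K[X][X]).Monic := monic_X_pow_sub_C _ hd.ne'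
  rw [hm.irreducible_iff_irreducible_map_fraction_map (K := RatFunc K)]
  simp only [Polynomial.map_sub, Polynomial.map_pow, Polynomial.map_X, Polynomial.map_C]
  have _inst : NeZero (d : K) := ⟨hdK⟩
  obtain ⟨ζ, hζ⟩ := HasEnoughRootsOfUnity.exists_primitiveRoot K d
  have hζ' : IsPrimitiveRoot (algebraMap K[X] (RatFunc K) (C ζ)) d :=
    (hζ.map_of_injective (C_injective)).map_of_injective (RatFunc.algebraMap_injective K)
  have hinj := RatFunc.algebraMap_injective K
  have hh0 : algebraMap K[X] (RatFunc K) h ≠ 0 := by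
    rw [Ne, map_eq_zero_iff _ hinj]; exact hmon.ne_zero
  apply kummer_irred hd hζ'
  · rw [Ne, map_eq_zero_iff _ hinj]
    exact mul_ne_zero (C_ne_zero.2 hc) (pow_ne_zero _ hmon.ne_zero)
  · intro l hl hl1 b hb
    have hlpos : 0 < l := Nat.pos_of_dvd_of_pos hl hd
    obtain ⟨e, he⟩ := hl
    obtain ⟨γ, hγ⟩ := IsAlgClosed.exists_pow_nat_eq c hlpos
    -- w ^ l = h
    have hw : ∃ w : RatFunc K, w ^ l = algebraMap _ _ h := by
      have hb0 : b ≠ 0 := by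
        rintro rfl
        rw [zero_pow hlpos.ne', eq_comm, map_eq_zero_iff _ hinj] at hb
        exact mul_ne_zero (C_ne_zero.2 hc) (pow_ne_zero _ hmon.ne_zero) hb
      refine ⟨algebraMap _ _ (C γ) * algebraMap _ _ h ^ e / b, ?_⟩
      rw [div_pow, hb, mul_pow, ← map_pow, ← C_pow, hγ, ← pow_mul, mul_comm e l, ← he, map_mul,
        map_pow]
      have hc0 : algebraMap K[X] (RatFunc K) (C c) ≠ 0 := by
        rw [Ne, map_eq_zero_iff _ hinj]; exact C_ne_zero.2 hc
      obtain ⟨d', rfl⟩ : ∃ d', d = d' + 1 := ⟨d - 1, by omega⟩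
      field_simp
      simp [pow_succ]
    obtain ⟨w, hw⟩ := hw
    have hwint : IsIntegral K[X] w := by
      refine ⟨X ^ l - C h, monic_X_pow_sub_C _ hlpos.ne', ?_⟩
      simp [hw]
    obtain ⟨v, rfl⟩ := IsIntegrallyClosed.isIntegral_iff.1 hwint
    rw [← map_pow] at hw
    have hv := hinj hw
    have hv0 : v ≠ 0 := by
      rintro rfl
      rw [zero_pow hlpos.ne'] at hv
      exact hmon.ne_zero hv.symm
    refine hpow l ⟨e, he⟩ hl1 (v * C (v.leadingCoeff)⁻¹) (monic_mul_leadingCoeff_inv hv0) ?_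
    have hlc : v.leadingCoeff ^ l = 1 := by
      rw [← leadingCoeff_pow, hv]; exact hmon
    rw [mul_pow, hv, ← C_pow, inv_pow, hlc]; simp

theorem cyc_mul {R : Type*} [CommRing R] {d : ℕ} [NeZero d] (β : Fin d → R) (A z : R)
    (hz : z ^ d = A) (s : Fin d) :
    (∑ i, β i * z ^ (i : ℕ)) * z ^ (s : ℕ) =
      ∑ r, (β (r - s) * (if s ≤ r then 1 else A)) * z ^ (r : ℕ) := by
  rw [Finset.sum_mul, ← Equiv.sum_comp (Equiv.subRight s)]
  apply Finset.sum_congr rfl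
  intro r _
  simp only [Equiv.subRight_apply]
  rw [mul_assoc, mul_assoc, ← pow_add]
  congr 1
  split_ifs with h
  · rw [Fin.sub_val_of_le h, one_mul]
    congr 1
    have : (s : ℕ) ≤ r := h
    omega
  · rw [← hz, ← pow_add]
    congr 1
    have h' : r < s := not_le.1 h
    rw [Fin.coe_sub_iff_lt.2 h']
    omega

theorem polyOf_dvd {A : Type*} [CommRing A] [IsDomain A] {d : ℕ} {a : A} (β : Fin d → A) (hd : 0 < d)
    (h : (X ^ d - C a : A[X]) ∣ ∑ i, C (β i) * X ^ (i : ℕ)) : β = 0 := by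
  have hmon : (X ^ d - C a : A[X]).Monic := monic_X_pow_sub_C a hd.ne'
  have h0 : (∑ i, C (β i) * X ^ (i : ℕ) : A[X]) = 0 := by
    apply eq_zero_of_dvd_of_degree_lt h
    rw [degree_X_pow_sub_C hd]
    refine lt_of_le_of_lt (degree_sum_le _ _) ?_
    rw [Finset.sup_lt_iff (by exact WithBot.bot_lt_coe _)]
    intro i _
    refine lt_of_le_of_lt (degree_C_mul_X_pow_le _ _) ?_
    exact_mod_cast i.2
  funext i
  have := congrArg (fun p => coeff p (i : ℕ)) h0
  simp only [finsetSum_coeff, coeff_C_mul, coeff_X_pow, coeff_zero] at this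
  rw [Finset.sum_eq_single i] at this
  · simpa using this
  · intro j _ hj
    rw [if_neg, mul_zero]
    intro h; exact hj (Fin.ext h.symm)
  · simp

theorem stepanov_indep {K : Type*} [Field K] (p n q d m κ : ℕ) [Fact p.Prime] [CharP K p] [NeZero d]
    (hq : q = p ^ n) (hdq : d ∣ q - 1) (h : K[X]) (hm : h.natDegree ≤ m) (x0 : K)
    (hx0 : h.eval x0 ≠ 0)
    (hprime : ∀ c : K, c ≠ 0 → Prime (X ^ d - C (C c * h ^ (d - 1)) : K[X][X]))
    (hκ : d * (κ + 2 * d * m) ≤ q) (k : Fin d → K[X]) (hk : ∀ i, (k i).natDegree < κ)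
    (hdiv : (X - C x0) ^ q ∣ ∑ i, k i * (h ^ ((q - 1) / d)) ^ (i : ℕ)) : ∀ i, k i = 0 := by
  have hd : 0 < d := Nat.pos_of_neZero d
  have hh0 : h ≠ 0 := by rintro rfl; simp at hx0
  have hqpos : 0 < q := by rw [hq]; exact pow_pos (Fact.out (p := p.Prime)).pos _
  set g := h ^ ((q - 1) / d) with hg
  set A : K[X] := C ((h.eval x0) ^ q) * h ^ (d - 1) with hA
  set β : Fin d → K[X] := fun i => k i * h ^ (d - 1 - (i : ℕ)) with hβ
  set T : Matrix (Fin d) (Fin d) K[X] :=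
    Matrix.of fun s r => β (r - s) * (if s ≤ r then 1 else A) with hT
  have hdvd : (X - C x0) ^ q ∣ h ^ q - C ((h.eval x0) ^ q) := by
    have : h ^ q - C ((h.eval x0) ^ q) = (h - C (h.eval x0)) ^ q := by
      rw [hq, sub_pow_char_pow, ← C_pow]
    rw [this]
    exact pow_dvd_pow_of_dvd (X_sub_C_dvd_sub_C_eval) q
  have hgd : (h * g) ^ d = h ^ q * h ^ (d - 1) := by
    rw [hg, mul_pow, ← pow_mul, Nat.div_mul_cancel hdq, ← pow_add, ← pow_add]
    congr 1; omega
  have hdet0 : T.det = 0 := by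
    have hdd : (X - C x0) ^ q ∣ T.det := by
      rw [← Ideal.mem_span_singleton, ← Ideal.Quotient.eq_zero_iff_mem]
      set φ := Ideal.Quotient.mk (Ideal.span {(X - C x0) ^ q}) with hφ
      have hz : (φ (h * g)) ^ d = φ A := by
        rw [← map_pow, hgd, hA, Ideal.Quotient.eq, Ideal.mem_span_singleton, ← sub_mul]
        exact dvd_mul_of_dvd_left hdvd _
      have hB : ∑ i, φ (β i) * (φ (h * g)) ^ (i : ℕ) = 0 := by
        have : ∑ i, φ (β i) * (φ (h * g)) ^ (i : ℕ) =
            φ (h ^ (d - 1) * ∑ i, k i * g ^ (i : ℕ)) := by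
          rw [Finset.mul_sum, map_sum]
          apply Finset.sum_congr rfl
          intro i _
          rw [← map_pow, ← map_mul]
          congr 1
          have : h ^ (d - 1) = h ^ (d - 1 - (i : ℕ)) * h ^ (i : ℕ) := by
            rw [← pow_add]; congr 1; omega
          rw [hβ, this]; ring
        rw [this, Ideal.Quotient.eq_zero_iff_mem, Ideal.mem_span_singleton]
        exact dvd_mul_of_dvd_right hdiv _
      have hTv : (T.map φ).mulVec (fun r : Fin d => (φ (h * g)) ^ (r : ℕ)) = 0 := by
        funext s
        have := cyc_mul (fun i => φ (β i)) (φ A) (φ (h * g)) hz s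
        rw [hB, zero_mul] at this
        simp only [Matrix.mulVec, dotProduct, Matrix.map_apply, hT, Matrix.of_apply,
          map_mul, Pi.zero_apply]
        rw [this]
        apply Finset.sum_congr rfl
        intro r _
        rw [← map_mul φ h g]
        split_ifs <;> simp
      have h1 := congrArg ((T.map φ).adjugate.mulVec) hTv
      rw [Matrix.mulVec_mulVec, Matrix.adjugate_mul, Matrix.mulVec_zero, Matrix.smul_mulVec,
        Matrix.one_mulVec] at h1
      have h2 := congrFun h1 (⟨0, hd⟩ : Fin d)
      simp only [Pi.smul_apply, pow_zero, smul_eq_mul, mul_one, Pi.zero_apply] at h2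
      rw [RingHom.map_det]
      exact h2
    apply eq_zero_of_dvd_of_natDegree_lt hdd
    rw [natDegree_pow, natDegree_X_sub_C, mul_one]
    have hent : ∀ s r, (T s r).natDegree ≤ κ - 1 + 2 * d * m := by
      intro s r
      have h1 : (β (r - s)).natDegree ≤ κ - 1 + d * m := by
        refine natDegree_mul_le.trans (add_le_add (Nat.le_sub_one_of_lt (hk _)) ?_)
        exact natDegree_pow_le.trans (Nat.mul_le_mul (by omega) hm)
      have h2 : A.natDegree ≤ d * m := by
        refine (natDegree_C_mul_le _ _).trans ?_
        exact natDegree_pow_le.trans (Nat.mul_le_mul (by omega) hm)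
      simp only [hT, Matrix.of_apply]
      refine natDegree_mul_le.trans ?_
      have : (if s ≤ r then (1 : K[X]) else A).natDegree ≤ d * m := by
        split_ifs
        · simp
        · exact h2
      calc _ ≤ (κ - 1 + d * m) + d * m := add_le_add h1 this
        _ = _ := by ring
    have hκ1 : 0 < κ := lt_of_le_of_lt (Nat.zero_le _) (hk ⟨0, hd⟩)
    have : T.det.natDegree ≤ d * (κ - 1 + 2 * d * m) := by
      rw [Matrix.det_apply]
      apply natDegree_sum_le_of_forall_le
      intro σ _
      refine (natDegree_smul_le _ _).trans ?_
      refine (natDegree_prod_le _ _).trans ?_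
      refine (Finset.sum_le_card_nsmul _ _ (κ - 1 + 2 * d * m) fun i _ => hent _ _).trans ?_
      simp
    refine lt_of_le_of_lt this (lt_of_lt_of_le ?_ hκ)
    apply Nat.mul_lt_mul_of_pos_left _ hd
    omega
  obtain ⟨w, hw0, hw⟩ := Matrix.exists_vecMul_eq_zero_iff.2 hdet0
  have hP := hprime _ (pow_ne_zero q hx0)
  rw [← hA] at hP
  have hmul : (X ^ d - C A : K[X][X]) ∣
      (∑ i, C (w i) * X ^ (i : ℕ)) * (∑ i, C (β i) * X ^ (i : ℕ)) := by
    rw [← AdjoinRoot.mk_eq_zero]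
    have hz : (AdjoinRoot.root (X ^ d - C A)) ^ d = AdjoinRoot.of (X ^ d - C A) A := by
      have := AdjoinRoot.eval₂_root (X ^ d - C A)
      simpa [sub_eq_zero] using this
    set φ := AdjoinRoot.of (X ^ d - C A)
    set z := AdjoinRoot.root (X ^ d - C A)
    simp only [map_mul, map_sum, map_pow, AdjoinRoot.mk_C, AdjoinRoot.mk_X]
    rw [Finset.sum_mul]
    have : ∀ s : Fin d, φ (w s) * z ^ (s : ℕ) * ∑ i, φ (β i) * z ^ (i : ℕ) =
        ∑ r, φ (w s * T s r) * z ^ (r : ℕ) := by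
      intro s
      rw [mul_assoc, mul_comm (z ^ (s : ℕ)), cyc_mul _ (φ A) z hz s, Finset.mul_sum]
      apply Finset.sum_congr rfl
      intro r _
      simp only [hT, Matrix.of_apply, map_mul]
      split_ifs
      · rw [map_one]; ring
      · ring
    rw [Finset.sum_congr rfl fun s _ => this s, Finset.sum_comm]
    apply Finset.sum_eq_zero
    intro r _
    rw [← Finset.sum_mul, ← map_sum]
    have := congrFun hw r
    simp only [Matrix.vecMul, dotProduct, Pi.zero_apply] at this
    rw [this]; simp
  rcases hP.dvd_or_dvd hmul with h1 | h1
  · exact absurd (polyOf_dvd _ hd h1) hw0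
  · have := polyOf_dvd _ hd h1
    intro i
    have := congrFun this i
    simp only [hβ, Pi.zero_apply, mul_eq_zero] at this
    exact this.resolve_right (pow_ne_zero _ hh0)

theorem hasse_pow {K : Type*} [Field K] (h : K[X]) (m : ℕ) (hm : h.natDegree ≤ m) (s : ℕ) :
    ∀ t : ℕ, ∃ w : K[X], w.natDegree ≤ t * m ∧ hasseDeriv t (h ^ s) = h ^ (s - t) * w := by
  induction s with
  | zero =>
    intro t
    refine ⟨hasseDeriv t 1, ?_, by simp⟩
    refine (natDegree_hasseDeriv_le _ _).trans ?_
    simp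
  | succ s ih =>
    intro t
    rcases Nat.lt_or_ge s t with hst | hst
    · refine ⟨hasseDeriv t (h ^ (s + 1)), ?_, ?_⟩
      · refine (natDegree_hasseDeriv_le _ _).trans ((Nat.sub_le _ _).trans ?_)
        exact natDegree_pow_le.trans (Nat.mul_le_mul hst hm)
      · rw [show s + 1 - t = 0 by omega]; simp
    · choose w hw1 hw2 using ih
      refine ⟨∑ x ∈ Finset.HasAntidiagonal.antidiagonal t,
        if x.1 = 0 then w x.2 else
          hasseDeriv x.1 h * h ^ ((s - x.2) - (s + 1 - t)) * w x.2, ?_, ?_⟩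
      · apply natDegree_sum_le_of_forall_le
        rintro ⟨a, b⟩ hx
        rw [Finset.HasAntidiagonal.mem_antidiagonal] at hx
        simp only at hx ⊢
        split_ifs with ha
        · refine (hw1 b).trans (Nat.mul_le_mul_right _ (by omega))
        · refine natDegree_mul_le.trans ?_
          have h1 : (hasseDeriv a h).natDegree ≤ m :=
            (natDegree_hasseDeriv_le _ _).trans ((Nat.sub_le _ _).trans hm)
          have h2 : (h ^ ((s - b) - (s + 1 - t))).natDegree ≤ (a - 1) * m :=
            natDegree_pow_le.trans (Nat.mul_le_mul (by omega) hm)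
          have h3 := natDegree_mul_le (p := hasseDeriv a h) (q := h ^ ((s - b) - (s + 1 - t)))
          have h4 := hw1 b
          have : t * m = m + (a - 1) * m + b * m := by
            rw [← hx]
            obtain ⟨a', rfl⟩ : ∃ a', a = a' + 1 := ⟨a - 1, by omega⟩
            simp; ring
          omega
      · rw [pow_succ', hasseDeriv_mul, Finset.mul_sum]
        apply Finset.sum_congr rfl
        rintro ⟨a, b⟩ hx
        rw [Finset.HasAntidiagonal.mem_antidiagonal] at hx
        simp only at hx ⊢
        rw [hw2 b]
        split_ifs with ha
        · subst ha
          rw [hasseDeriv_zero', ← mul_assoc, ← pow_succ']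
          congr 2; omega
        · have : h ^ (s - b) = h ^ (s + 1 - t) * h ^ ((s - b) - (s + 1 - t)) := by
            rw [← pow_add]; congr 1; omega
          rw [this]; ring

theorem hasse_mul_pow {K : Type*} [Field K] (h : K[X]) (m : ℕ) (hm : h.natDegree ≤ m) (k : K[X])
    (s l : ℕ) :
    ∃ w : K[X], w.natDegree ≤ k.natDegree + l * m ∧
      hasseDeriv l (k * h ^ s) = h ^ (s - l) * w := by
  choose w hw1 hw2 using hasse_pow h m hm s
  refine ⟨∑ x ∈ Finset.HasAntidiagonal.antidiagonal l, hasseDeriv x.1 k * h ^ ((s - x.2) - (s - l)) * w x.2, ?_, ?_⟩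
  · apply natDegree_sum_le_of_forall_le
    rintro ⟨a, b⟩ hx
    rw [Finset.HasAntidiagonal.mem_antidiagonal] at hx
    simp only at hx ⊢
    refine natDegree_mul_le.trans ?_
    have h1 : (hasseDeriv a k).natDegree ≤ k.natDegree :=
      (natDegree_hasseDeriv_le _ _).trans (Nat.sub_le _ _)
    have h2 : (h ^ ((s - b) - (s - l))).natDegree ≤ a * m :=
      natDegree_pow_le.trans (Nat.mul_le_mul (by omega) hm)
    have h3 := natDegree_mul_le (p := hasseDeriv a k) (q := h ^ ((s - b) - (s - l)))
    have h4 := hw1 b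
    have : l * m = a * m + b * m := by rw [← hx]; ring
    omega
  · rw [hasseDeriv_mul, Finset.mul_sum]
    apply Finset.sum_congr rfl
    rintro ⟨a, b⟩ hx
    rw [Finset.HasAntidiagonal.mem_antidiagonal] at hx
    simp only at hx ⊢
    rw [hw2 b]
    have : h ^ (s - b) = h ^ (s - l) * h ^ ((s - b) - (s - l)) := by
      rw [← pow_add]; congr 1; omega
    rw [this]; ring

theorem hasse_frob {K : Type*} [Field K] (p n q : ℕ) [Fact p.Prime] [CharP K p] (hq : q = p ^ n)
    (v : K[X]) (x0 a : K) (j l : ℕ) (hl : l < q) :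
    (hasseDeriv l (v * (X - C x0) ^ (q * j))).eval a =
      (hasseDeriv l v).eval a * (a - x0) ^ (q * j) := by
  have key : ∀ b, 0 < b → b < q → (hasseDeriv b ((X - C x0) ^ (q * j))).eval a = 0 := by
    intro b hb hbq
    rw [← taylor_coeff]
    have : taylor a ((X - C x0) ^ (q * j)) = expand K q ((X + C ((a - x0) ^ q)) ^ j) := by
      rw [taylor_pow, pow_mul, map_sub, taylor_X, taylor_C, add_sub_assoc, ← C_sub, map_pow, map_add,
        expand_X, expand_C, hq, add_pow_char_pow, C_pow]
    rw [this, coeff_expand (by omega), if_neg]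
    exact Nat.not_dvd_of_pos_of_lt hb hbq
  rw [hasseDeriv_mul, eval_finsetSum, Finset.sum_eq_single (l, 0)]
  · simp
  · rintro ⟨x, y⟩ hx hne
    rw [Finset.HasAntidiagonal.mem_antidiagonal] at hx
    simp only at hx
    rw [eval_mul, key y, mul_zero]
    · rcases Nat.eq_zero_or_pos y with rfl | h
      · exfalso; apply hne; simp at hx; rw [hx]
      · exact h
    · omega
  · intro h; exact absurd (by simp) h

theorem exists_lin {K : Type*} [Field K] {α β : Type*} [Fintype α] [Fintype β]
    (hc : Fintype.card β < Fintype.card α) (A : α → β → K) :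
    ∃ c : α → K, c ≠ 0 ∧ ∀ b, ∑ a, c a * A a b = 0 := by
  classical
  let f : (α → K) →ₗ[K] (β → K) := Matrix.vecMulLinear (Matrix.of A)
  have : LinearMap.ker f ≠ ⊥ := by
    apply LinearMap.ker_ne_bot_of_finrank_lt
    simpa using hc
  obtain ⟨c, hc, hc0⟩ := Submodule.exists_mem_ne_zero_of_ne_bot this
  refine ⟨c, hc0, fun b => ?_⟩
  have := congrFun (LinearMap.mem_ker.1 hc) b
  simpa [f, Matrix.vecMul, dotProduct] using this

theorem sum_pow_zero {A : Type*} [CommRing A] [IsDomain A] (u : A) (hu : u ≠ 0) :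
    ∀ (J : ℕ) (G : ℕ → A), (∀ j < J, u ∣ G j → G j = 0) →
      ∑ j ∈ Finset.range J, G j * u ^ j = 0 → ∀ j < J, G j = 0 := by
  intro J
  induction J with
  | zero => intro G _ _ j hj; omega
  | succ J ih =>
    intro G hG hs
    rw [Finset.sum_range_succ'] at hs
    have hd : ∑ j ∈ Finset.range J, G (j + 1) * u ^ (j + 1) =
        u * ∑ j ∈ Finset.range J, G (j + 1) * u ^ j := by
      rw [Finset.mul_sum]
      exact Finset.sum_congr rfl fun _ _ => by ring
    rw [hd, pow_zero, mul_one] at hs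
    have h0 : G 0 = 0 := by
      apply hG 0 (by omega)
      exact ⟨-∑ j ∈ Finset.range J, G (j + 1) * u ^ j, by linear_combination hs⟩
    rw [h0, add_zero] at hs
    have hs' := (mul_eq_zero.1 hs).resolve_left hu
    have := ih (fun j => G (j + 1)) (fun j hj => hG (j + 1) (by omega)) hs'
    intro j hj
    rcases j with _ | j
    · exact h0
    · exact this j (by omega)

theorem stepanov_count {K : Type*} [Field K] (p n q d m κ J M : ℕ) [Fact p.Prime] [CharP K p]
    [NeZero d]
    (hq : q = p ^ n) (hdq : d ∣ q - 1) (h : K[X]) (hm : h.natDegree ≤ m) (x0 : K)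
    (hx0 : h.eval x0 ≠ 0)
    (hprime : ∀ c : K, c ≠ 0 → Prime (X ^ d - C (C c * h ^ (d - 1)) : K[X][X]))
    (hκ : d * (κ + 2 * d * m) ≤ q) (hM : M ≤ q) (hcond : M * (κ + M * m + J) < d * J * κ)
    (z : K) (Z : Finset K) (hZ : ∀ a ∈ Z, a ^ q = a ∧ h.eval a ^ ((q - 1) / d) = z) :
    Z.card * M ≤ M * m + κ + m * q + J * q := by
  classical
  have hd : 0 < d := Nat.pos_of_neZero d
  have hh0 : h ≠ 0 := by rintro rfl; simp at hx0
  have hκ0 : 0 < κ := by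
    rcases Nat.eq_zero_or_pos κ with h0 | h0
    · rw [h0] at hcond; simp at hcond
    · exact h0
  set N := (q - 1) / d with hN
  choose w hw1 hw2 using fun (k : K[X]) (s l : ℕ) => hasse_mul_pow h m hm k s l
  let τ : Fin d × Fin J × Fin κ → ℕ → K[X] := fun x l =>
    w (X ^ (x.2.2 : ℕ)) (M + x.1 * N) l * C (z ^ (x.1 : ℕ)) * (X - C (x0 ^ q)) ^ (x.2.1 : ℕ)
  have hτdeg : ∀ x l, l < M → (τ x l).natDegree < κ + M * m + J := by
    rintro ⟨i, j, t⟩ l hl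
    simp only [τ]
    have h1 := hw1 (X ^ (t : ℕ)) (M + i * N) l
    rw [natDegree_X_pow] at h1
    have h2 : ((X - C (x0 ^ q)) ^ (j : ℕ) : K[X]).natDegree ≤ j := by
      refine natDegree_pow_le.trans ?_
      rw [natDegree_X_sub_C, mul_one]
    have h3 : l * m ≤ M * m := Nat.mul_le_mul_right _ hl.le
    have h4 := natDegree_mul_C_le (w (X ^ (t : ℕ)) (M + i * N) l) (z ^ (i : ℕ))
    refine lt_of_le_of_lt natDegree_mul_le ?_
    have := t.2; have := j.2
    omega
  obtain ⟨c, hc0, hc⟩ := exists_lin (K := K) (α := Fin d × Fin J × Fin κ)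
    (β := Fin M × Fin (κ + M * m + J)) (by simpa [mul_assoc] using hcond)
    (fun x y => (τ x y.1).coeff y.2)
  have hT : ∀ l < M, ∑ x, C (c x) * τ x l = 0 := by
    intro l hl
    ext b
    rw [finsetSum_coeff, coeff_zero]
    simp only [coeff_C_mul]
    by_cases hb : b < κ + M * m + J
    · exact hc (⟨l, hl⟩, ⟨b, hb⟩)
    · apply Finset.sum_eq_zero
      intro x _
      rw [coeff_eq_zero_of_natDegree_lt (lt_of_lt_of_le (hτdeg x l hl) (not_lt.1 hb)), mul_zero]
  let r : K[X] := ∑ x : Fin d × Fin J × Fin κ,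
    C (c x) * ((X ^ (x.2.2 : ℕ) * h ^ (M + x.1 * N)) * (X - C x0) ^ (q * x.2.1))
  let k : Fin d → ℕ → K[X] := fun i j =>
    if hj : j < J then ∑ t : Fin κ, C (c (i, ⟨j, hj⟩, t)) * X ^ (t : ℕ) else 0
  have hr : r = h ^ M * ∑ j ∈ Finset.range J,
      (∑ i, k i j * (h ^ N) ^ (i : ℕ)) * ((X - C x0) ^ q) ^ j := by
    simp only [r]
    rw [Fintype.sum_prod_type, Finset.sum_range, Finset.mul_sum]
    simp only [Fintype.sum_prod_type]
    rw [Finset.sum_comm]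
    apply Finset.sum_congr rfl
    intro j _
    rw [Finset.sum_mul, Finset.mul_sum]
    apply Finset.sum_congr rfl
    intro i _
    simp only [k, dif_pos j.2]
    rw [Finset.sum_mul, Finset.sum_mul, Finset.mul_sum]
    apply Finset.sum_congr rfl
    intro t _
    rw [pow_add, pow_mul (X - C x0), mul_comm (i : ℕ) N, pow_mul h]
    ring
  have hkdeg : ∀ i j, (k i j).natDegree < κ := by
    intro i j
    simp only [k]
    split_ifs with hj
    · refine lt_of_le_of_lt (natDegree_sum_le_of_forall_le (n := κ - 1) _ _ fun t _ => ?_) (by omega)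
      exact (natDegree_C_mul_X_pow_le _ _).trans (by omega)
    · simpa using hκ0
  have hr0 : r ≠ 0 := by
    intro h0
    rw [hr] at h0
    have h0' := (mul_eq_zero.1 h0).resolve_left (pow_ne_zero _ hh0)
    have hu : ((X - C x0) ^ q : K[X]) ≠ 0 := pow_ne_zero _ (X_sub_C_ne_zero _)
    have hind : ∀ j, (X - C x0) ^ q ∣ (∑ i, k i j * (h ^ N) ^ (i : ℕ)) → ∀ i, k i j = 0 := by
      intro j hj
      exact stepanov_indep p n q d m κ hq hdq h hm x0 hx0 hprime hκ (fun i => k i j)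
        (fun i => hkdeg i j) hj
    have hall := sum_pow_zero _ hu J (fun j => ∑ i, k i j * (h ^ N) ^ (i : ℕ)) (fun j _ hj => by
      apply Finset.sum_eq_zero
      intro i _
      rw [hind j hj i, zero_mul]) h0'
    apply hc0
    funext ⟨i, j, t⟩
    have h1 : k i j = 0 := hind j (by rw [hall j j.2]; exact dvd_zero _) i
    have h2 := congrArg (fun P => coeff P (t : ℕ)) h1
    simp only [k, dif_pos j.2, finsetSum_coeff, coeff_C_mul, coeff_X_pow, coeff_zero] at h2
    rw [Finset.sum_eq_single t] at h2
    · simpa using h2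
    · intro t' _ hne
      rw [if_neg, mul_zero]
      intro h; exact hne (Fin.ext h.symm)
    · simp
  have hrdeg : r.natDegree ≤ M * m + κ + m * q + J * q := by
    apply natDegree_sum_le_of_forall_le
    rintro ⟨i, j, t⟩ _
    simp only
    refine (natDegree_C_mul_le _ _).trans ?_
    refine natDegree_mul_le.trans ?_
    have h1 : ((X - C x0) ^ (q * (j : ℕ)) : K[X]).natDegree ≤ J * q := by
      refine natDegree_pow_le.trans ?_
      rw [natDegree_X_sub_C, mul_one, mul_comm]
      exact Nat.mul_le_mul_right _ j.2.le
    have h2 : (h ^ (M + i * N)).natDegree ≤ (M + q) * m := by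
      refine natDegree_pow_le.trans (Nat.mul_le_mul (Nat.add_le_add_left ?_ _) hm)
      calc (i : ℕ) * N ≤ d * N := Nat.mul_le_mul_right _ i.2.le
        _ = q - 1 := Nat.mul_div_cancel' hdq
        _ ≤ q := Nat.sub_le _ _
    have h3 := natDegree_mul_le (p := (X ^ (t : ℕ) : K[X])) (q := h ^ (M + i * N))
    rw [natDegree_X_pow] at h3
    have := t.2
    have h5 : (M + q) * m = M * m + m * q := by ring
    omega
  have hvan : ∀ a ∈ Z, (X - C a) ^ M ∣ r := by
    intro a ha
    obtain ⟨ha1, ha2⟩ := hZ a ha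
    rw [X_sub_C_pow_dvd_iff, ← taylor_apply, X_pow_dvd_iff]
    intro l hl
    rw [taylor_coeff]
    simp only [r, map_sum, eval_finsetSum]
    have hterm : ∀ x : Fin d × Fin J × Fin κ,
        (hasseDeriv l (C (c x) * ((X ^ (x.2.2 : ℕ) * h ^ (M + x.1 * N)) *
          (X - C x0) ^ (q * x.2.1)))).eval a = h.eval a ^ (M - l) * (C (c x) * τ x l).eval a := by
      rintro ⟨i, j, t⟩
      simp only [τ]
      rw [← smul_eq_C_mul, map_smul, eval_smul, hasse_frob p n q hq _ _ _ _ _ (by omega), hw2]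
      have : (M + i * N - l) = (M - l) + N * i := by
        rw [mul_comm N]; omega
      rw [this, pow_mul (a - x0), hq, sub_pow_char_pow, ← hq, ha1]
      simp only [eval_mul, eval_pow, eval_C, eval_sub, eval_X, smul_eq_mul]
      rw [pow_add, pow_mul (eval a h), ha2]
      ring
    rw [Finset.sum_congr rfl fun x _ => hterm x, ← Finset.mul_sum, ← eval_finsetSum, hT l hl]
    simp
  have hprod : ∏ a ∈ Z, (X - C a) ^ M ∣ r := by
    apply Finset.prod_dvd_of_coprime
    · intro a _ b _ hab
      exact IsCoprime.pow (isCoprime_X_sub_C_of_isUnit_sub (sub_ne_zero.2 hab).isUnit)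
    · exact hvan
  have hfin := natDegree_le_of_dvd hprod hr0
  rw [natDegree_prod_of_monic _ _ fun a _ => (monic_X_sub_C a).pow M] at hfin
  simp only [natDegree_pow, natDegree_X_sub_C, mul_one, Finset.sum_const, smul_eq_mul] at hfin
  exact hfin.trans hrdeg

theorem stepanov_param (d m : ℕ) (hd : 1 ≤ d) : ∃ B : ℝ, 0 ≤ B ∧ ∀ q : ℕ, 1 ≤ q → ∀ N : ℕ, N ≤ q →
    (∀ κ J M : ℕ, d * (κ + 2 * d * m) ≤ q → M ≤ q → M * (κ + M * m + J) < d * J * κ →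
      N * M ≤ M * m + κ + m * q + J * q) → (N : ℝ) ≤ q / d + B * Real.sqrt q := by
  obtain ⟨c, hc⟩ : ∃ c : ℕ, c = 4 * d * (d * m + 1) := ⟨_, rfl⟩
  refine ⟨4 * c + m + 4 * (1 + m + c), by positivity, ?_⟩
  intro q hq N hNq H
  have hsq : (0 : ℝ) ≤ Real.sqrt q := Real.sqrt_nonneg _
  have hsq1 : (1 : ℝ) ≤ Real.sqrt q := by
    rw [Real.one_le_sqrt]; exact_mod_cast hq
  have hqq : Real.sqrt q * Real.sqrt q = q := Real.mul_self_sqrt (by positivity)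
  obtain ⟨s, hs⟩ : ∃ s, s = Nat.sqrt q := ⟨_, rfl⟩
  have hs1 : s * s ≤ q := by rw [hs]; exact Nat.sqrt_le q
  have hs2 : q < (s + 1) * (s + 1) := by rw [hs]; exact Nat.lt_succ_sqrt q
  have hrs : Real.sqrt q ≤ s + 1 := by
    rw [Real.sqrt_le_left (by positivity)]
    have : (q : ℝ) < (s + 1) * (s + 1) := by exact_mod_cast hs2
    nlinarith
  have hc4 : 4 ≤ c := by rw [hc]; nlinarith [Nat.zero_le (d * m), Nat.zero_le (d * (d * m))]
  have hqd : (0 : ℝ) ≤ q / d := by positivity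
  have hN : (N : ℝ) ≤ q := by exact_mod_cast hNq
  rcases Nat.lt_or_ge s (4 * c) with hlt | hge
  · have h1 : (s : ℝ) + 1 ≤ 4 * c := by exact_mod_cast hlt
    have h2 : Real.sqrt q * Real.sqrt q ≤ 4 * c * Real.sqrt q :=
      mul_le_mul_of_nonneg_right (hrs.trans h1) hsq
    have h3 : (0 : ℝ) ≤ (m + 4 * (1 + m + c)) * Real.sqrt q := by positivity
    linarith
  · obtain ⟨t, ht⟩ : ∃ t, s = t + c := ⟨s - c, by omega⟩
    have hq16 : 16 * (c * c) ≤ q := by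
      have a : 4 * c * (4 * c) = 16 * (c * c) := by ring
      have b := Nat.mul_le_mul hge hge
      omega
    have hcc : c ≤ c * c := by nlinarith
    have hcd : 4 * (d * d * m) + 4 * d = c := by rw [hc]; ring
    have hmod := Nat.div_add_mod q d
    have hmodlt := Nat.mod_lt q hd
    have h2dm : 2 * d * m ≤ q / d := by
      rw [Nat.le_div_iff_mul_le hd]
      have : 2 * d * m * d = 2 * (d * d * m) := by ring
      omega
    obtain ⟨κ, hκ⟩ : ∃ κ, q / d = κ + 2 * d * m := ⟨q / d - 2 * d * m, by omega⟩
    rw [hκ] at hmod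
    have hexp : d * (κ + 2 * d * m) = d * κ + 2 * (d * d * m) := by ring
    have hdκ : q ≤ 2 * (d * κ) := by omega
    have hckap : 2 * (d * m + 1) * q ≤ c * κ := by
      calc 2 * (d * m + 1) * q ≤ 2 * (d * m + 1) * (2 * (d * κ)) := Nat.mul_le_mul_left _ hdκ
        _ = c * κ := by rw [hc]; ring
    have hts : d ≤ s := by omega
    have hdt : d * t ≤ q := (Nat.mul_le_mul hts (by omega : t ≤ s)).trans hs1
    have hmain := H κ s (d * t) (by omega) hdt (by
      have h1 : (d * m + 1) * (t * s) < c * κ := by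
        have : t * s ≤ q := (Nat.mul_le_mul_right s (by omega : t ≤ s)).trans hs1
        have h2 : (d * m + 1) * (t * s) ≤ (d * m + 1) * q := Nat.mul_le_mul_left _ this
        have h3 : (d * m + 1) * q < 2 * (d * m + 1) * q := by
          have a : 2 * (d * m + 1) * q = (d * m + 1) * q + (d * m * q + q) := by ring
          omega
        omega
      have h2 : t * (κ + d * t * m + s) < s * κ := by
        have : t * (κ + d * t * m + s) ≤ t * κ + (d * m + 1) * (t * s) := by
          have : d * m * t * t ≤ d * m * t * s := Nat.mul_le_mul_left _ (by omega)
          have a : t * (κ + d * t * m + s) = t * κ + d * m * t * t + t * s := by ring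
          have b : (d * m + 1) * (t * s) = d * m * t * s + t * s := by ring
          omega
        have e : s * κ = t * κ + c * κ := by rw [ht]; ring
        omega
      calc d * t * (κ + d * t * m + s) = d * (t * (κ + d * t * m + s)) := by ring
        _ < d * (s * κ) := Nat.mul_lt_mul_of_pos_left h2 hd
        _ = d * s * κ := by ring)
    have hmR : (N : ℝ) * (d * t) ≤ d * t * m + κ + m * q + s * q := by exact_mod_cast hmain
    have hκR : (κ : ℝ) ≤ q := by
      have : κ ≤ q := by
        have : κ ≤ d * κ := Nat.le_mul_of_pos_left _ hd
        omega
      exact_mod_cast this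
    have hstR : (s : ℝ) = t + c := by exact_mod_cast ht
    have htpos : (0 : ℝ) < t := by
      have : 0 < t := by omega
      exact_mod_cast this
    have hd1 : (1 : ℝ) ≤ d := by exact_mod_cast hd
    have h4t : (s : ℝ) + 1 ≤ 4 * t := by
      have : s + 1 ≤ 4 * t := by omega
      exact_mod_cast this
    have hq4 : (q : ℝ) ≤ 4 * t * Real.sqrt q := by
      rw [← hqq]
      have := mul_le_mul_of_nonneg_right (hrs.trans h4t) hsq
      rw [hqq] at this ⊢
      exact this
    have hdtpos : (0 : ℝ) < d * t := by positivity
    rw [← mul_le_mul_iff_left₀ hdtpos]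
    refine hmR.trans ?_
    have e1 : (q / d : ℝ) * (d * t) = q * t := by field_simp
    rw [add_mul, e1, hstR]
    have e2 : (m : ℝ) * (d * t) ≤ m * Real.sqrt q * (d * t) := by
      apply mul_le_mul_of_nonneg_right _ hdtpos.le
      exact le_mul_of_one_le_right (by positivity) hsq1
    have e3 : (1 + m + c : ℝ) * q ≤ 4 * (1 + m + c) * Real.sqrt q * (d * t) := by
      calc (1 + m + c : ℝ) * q ≤ (1 + m + c) * (4 * t * Real.sqrt q) :=
            mul_le_mul_of_nonneg_left hq4 (by positivity)
        _ = 4 * (1 + m + c) * Real.sqrt q * (1 * t) := by ring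
        _ ≤ 4 * (1 + m + c) * Real.sqrt q * (d * t) := by gcongr
    have e4 : (0 : ℝ) ≤ 4 * c * Real.sqrt q * (d * t) := by positivity
    linarith

theorem stepanov_bound {K : Type*} [Field K] [IsAlgClosed K] (p d m : ℕ) [Fact p.Prime] [CharP K p]
    (hd : 0 < d) (hdK : (d : K) ≠ 0) :
    ∃ B : ℝ, 0 ≤ B ∧ ∀ h : K[X], h.Monic → h.natDegree ≤ m →
      (∀ l, l ∣ d → l ≠ 1 → ∀ b : K[X], b.Monic → b ^ l ≠ h) →
      ∀ n q : ℕ, q = p ^ n → 1 < q → d ∣ q - 1 → ∀ (z : K) (Z : Finset K),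
        (∀ a ∈ Z, a ^ q = a ∧ h.eval a ^ ((q - 1) / d) = z) →
        (Z.card : ℝ) ≤ q / d + B * Real.sqrt q := by
  obtain ⟨B, hB, H⟩ := stepanov_param d m hd
  refine ⟨B, hB, ?_⟩
  intro h hmon hdeg hpow n q hq hq1 hdq z Z hZ
  have _i : NeZero d := ⟨hd.ne'⟩
  have _i2 : Infinite K := IsAlgClosed.instInfinite
  obtain ⟨x0, hx0⟩ : ∃ x0, h.eval x0 ≠ 0 := by
    by_contra hcon
    push Not at hcon
    exact hmon.ne_zero (Polynomial.funext (fun x => by simpa using hcon x))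
  apply H q hq1.le
  · have hne : (X ^ q - X : K[X]) ≠ 0 := FiniteField.X_pow_card_sub_X_ne_zero K hq1
    have : Z.val ≤ (X ^ q - X : K[X]).roots := by
      rw [Multiset.le_iff_subset Z.nodup]
      intro a ha
      rw [mem_roots hne]
      simp [(hZ a ha).1]
    calc Z.card = Multiset.card Z.val := rfl
      _ ≤ _ := Multiset.card_le_card this
      _ ≤ _ := card_roots' _
      _ = q := FiniteField.X_pow_card_sub_X_natDegree_eq K hq1
  · intro κ J M h1 h2 h3
    exact stepanov_count p n q d m κ J M hq hdq h hdeg x0 hx0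
      (fun c hc => kummer_prime hd hdK hmon hpow hc) h1 h2 h3 z Z hZ

theorem frob_fix {F K : Type*} [Field F] [Fintype F] [Field K] [Algebra F K] {y : K}
    (hy : y ^ Fintype.card F = y) : ∃ x : F, algebraMap F K x = y := by
  classical
  have h1 : (X ^ Fintype.card F - X : F[X]).roots = Finset.univ.val := FiniteField.roots_X_pow_card_sub_X F
  have hq : 1 < Fintype.card F := Fintype.one_lt_card
  have h2 : Multiset.card (X ^ Fintype.card F - X : F[X]).roots = (X ^ Fintype.card F - X : F[X]).natDegree := by
    rw [h1, FiniteField.X_pow_card_sub_X_natDegree_eq F hq]; rfl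
  have h3 := Polynomial.roots_map_of_injective_of_card_eq_natDegree (algebraMap F K).injective h2
  have h4 : y ∈ ((X ^ Fintype.card F - X : F[X]).map (algebraMap F K)).roots := by
    rw [mem_roots]
    · simp [hy]
    · simpa using FiniteField.X_pow_card_sub_X_ne_zero K hq
  rw [← h3, Multiset.mem_map] at h4
  obtain ⟨x, _, hx⟩ := h4
  exact ⟨x, hx⟩

theorem frob_poly {F K : Type*} [Field F] [Fintype F] [Field K] [Algebra F K] {b : K[X]}
    (hb : ∀ i, b.coeff i ^ Fintype.card F = b.coeff i) : ∃ b0 : F[X], b0.map (algebraMap F K) = b := by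
  have : b ∈ Polynomial.lifts (algebraMap F K) := by
    rw [Polynomial.lifts_iff_coeff_lifts]
    intro i
    obtain ⟨x, hx⟩ := frob_fix (F := F) (hb i)
    exact ⟨x, hx⟩
  exact (Polynomial.mem_lifts _).1 this

theorem descent_pow {F K : Type*} [Field F] [Fintype F] [Field K] [Algebra F K] {h : F[X]}
    {b : K[X]} (hb : b.Monic) {l : ℕ} (hl : l ≠ 0) (hbl : b ^ l = h.map (algebraMap F K)) :
    ∃ b0 : F[X], b0.Monic ∧ b0 ^ l = h := by
  set φ : K →ₐ[F] K := FiniteField.frobeniusAlgHom F K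
  have hφ : ∀ x, φ x = x ^ Fintype.card F := fun x => by simp [φ]
  have h1 : (b.map (φ : K →+* K)) ^ l = b ^ l := by
    rw [← Polynomial.map_pow, hbl, Polynomial.map_map]
    congr 1
    ext x
    simp
  have hb' : (b.map (φ : K →+* K)).Monic := hb.map _
  have h2 : b.map (φ : K →+* K) ∣ b := (IsIntegrallyClosed.pow_dvd_pow_iff hl).1 h1.dvd
  have h3 : b = b.map (φ : K →+* K) := by
    apply eq_of_monic_of_dvd_of_natDegree_le hb' hb h2
    simp
  obtain ⟨b0, hb0⟩ := frob_poly (F := F) (b := b) (fun i => by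
    conv_rhs => rw [h3]
    rw [coeff_map, ← hφ]; rfl)
  refine ⟨b0, ?_, ?_⟩
  · rw [← hb0] at hb
    exact (Polynomial.monic_map_iff).1 hb
  · apply Polynomial.map_injective (algebraMap F K) (algebraMap F K).injective
    rw [Polynomial.map_pow, hb0, hbl]

open scoped Classical in
/-- fixed points of the k-th power of Frobenius -/
noncomputable def fixK (K : Type*) [Field K] (q : ℕ) : Finset K := (X ^ q - X : K[X]).roots.toFinset

theorem mem_fixK {K : Type*} [Field K] {q : ℕ} (hq : 1 < q) {a : K} : a ∈ fixK K q ↔ a ^ q = a := by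
  simp [fixK, mem_roots (FiniteField.X_pow_card_sub_X_ne_zero K hq), sub_eq_zero]

theorem card_fixK {K : Type*} [Field K] [IsAlgClosed K] (p : ℕ) [CharP K p] {q : ℕ} (hq : 1 < q)
    (hp : p ∣ q) : (fixK K q).card = q := by
  classical
  have hs : (X ^ q - X : K[X]).Separable := galois_poly_separable p q hp
  rw [fixK, Multiset.toFinset_card_of_nodup (nodup_roots hs),
    ← (IsAlgClosed.splits (X ^ q - X : K[X])).natDegree_eq_card_roots,
    FiniteField.X_pow_card_sub_X_natDegree_eq K hq]

noncomputable def resF (F K : Type*) [Field F] [Field K] [Algebra F K] : K → F :=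
  Function.invFun (algebraMap F K)

theorem resF_alg {F K : Type*} [Field F] [Field K] [Algebra F K] (x : F) :
    resF F K (algebraMap F K x) = x :=
  Function.leftInverse_invFun (algebraMap F K).injective x

theorem alg_resF {F K : Type*} [Field F] [Fintype F] [Field K] [Algebra F K] {y : K}
    (hy : y ^ Fintype.card F = y) : algebraMap F K (resF F K y) = y := by
  obtain ⟨x, rfl⟩ := frob_fix (F := F) hy
  rw [resF_alg]

theorem chi_ker {F : Type*} [Field F] [Fintype F] (χ : MulChar F ℂ) {t : F} (ht : t ≠ 0) (h : χ t = 1) :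
    t ^ ((Fintype.card F - 1) / orderOf χ) = 1 := by
  classical
  obtain ⟨g, hg⟩ := IsCyclic.exists_generator (α := Fˣ)
  obtain ⟨j, hj⟩ := Submonoid.mem_powers_iff _ _ |>.1
    ((mem_powers_iff_mem_zpowers).2 (hg (Units.mk0 t ht)))
  have h1 : (χ ^ j) = 1 := by
    rw [MulChar.eq_iff hg]
    rw [MulChar.pow_apply_coe, MulChar.one_apply_coe, ← map_pow, ← Units.val_pow_eq_pow_val, hj]
    simpa using h
  obtain ⟨c, hc⟩ := orderOf_dvd_of_pow_eq_one h1
  obtain ⟨e, he⟩ := MulChar.orderOf_dvd_card_sub_one F χ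
  have h2 : t = ((g ^ j : Fˣ) : F) := by rw [hj]; rfl
  rw [he, Nat.mul_div_cancel_left _ χ.orderOf_pos, h2, Units.val_pow_eq_pow_val, ← pow_mul, hc,
    show orderOf χ * c * e = (orderOf χ * e) * c by ring, ← he, pow_mul]
  rw [FiniteField.pow_card_sub_one_eq_one _ g.ne_zero, one_pow]

noncomputable def charS {F : Type*} (K : Type*) [Field F] [Fintype F] [Field K] [Algebra F K]
    (χ : MulChar F ℂ) (h : F[X]) (k : ℕ) : ℂ :=
  ∑ a ∈ fixK K (Fintype.card F ^ k),
    χ (resF F K ((aeval a h) ^ ((Fintype.card F ^ k - 1) / (Fintype.card F - 1))))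

theorem aeval_frob {F K : Type*} [Field F] [Fintype F] [Field K] [Algebra F K] (a : K) (h : F[X]) (k : ℕ) :
    aeval (a ^ Fintype.card F ^ k) h = (aeval a h) ^ Fintype.card F ^ k := by
  induction k with
  | zero => simp
  | succ k ih =>
    have := (Polynomial.aeval_algHom_apply (FiniteField.frobeniusAlgHom F K) (a ^ Fintype.card F ^ k) h)
    simp only [FiniteField.coe_frobeniusAlgHom] at this
    rw [pow_succ, pow_mul, pow_mul, this, ih]

theorem norm_fix {F K : Type*} [Field F] [Fintype F] [Field K] [Algebra F K] (y : K) (k : ℕ) (hk : 0 < k)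
    (hy : y ^ Fintype.card F ^ k = y) :
    (y ^ ((Fintype.card F ^ k - 1) / (Fintype.card F - 1))) ^ Fintype.card F =
      y ^ ((Fintype.card F ^ k - 1) / (Fintype.card F - 1)) := by
  have hQ : 1 < Fintype.card F := Fintype.one_lt_card
  have hdvd : Fintype.card F - 1 ∣ Fintype.card F ^ k - 1 := Nat.sub_one_dvd_pow_sub_one _ _
  have hq : 1 < Fintype.card F ^ k := Nat.one_lt_pow hk.ne' hQ
  obtain ⟨c, hc⟩ := hdvd
  have hc' : (Fintype.card F ^ k - 1) / (Fintype.card F - 1) = c := by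
    rw [hc]; exact Nat.mul_div_cancel_left _ (by omega)
  have hc0 : c ≠ 0 := by rintro rfl; omega
  rw [hc']
  by_cases h0 : y = 0
  · subst h0; simp [hc0]
  · have h1 : y ^ (Fintype.card F ^ k - 1) = 1 := by
      have : y ^ (Fintype.card F ^ k - 1) * y = 1 * y := by
        rw [← pow_succ, Nat.sub_add_cancel hq.le, hy, one_mul]
      exact mul_right_cancel₀ h0 this
    have h2 : (y ^ c) ^ (Fintype.card F - 1) = 1 := by
      rw [← pow_mul, mul_comm, ← hc, h1]
    calc (y ^ c) ^ Fintype.card F = (y ^ c) ^ (Fintype.card F - 1 + 1) := by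
          rw [Nat.sub_add_cancel hQ.le]
      _ = y ^ c := by rw [pow_succ, h2, one_mul]

theorem charS_bound {F K : Type*} [Field F] [Fintype F] [Field K] [Algebra F K] [IsAlgClosed K]
    (χ : MulChar F ℂ) (hχ : 1 < orderOf χ) (h : F[X]) (hmon : h.Monic)
    (hpow : ∀ l, l ∣ orderOf χ → l ≠ 1 → ∀ b : F[X], b.Monic → b ^ l ≠ h) :
    ∃ C : ℝ, 0 ≤ C ∧ ∀ k, 0 < k → ‖charS K χ h k‖ ≤ C * (Real.sqrt (Fintype.card F)) ^ k := by
  classical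
  set d := orderOf χ with hd
  set Q := Fintype.card F with hQdef
  have hQ : 1 < Q := Fintype.one_lt_card
  obtain ⟨p, hpF⟩ := CharP.exists F
  obtain ⟨n0, hp, hcard⟩ := FiniteField.card F p
  have _f : Fact p.Prime := ⟨hp⟩
  have _c : CharP K p := charP_of_injective_algebraMap (algebraMap F K).injective p
  have hdQ : d ∣ Q - 1 := MulChar.orderOf_dvd_card_sub_one F χ
  have hpQ : p ∣ Q := by
    rw [hQdef, hcard]; exact dvd_pow_self _ n0.ne_zero
  have hdK : (d : K) ≠ 0 := by
    intro h0
    have h1 : p ∣ d := (CharP.cast_eq_zero_iff K p d).1 h0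
    have h2 : p ∣ 1 := by
      have := (Nat.dvd_sub hpQ (h1.trans hdQ))
      rwa [show Q - (Q - 1) = 1 by omega] at this
    exact hp.one_lt.ne' (Nat.dvd_one.1 h2)
  set m := h.natDegree
  obtain ⟨B, hB, H⟩ := stepanov_bound (K := K) p d m (by omega) hdK
  have H' := H (h.map (algebraMap F K)) (hmon.map _) (by simp [m]) (by
    intro l hl hl1 b hb hbl
    obtain ⟨b0, hb0, hb1⟩ := descent_pow hb (by rintro rfl; simp at hl; omega) hbl
    exact hpow l hl hl1 b0 hb0 hb1)
  refine ⟨d * B + m, by positivity, ?_⟩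
  intro k hk
  set q := Q ^ k with hq
  have hq1 : 1 < q := Nat.one_lt_pow hk.ne' hQ
  have hdvd : Q - 1 ∣ q - 1 := Nat.sub_one_dvd_pow_sub_one _ _
  set t : K → F := fun a => resF F K ((aeval a h) ^ ((q - 1) / (Q - 1))) with ht
  have hS : charS K χ h k = ∑ a ∈ fixK K q, χ (t a) := rfl
  have htA : ∀ a ∈ fixK K q, algebraMap F K (t a) = (aeval a h) ^ ((q - 1) / (Q - 1)) := by
    intro a ha
    rw [mem_fixK hq1] at ha
    apply alg_resF
    apply norm_fix _ _ hk
    rw [← aeval_frob, ← hQdef, ← hq, ha]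
  set R := nthRootsFinset d (1 : ℂ) with hR
  have hζ := Complex.isPrimitiveRoot_exp d (by omega)
  have hRcard : R.card = d := hζ.card_nthRootsFinset
  have hRsum : ∑ ξ ∈ R, ξ = 0 := by
    have hinj : Set.InjOn (fun i : ℕ => Complex.exp (2 * Real.pi * Complex.I / d) ^ i) (Finset.range d) :=
      fun i hi j hj hij => hζ.pow_inj (by simpa using hi) (by simpa using hj) hij
    have himg : (Finset.range d).image (fun i : ℕ => Complex.exp (2 * Real.pi * Complex.I / d) ^ i) = R := by
      apply Finset.eq_of_subset_of_card_le
      · intro x hx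
        obtain ⟨i, _, rfl⟩ := Finset.mem_image.1 hx
        rw [hR, mem_nthRootsFinset (by omega), pow_right_comm, hζ.pow_eq_one, one_pow]
      · rw [hRcard, Finset.card_image_of_injOn hinj, Finset.card_range]
    rw [← himg, Finset.sum_image hinj]
    exact hζ.geom_sum_eq_zero hχ
  set N : ℂ → ℕ := fun ξ => ((fixK K q).filter (fun a => χ (t a) = ξ)).card with hN
  have hNle : ∀ ξ ∈ R, (N ξ : ℝ) ≤ q / d + B * Real.sqrt q := by
    intro ξ hξ
    have hξ0 : ξ ≠ 0 := by
      rintro rfl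
      rw [hR, mem_nthRootsFinset (by omega)] at hξ
      rw [zero_pow (by omega)] at hξ
      exact zero_ne_one hξ
    have key : ∃ z : K, ∀ a ∈ (fixK K q).filter (fun a => χ (t a) = ξ),
        a ^ q = a ∧ (h.map (algebraMap F K)).eval a ^ ((q - 1) / d) = z := by
      by_cases hE : ((fixK K q).filter (fun a => χ (t a) = ξ)).Nonempty
      · obtain ⟨a0, ha0⟩ := hE
        refine ⟨(h.map (algebraMap F K)).eval a0 ^ ((q - 1) / d), ?_⟩
        intro a ha
        rw [Finset.mem_filter] at ha ha0
        refine ⟨(mem_fixK hq1).1 ha.1, ?_⟩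
        have hne : ∀ b, χ (t b) = ξ → t b ≠ 0 := by
          intro b hb h0
          rw [h0, MulChar.map_zero] at hb
          exact hξ0 hb.symm
        have h1 : χ (t a / t a0) = 1 := by
          rw [div_eq_mul_inv, map_mul, ← MulChar.inv_apply', MulChar.inv_apply_eq_inv', ha.2, ha0.2, mul_inv_cancel₀ hξ0]
        have h2 := chi_ker χ (div_ne_zero (hne a ha.2) (hne a0 ha0.2)) h1
        rw [div_pow, div_eq_one_iff_eq (pow_ne_zero _ (hne a0 ha0.2))] at h2
        have h3 := congrArg (algebraMap F K) h2
        rw [map_pow, map_pow, htA a ha.1, htA a0 ha0.1, ← pow_mul, ← pow_mul,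
          Nat.div_mul_div_comm hdvd hdQ, mul_comm (q - 1), Nat.mul_div_mul_left _ _ (by omega)] at h3
        rw [eval_map_algebraMap, eval_map_algebraMap]
        exact h3
      · rw [Finset.not_nonempty_iff_eq_empty] at hE
        exact ⟨0, by rw [hE]; simp⟩
    obtain ⟨z, hz⟩ := key
    exact H' (n0 * k) q (by rw [hq, hQdef, hcard, ← pow_mul]) hq1 (hdQ.trans hdvd) z _ hz
  have hval : ∀ a, t a ≠ 0 → χ (t a) ∈ R := by
    intro a ha
    rw [hR, mem_nthRootsFinset (by omega), ← MulChar.pow_apply' _ (by omega), hd, pow_orderOf_eq_one,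
      MulChar.one_apply (Ne.isUnit ha)]
  have hsum1 : ∑ a ∈ fixK K q, χ (t a) = ∑ ξ ∈ R, (N ξ : ℂ) * ξ := by
    rw [← Finset.sum_filter_add_sum_filter_not _ (fun a => χ (t a) ∈ R)]
    rw [Finset.sum_eq_zero (s := (fixK K q).filter (fun a => ¬ χ (t a) ∈ R)), add_zero]
    · rw [← Finset.sum_fiberwise_of_maps_to (t := R) (g := fun a => χ (t a))]
      · apply Finset.sum_congr rfl
        intro ξ hξ
        rw [Finset.filter_filter, hN, ← nsmul_eq_mul]
        rw [show (fixK K q).filter (fun a => χ (t a) ∈ R ∧ χ (t a) = ξ) = (fixK K q).filter (fun a => χ (t a) = ξ) from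
          Finset.filter_congr (fun a _ => ⟨fun h => h.2, fun h => ⟨h ▸ hξ, h⟩⟩)]
        rw [Finset.sum_congr rfl (g := fun _ => ξ), Finset.sum_const]
        intro a ha
        exact (Finset.mem_filter.1 ha).2
      · intro a ha; exact (Finset.mem_filter.1 ha).2
    · intro a ha
      rw [Finset.mem_filter] at ha
      have : t a = 0 := by
        by_contra h0
        exact ha.2 (hval a h0)
      rw [this, MulChar.map_zero]
  have hcount : (q : ℝ) ≤ ∑ ξ ∈ R, (N ξ : ℝ) + m := by
    have h1 : (fixK K q).card ≤ ((fixK K q).filter (fun a => χ (t a) ∈ R)).card + m := by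
      rw [← Finset.card_filter_add_card_filter_not (s := fixK K q) (fun a => χ (t a) ∈ R)]
      apply Nat.add_le_add_left
      have hsub : (fixK K q).filter (fun a => ¬ χ (t a) ∈ R) ⊆ (h.map (algebraMap F K)).roots.toFinset := by
        intro a ha
        rw [Finset.mem_filter] at ha
        have h0 : t a = 0 := by
          by_contra h0
          exact ha.2 (hval a h0)
        have h1 := htA a ha.1
        rw [h0, map_zero] at h1
        have h2 := eq_zero_of_pow_eq_zero h1.symm
        rw [Multiset.mem_toFinset, mem_roots (hmon.map _).ne_zero, IsRoot, eval_map_algebraMap, h2]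
      calc _ ≤ _ := Finset.card_le_card hsub
        _ ≤ _ := Multiset.toFinset_card_le _
        _ ≤ _ := card_roots' _
        _ = m := by simp [m]
    have h2 : ((fixK K q).filter (fun a => χ (t a) ∈ R)).card = ∑ ξ ∈ R, N ξ := by
      rw [Finset.card_eq_sum_card_fiberwise (t := R) (f := fun a => χ (t a))]
      · apply Finset.sum_congr rfl
        intro ξ hξ
        rw [Finset.filter_filter, hN]
        congr 1
        exact Finset.filter_congr (fun a _ => ⟨fun h => h.2, fun h => ⟨h ▸ hξ, h⟩⟩)
      · intro a ha; exact (Finset.mem_filter.1 ha).2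
    rw [card_fixK p hq1 (dvd_pow hpQ hk.ne'), h2] at h1
    exact_mod_cast h1
  have hsum2 : ∑ ξ ∈ R, (N ξ : ℂ) * ξ = ∑ ξ ∈ R, ((N ξ : ℂ) - ((q / d + B * Real.sqrt q : ℝ) : ℂ)) * ξ := by
    simp_rw [sub_mul]
    rw [Finset.sum_sub_distrib, ← Finset.mul_sum, hRsum, mul_zero, sub_zero]
  rw [hS, hsum1, hsum2]
  have hsq : Real.sqrt q = Real.sqrt Q ^ k := by
    rw [hq, Nat.cast_pow, Real.sqrt_eq_iff_mul_self_eq (by positivity) (by positivity), ← mul_pow, Real.mul_self_sqrt (by positivity)]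
  have hsq1 : 1 ≤ Real.sqrt Q ^ k := by
    apply one_le_pow₀
    rw [Real.one_le_sqrt]
    exact_mod_cast hQ.le
  have hd0 : (d : ℝ) ≠ 0 := by
    have : d ≠ 0 := by omega
    exact_mod_cast this
  calc _ ≤ ∑ ξ ∈ R, ((q / d + B * Real.sqrt q) - (N ξ : ℝ)) := by
        apply norm_sum_le_of_le
        intro ξ hξ
        have h1 : ‖ξ‖ = 1 := by
          rw [hR, mem_nthRootsFinset (by omega)] at hξ
          exact Complex.norm_eq_one_of_pow_eq_one hξ (by omega)
        rw [norm_mul, h1, mul_one]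
        have : ((N ξ : ℂ) - ((q / d + B * Real.sqrt q : ℝ) : ℂ)) = (((N ξ : ℝ) - (q / d + B * Real.sqrt q) : ℝ) : ℂ) := by
          push_cast; ring
        rw [this, Complex.norm_real, Real.norm_eq_abs, abs_sub_comm, abs_of_nonneg]
        linarith [hNle ξ hξ]
    _ = q + d * B * Real.sqrt q - ∑ ξ ∈ R, (N ξ : ℝ) := by
        rw [Finset.sum_sub_distrib, Finset.sum_const, hRcard, nsmul_eq_mul]
        field_simp
    _ ≤ d * B * Real.sqrt q + m := by linarith
    _ ≤ _ := by
        rw [hsq, add_mul]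
        have : (m : ℝ) ≤ m * Real.sqrt Q ^ k := le_mul_of_one_le_right (by positivity) hsq1
        linarith

theorem alg_resultant {F K : Type*} [Field F] [Field K] [Algebra F K] [IsAlgClosed K]
    (g f : F[X]) (hg : g.Monic) :
    algebraMap F K (resultant g f) = ((g.map (algebraMap F K)).roots.map (fun a => aeval a f)).prod := by
  have h1 := resultant_eq_prod_eval (g.map (algebraMap F K)) (f.map (algebraMap F K)) f.natDegree
    (by simp) (IsAlgClosed.splits _)
  rw [natDegree_map, resultant_map_map, (hg.map _).leadingCoeff, one_pow, one_mul] at h1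
  rw [h1]
  simp only [eval_map_algebraMap]

noncomputable def psiR {F : Type*} [Field F] (χ : MulChar F ℂ) (f g : F[X]) : ℂ := χ (resultant g f)

theorem psiR_mul {F : Type*} [Field F] (χ : MulChar F ℂ) (f : F[X]) {g₁ g₂ : F[X]} (h₁ : g₁.Monic) (h₂ : g₂.Monic) :
    psiR χ f (g₁ * g₂) = psiR χ f g₁ * psiR χ f g₂ := by
  rw [psiR, psiR, psiR, ← map_mul, ← resultant_mul_left _ _ _ _ le_rfl, h₁.natDegree_mul h₂]

theorem minpoly_fix {F K : Type*} [Field F] [Fintype F] [Field K] [Algebra F K] [Algebra.IsAlgebraic F K] (a : K)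
    (k : ℕ) : (minpoly F a).natDegree ∣ k ↔ a ^ Fintype.card F ^ k = a := by
  have hi := minpoly.irreducible (Algebra.IsIntegral.isIntegral (R := F) a)
  rw [hi.natDegree_dvd_iff_dvd_X_pow_card_pow_sub_X, minpoly.dvd_iff, Nat.card_eq_fintype_card]
  simp [sub_eq_zero]

theorem minpoly_orbit {F K : Type*} [Field F] [Fintype F] [Field K] [Algebra F K] [Algebra.IsAlgebraic F K] (a : K) :
    (minpoly F a).map (algebraMap F K) =
      ∏ i ∈ Finset.range (minpoly F a).natDegree, (X - C (a ^ Fintype.card F ^ i)) := by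
  have hint := (Algebra.IsIntegral.isIntegral (R := F) a)
  have hfinj : ∀ i (x y : K), x ^ Fintype.card F ^ i = y ^ Fintype.card F ^ i → x = y := by
    intro i
    induction i with
    | zero => intro x y h; simpa using h
    | succ i ih =>
      intro x y h
      apply ih
      rw [pow_succ, pow_mul, pow_mul] at h
      exact (FiniteField.frobeniusAlgHom F K).injective (by simpa using h)
  have key : ∀ i j, i < j → j < (minpoly F a).natDegree → a ^ Fintype.card F ^ i ≠ a ^ Fintype.card F ^ j := by
    intro i j hij hj h
    have h1 : a ^ Fintype.card F ^ (j - i) = a := by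
      apply hfinj i
      rw [← pow_mul, ← pow_add, Nat.sub_add_cancel hij.le, h]
    rw [← minpoly_fix] at h1
    have := Nat.le_of_dvd (by omega) h1
    omega
  apply eq_of_monic_of_dvd_of_natDegree_le
  · exact monic_prod_of_monic _ _ (fun i _ => monic_X_sub_C _)
  · exact (minpoly.monic hint).map _
  · apply Finset.prod_dvd_of_coprime
    · intro i hi j hj hij
      simp only [Finset.coe_range, Set.mem_Iio] at hi hj
      apply isCoprime_X_sub_C_of_isUnit_sub
      apply Ne.isUnit
      rw [sub_ne_zero]
      rcases lt_or_gt_of_ne hij with h | h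
      · exact key i j h hj
      · exact (key j i h hi).symm
    · intro i _
      rw [dvd_iff_isRoot, IsRoot, eval_map_algebraMap, aeval_frob, minpoly.aeval]
      simp
  · rw [natDegree_prod_of_monic _ _ (fun i _ => monic_X_sub_C _)]
    simp only [natDegree_X_sub_C, natDegree_map, Finset.sum_const, Finset.card_range, smul_eq_mul, mul_one, le_refl]

theorem minpoly_orbit_pow {F K : Type*} [Field F] [Fintype F] [Field K] [Algebra F K] [Algebra.IsAlgebraic F K] (a : K)
    (j : ℕ) : ((minpoly F a) ^ j).map (algebraMap F K) =
      ∏ i ∈ Finset.range ((minpoly F a).natDegree * j), (X - C (a ^ Fintype.card F ^ i)) := by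
  induction j with
  | zero => simp
  | succ j ih =>
    rw [pow_succ, Polynomial.map_mul, ih, mul_add, mul_one, Finset.prod_range_add, minpoly_orbit]
    congr 1
    apply Finset.prod_congr rfl
    intro i _
    congr 2
    rw [pow_add, pow_mul, (minpoly_fix a _).1 (dvd_mul_right _ j)]

theorem psiR_minpoly {F K : Type*} [Field F] [Fintype F] [Field K] [Algebra F K] [IsAlgClosed K]
    [Algebra.IsAlgebraic F K] (χ : MulChar F ℂ) (f : F[X]) (a : K) (k : ℕ) 
    (ha : a ^ Fintype.card F ^ k = a) :
    psiR χ f ((minpoly F a) ^ (k / (minpoly F a).natDegree)) =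
      χ (resF F K ((aeval a f) ^ ((Fintype.card F ^ k - 1) / (Fintype.card F - 1)))) := by
  have hint := (Algebra.IsIntegral.isIntegral (R := F) a)
  have h1 := alg_resultant (K := K) ((minpoly F a) ^ (k / (minpoly F a).natDegree)) f ((minpoly.monic hint).pow _)
  rw [minpoly_orbit_pow, Nat.mul_div_cancel' ((minpoly_fix a k).2 ha), roots_prod _ _
    (monic_prod_of_monic _ _ (fun i _ => monic_X_sub_C _)).ne_zero] at h1
  simp only [roots_X_sub_C, Multiset.bind_singleton, Multiset.map_map, Function.comp_def, aeval_frob] at h1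
  have h2 : (Multiset.map (fun i => (aeval a f) ^ Fintype.card F ^ i) (Finset.range k).val).prod = 
    (aeval a f) ^ ((Fintype.card F ^ k - 1) / (Fintype.card F - 1)) := by
    rw [← Nat.geomSum_eq Fintype.one_lt_card, ← Finset.prod_pow_eq_pow_sum]; rfl
  rw [h2] at h1
  rw [← h1, resF_alg, psiR]

theorem minpoly_pow_dvd {F K : Type*} [Field F] [Fintype F] [Field K] [Algebra F K] [Algebra.IsAlgebraic F K] (a : K)
    (j : ℕ) (g : F[X]) (hg : g ≠ 0) :
    (minpoly F a) ^ j ∣ g ↔ j ≤ rootMultiplicity a (g.map (algebraMap F K)) := by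
  have hint := (Algebra.IsIntegral.isIntegral (R := F) a)
  have hi := minpoly.irreducible hint
  have hsep : (minpoly F a).Separable := PerfectField.separable_of_irreducible hi
  obtain ⟨s, hs⟩ : (X - C a) ∣ (minpoly F a).map (algebraMap F K) := by
    rw [dvd_iff_isRoot, IsRoot, eval_map_algebraMap, minpoly.aeval]
  have hcop : IsCoprime (X - C a) s := by
    have h2 := hsep.map (f := algebraMap F K)
    rw [hs] at h2
    exact h2.isCoprime
  rw [le_rootMultiplicity_iff (by rwa [Ne, Polynomial.map_eq_zero])]
  constructor
  · intro h
    have h1 := Polynomial.map_dvd (algebraMap F K) h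
    rw [Polynomial.map_pow, hs, mul_pow] at h1
    exact (dvd_mul_right _ _).trans h1
  · induction j generalizing g with
    | zero => intro _; simp
    | succ j ih =>
      intro h
      have h1 : minpoly F a ∣ g := by
        rw [minpoly.dvd_iff, ← eval_map_algebraMap]
        have : (X - C a) ∣ g.map (algebraMap F K) := (dvd_pow_self _ (by omega)).trans h
        rwa [dvd_iff_isRoot] at this
      obtain ⟨g', rfl⟩ := h1
      rw [pow_succ']
      apply mul_dvd_mul_left
      apply ih _ (right_ne_zero_of_mul hg)
      rw [Polynomial.map_mul, hs, pow_succ', mul_assoc] at h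
      have h2 := (mul_dvd_mul_iff_left (X_sub_C_ne_zero a)).1 h
      exact (hcop.pow_left).dvd_of_dvd_mul_left h2

theorem finite_mon (F : Type*) [Field F] [Fintype F] (m : ℕ) : {g : F[X] | g.Monic ∧ g.natDegree = m}.Finite := by
  have h1 : Finite (degreeLT F (m + 1)) := Finite.of_equiv _ (degreeLTEquiv F (m + 1)).symm.toEquiv
  have h2 : ((degreeLT F (m + 1) : Submodule F F[X]) : Set F[X]).Finite := Set.toFinite _
  apply h2.subset
  rintro g ⟨_, hg⟩
  rw [SetLike.mem_coe, mem_degreeLT]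
  refine (degree_le_natDegree).trans_lt ?_
  rw [hg]
  exact_mod_cast Nat.lt_succ_self m

noncomputable def monF (F : Type*) [Field F] [Fintype F] (m : ℕ) : Finset F[X] := (finite_mon F m).toFinset

theorem mem_monF {F : Type*} [Field F] [Fintype F] {m : ℕ} {g : F[X]} :
    g ∈ monF F m ↔ g.Monic ∧ g.natDegree = m := by
  simp [monF]

open scoped Classical in
theorem count_orbits {F K : Type*} [Field F] [Fintype F] [Field K] [Algebra F K] [IsAlgClosed K]
    [Algebra.IsAlgebraic F K] (m : ℕ) (g : F[X]) (hg : g.Monic) (hm : g.natDegree = m) :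
    ∑ k ∈ Finset.Icc 1 m, ((fixK K (Fintype.card F ^ k)).filter
      (fun a => (minpoly F a) ^ (k / (minpoly F a).natDegree) ∣ g)).card = m := by
  have hQ : 1 < Fintype.card F := Fintype.one_lt_card
  set Rts := (g.map (algebraMap F K)).roots.toFinset with hR
  have hg0 : g.map (algebraMap F K) ≠ 0 := (hg.map _).ne_zero
  have epos : ∀ a : K, 0 < (minpoly F a).natDegree := fun a =>
    minpoly.natDegree_pos (Algebra.IsIntegral.isIntegral (R := F) a)
  have h1 : ∀ k ∈ Finset.Icc 1 m, (fixK K (Fintype.card F ^ k)).filter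
      (fun a => (minpoly F a) ^ (k / (minpoly F a).natDegree) ∣ g) =
      Rts.filter (fun a => (minpoly F a).natDegree ∣ k ∧ (minpoly F a) ^ (k / (minpoly F a).natDegree) ∣ g) := by
    intro k hk
    rw [Finset.mem_Icc] at hk
    ext a
    rw [Finset.mem_filter, Finset.mem_filter, mem_fixK (Nat.one_lt_pow (by omega) hQ), ← minpoly_fix]
    constructor
    · rintro ⟨h1, h2⟩
      refine ⟨?_, h1, h2⟩
      rw [hR, Multiset.mem_toFinset, mem_roots hg0, IsRoot, eval_map_algebraMap, ← minpoly.dvd_iff]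
      refine (dvd_pow_self _ ?_).trans h2
      have := Nat.div_pos (Nat.le_of_dvd (by omega) h1) (epos a)
      omega
    · rintro ⟨_, h1, h2⟩
      exact ⟨h1, h2⟩
  rw [Finset.sum_congr rfl (fun k hk => by rw [h1 k hk])]
  simp_rw [Finset.card_filter]
  rw [Finset.sum_comm]
  have h2 : ∀ a ∈ Rts, ∑ k ∈ Finset.Icc 1 m, (if (minpoly F a).natDegree ∣ k ∧ (minpoly F a) ^ (k / (minpoly F a).natDegree) ∣ g then 1 else 0)
      = (g.map (algebraMap F K)).roots.count a := by
    intro a _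
    rw [← Finset.card_filter, count_roots]
    set e := (minpoly F a).natDegree with he
    set μ := rootMultiplicity a (g.map (algebraMap F K)) with hμ
    have heμ : e * μ ≤ m := by
      have := natDegree_le_of_dvd ((minpoly_pow_dvd a μ g hg.ne_zero).2 le_rfl) hg.ne_zero
      rwa [natDegree_pow, hm, mul_comm] at this
    have : (Finset.Icc 1 m).filter (fun k => e ∣ k ∧ (minpoly F a) ^ (k / e) ∣ g) = (Finset.Icc 1 μ).image (fun j => e * j) := by
      ext k
      rw [Finset.mem_filter, Finset.mem_image, Finset.mem_Icc]
      constructor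
      · rintro ⟨h1, ⟨j, rfl⟩, h3⟩
        rw [minpoly_pow_dvd a _ g hg.ne_zero, Nat.mul_div_cancel_left _ (epos a)] at h3
        refine ⟨j, Finset.mem_Icc.2 ⟨?_, h3⟩, rfl⟩
        rcases Nat.eq_zero_or_pos j with rfl | h
        · simp at h1
        · exact h
      · rintro ⟨j, hj, rfl⟩
        rw [Finset.mem_Icc] at hj
        refine ⟨⟨Nat.mul_pos (epos a) hj.1, (Nat.mul_le_mul_left _ hj.2).trans heμ⟩, dvd_mul_right _ _, ?_⟩
        rw [minpoly_pow_dvd a _ g hg.ne_zero, Nat.mul_div_cancel_left _ (epos a)]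
        exact hj.2
    rw [this, Finset.card_image_of_injective _ (fun i j hij => Nat.eq_of_mul_eq_mul_left (epos a) hij)]
    simp
  rw [Finset.sum_congr rfl h2, hR, Multiset.toFinset_sum_count_eq, ← (IsAlgClosed.splits _).natDegree_eq_card_roots,
    natDegree_map, hm]

noncomputable def cSum {F : Type*} [Field F] [Fintype F] (χ : MulChar F ℂ) (f : F[X]) (m : ℕ) : ℂ :=
  ∑ g ∈ monF F m, psiR χ f g

theorem newton_id {F : Type*} (K : Type*) [Field F] [Fintype F] [Field K] [Algebra F K] [IsAlgClosed K]
    [Algebra.IsAlgebraic F K] (χ : MulChar F ℂ) (f : F[X]) (m : ℕ) :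
    (m : ℂ) * cSum χ f m = ∑ k ∈ Finset.Icc 1 m, charS K χ f k * cSum χ f (m - k) := by
  classical
  have hQ : 1 < Fintype.card F := Fintype.one_lt_card
  have h1 : ∀ k ∈ Finset.Icc 1 m, charS K χ f k * cSum χ f (m - k) =
      ∑ g ∈ monF F m, ((fixK K (Fintype.card F ^ k)).filter
      (fun a => (minpoly F a) ^ (k / (minpoly F a).natDegree) ∣ g)).card * psiR χ f g := by
    intro k hk
    rw [Finset.mem_Icc] at hk
    have h2 : ∀ g ∈ monF F m, (((fixK K (Fintype.card F ^ k)).filter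
      (fun a => (minpoly F a) ^ (k / (minpoly F a).natDegree) ∣ g)).card : ℂ) * psiR χ f g = 
      ∑ a ∈ fixK K (Fintype.card F ^ k), if (minpoly F a) ^ (k / (minpoly F a).natDegree) ∣ g then psiR χ f g else 0 := by
      intro g _
      rw [← Finset.sum_filter, Finset.sum_const, nsmul_eq_mul]
    rw [Finset.sum_congr rfl h2, Finset.sum_comm, charS, Finset.sum_mul]
    apply Finset.sum_congr rfl
    intro a ha
    rw [mem_fixK (Nat.one_lt_pow (by omega) hQ)] at ha
    rw [← psiR_minpoly χ f a k ha, cSum, Finset.mul_sum, ← Finset.sum_filter]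
    set T := minpoly F a ^ (k / (minpoly F a).natDegree) with hT
    have hTm : T.Monic := (minpoly.monic (Algebra.IsIntegral.isIntegral (R := F) a)).pow _
    have hTd : T.natDegree = k := by
      rw [hT, natDegree_pow, Nat.div_mul_cancel ((minpoly_fix a k).2 ha)]
    apply Finset.sum_bij (fun g _ => T * g)
    · intro g hg
      rw [mem_monF] at hg
      rw [Finset.mem_filter, mem_monF]
      refine ⟨⟨hTm.mul hg.1, ?_⟩, dvd_mul_right _ _⟩
      rw [hTm.natDegree_mul hg.1, hTd, hg.2]
      omega
    · intro g _ g' _ h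
      exact mul_left_cancel₀ hTm.ne_zero h
    · intro g hg
      rw [Finset.mem_filter, mem_monF] at hg
      obtain ⟨⟨hgm, hgd⟩, g', rfl⟩ := hg
      have hg'm : g'.Monic := hTm.of_mul_monic_left hgm
      refine ⟨g', ?_, rfl⟩
      rw [mem_monF]
      refine ⟨hg'm, ?_⟩
      rw [hTm.natDegree_mul hg'm, hTd] at hgd
      omega
    · intro g hg
      rw [mem_monF] at hg
      rw [psiR_mul χ f hTm hg.1]
  rw [Finset.sum_congr rfl h1, Finset.sum_comm, cSum, Finset.mul_sum]
  apply Finset.sum_congr rfl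
  intro g hg
  rw [mem_monF] at hg
  rw [← Finset.sum_mul, ← Nat.cast_sum, count_orbits m g hg.1 hg.2]

theorem cSum_zero {F : Type*} [Field F] [Fintype F] (χ : MulChar F ℂ) (f : F[X]) : cSum χ f 0 = 1 := by
  have : monF F 0 = {1} := by
    ext g
    rw [mem_monF, Finset.mem_singleton]
    constructor
    · rintro ⟨h1, h2⟩
      exact h1.natDegree_eq_zero.1 h2
    · rintro rfl; simp [monic_one]
  rw [cSum, this, Finset.sum_singleton, psiR]
  simp

theorem cSum_one {F : Type*} [Field F] [Fintype F] (χ : MulChar F ℂ) (f : F[X]) :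
    cSum χ f 1 = ∑ a : F, χ (f.eval a) := by
  rw [cSum]
  symm
  apply Finset.sum_bij (fun a _ => X - C a)
  · intro a _
    rw [mem_monF]
    exact ⟨monic_X_sub_C a, natDegree_X_sub_C a⟩
  · intro a _ b _ h
    simpa using h
  · intro g hg
    rw [mem_monF] at hg
    refine ⟨- g.coeff 0, Finset.mem_univ _, ?_⟩
    rw [map_neg, sub_neg_eq_add, ← hg.1.eq_X_add_C hg.2]
  · intro a _
    rw [psiR]
    congr 1
    have := resultant_X_sub_C_pow_left a f 1 f.natDegree le_rfl
    rw [pow_one, pow_one] at this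
    rw [natDegree_X_sub_C, this]

theorem cSum_vanish {F : Type*} (K : Type*) [Field F] [Fintype F] [Field K] [Algebra F K] [IsAlgClosed K]
    (χ : MulChar F ℂ) (f M : F[X]) (hf : f.Monic) (hM : M.Monic)
    (N₁ N₂ : ℕ) (hfM : f ∣ M ^ N₁) (hMf : M ∣ f ^ N₂) (u : F[X]) (hu : IsCoprime u f)
    (hχu : χ (resultant f u) ≠ 1) (m : ℕ) (hm : M.natDegree ≤ m) : cSum χ f m = 0 := by
  classical
  have hcop : IsCoprime u M := (hu.pow_right (n := N₂)).of_isCoprime_of_dvd_right hMf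
  have hroot : ∀ ρ : K, aeval ρ f = 0 → aeval ρ M = 0 := by
    intro ρ h
    obtain ⟨w, hw⟩ := hfM
    have := congrArg (aeval ρ) hw
    rw [map_mul, h, zero_mul, map_pow] at this
    exact eq_zero_of_pow_eq_zero this
  set σ : F[X] → F[X] := fun g => M * (g /ₘ M) + (u * g) %ₘ M with hσ
  have hdeg : M.degree ≤ (m : WithBot ℕ) := by
    rw [degree_eq_natDegree hM.ne_zero]; exact_mod_cast hm
  have hσmem : ∀ g ∈ monF F m, σ g ∈ monF F m := by
    intro g hg
    rw [mem_monF] at hg ⊢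
    have hgd : g.degree = m := by rw [degree_eq_natDegree hg.1.ne_zero, hg.2]
    have hlt : ((u * g) %ₘ M - g %ₘ M).degree < g.degree := by
      rw [hgd]
      refine (degree_sub_le _ _).trans_lt (max_lt ?_ ?_)
      · exact (degree_modByMonic_lt _ hM).trans_le hdeg
      · exact (degree_modByMonic_lt _ hM).trans_le hdeg
    have h1 : σ g = g + ((u * g) %ₘ M - g %ₘ M) := by
      have := modByMonic_add_div g M
      rw [hσ]
      linear_combination this
    rw [h1]
    refine ⟨hg.1.add_of_left hlt, ?_⟩
    rw [natDegree_add_eq_left_of_degree_lt hlt, hg.2]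
  have hσinj : Set.InjOn σ (monF F m) := by
    intro g _ g' _ h
    have h1 := div_modByMonic_unique (g /ₘ M) ((u * g) %ₘ M) hM ⟨by rw [add_comm], degree_modByMonic_lt _ hM⟩
    have h2 := div_modByMonic_unique (g' /ₘ M) ((u * g') %ₘ M) hM ⟨by rw [add_comm], degree_modByMonic_lt _ hM⟩
    have h : M * (g /ₘ M) + (u * g) %ₘ M = M * (g' /ₘ M) + (u * g') %ₘ M := h
    rw [h] at h1
    have h3 : g /ₘ M = g' /ₘ M := h1.1.symm.trans h2.1
    have h4 : (u * g) %ₘ M = (u * g') %ₘ M := h1.2.symm.trans h2.2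
    have h5 : M ∣ u * (g - g') := by
      rw [← modByMonic_eq_zero_iff_dvd hM, mul_sub, sub_modByMonic, h4, sub_self]
    have h6 : M ∣ g - g' := hcop.symm.dvd_of_dvd_mul_left h5
    rw [← modByMonic_eq_zero_iff_dvd hM, sub_modByMonic, sub_eq_zero] at h6
    rw [← modByMonic_add_div g M, ← modByMonic_add_div g' M, h3, h6]
  have himg : (monF F m).image σ = monF F m := by
    apply Finset.eq_of_subset_of_card_le
    · intro x hx
      obtain ⟨g, hg, rfl⟩ := Finset.mem_image.1 hx
      exact hσmem g hg
    · rw [Finset.card_image_of_injOn hσinj]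
  have hmul : ∀ g ∈ monF F m, psiR χ f (σ g) = χ (resultant f u) * psiR χ f g := by
    intro g hg
    have h1 : resultant f (σ g) = resultant f u * resultant f g := by
      apply (algebraMap F K).injective
      rw [map_mul, alg_resultant f _ hf, alg_resultant f _ hf, alg_resultant f _ hf, ← Multiset.prod_map_mul]
      congr 1
      apply Multiset.map_congr rfl
      intro ρ hρ
      rw [mem_roots (hf.map _).ne_zero, IsRoot, eval_map_algebraMap] at hρ
      have h2 := hroot ρ hρ
      have h3 := congrArg (aeval ρ) (modByMonic_add_div (u * g) M)
      rw [map_add, map_mul, h2, zero_mul, add_zero, map_mul] at h3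
      rw [hσ]
      simp only [map_add, map_mul, h2, zero_mul, zero_add, h3]
    rw [psiR, psiR, resultant_comm, resultant_comm g, h1, (mem_monF.1 hg).2, (mem_monF.1 (hσmem g hg)).2, ← map_mul]
    congr 1
    ring
  have hfin : cSum χ f m = χ (resultant f u) * cSum χ f m := by
    conv_lhs => rw [cSum, ← himg, Finset.sum_image hσinj, Finset.sum_congr rfl hmul, ← Finset.mul_sum]
    rfl
  have : (1 - χ (resultant f u)) * cSum χ f m = 0 := by
    rw [sub_mul, one_mul, sub_eq_zero]; exact hfin
  rcases mul_eq_zero.1 this with h | h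
  · exact absurd (sub_eq_zero.1 h).symm hχu
  · exact h

theorem exists_nontriv {F : Type*} (K : Type*) [Field F] [Fintype F] [Field K] [Algebra F K] [IsAlgClosed K]
    [Algebra.IsAlgebraic F K] (χ : MulChar F ℂ) (f : F[X]) (hf : f.Monic) (C : ℝ) (hC : 0 ≤ C)
    (hS : ∀ k, 0 < k → ‖charS K χ f k‖ ≤ C * (Real.sqrt (Fintype.card F)) ^ k) :
    ∃ u : F[X], IsCoprime u f ∧ χ (resultant f u) ≠ 1 := by
  classical
  by_contra hcon
  push Not at hcon
  set Q := Fintype.card F with hQdef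
  have hQ : 1 < Q := Fintype.one_lt_card
  obtain ⟨p, hpF⟩ := CharP.exists F
  obtain ⟨n0, hp, hcard⟩ := FiniteField.card F p
  have _c : CharP K p := charP_of_injective_algebraMap (algebraMap F K).injective p
  have hpQ : p ∣ Q := by
    rw [hQdef, hcard]; exact dvd_pow_self _ n0.ne_zero
  have key : ∀ k, 0 < k → Even k → charS K χ f k = (((fixK K (Q ^ k)).filter (fun a => aeval a f ≠ 0)).card : ℂ) := by
    intro k hk hev
    have hq1 : 1 < Q ^ k := Nat.one_lt_pow hk.ne' hQ
    rw [charS, Finset.card_filter, Nat.cast_sum]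
    apply Finset.sum_congr rfl
    intro a ha
    rw [mem_fixK hq1] at ha
    by_cases h0 : aeval a f = 0
    · rw [h0, zero_pow, ← map_zero (algebraMap F K), resF_alg, MulChar.map_zero]
      · simp
      · have := Nat.div_pos (Nat.le_of_dvd (by omega) (Nat.sub_one_dvd_pow_sub_one Q k)) (by omega : 0 < Q - 1)
        exact this.ne'
    · rw [← psiR_minpoly χ f a k ha, psiR, resultant_comm, if_pos h0]
      have hint := (Algebra.IsIntegral.isIntegral (R := F) a)
      have hdeg : (minpoly F a ^ (k / (minpoly F a).natDegree)).natDegree = k := by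
        rw [natDegree_pow, Nat.div_mul_cancel ((minpoly_fix a k).2 ha)]
      have hco : IsCoprime (minpoly F a) f := by
        rw [(minpoly.irreducible hint).coprime_iff_not_dvd, minpoly.dvd_iff]
        exact h0
      rw [hdeg, (hev.mul_right _).neg_one_pow, one_mul]
      have := hcon _ (hco.pow_left (m := k / (minpoly F a).natDegree))
      rw [hdeg] at this
      rw [this]; simp
  have key2 : ∀ j : ℕ, 0 < j → (Q : ℝ) ^ j ≤ C + f.natDegree := by
    intro j hj
    have h1 := hS (2 * j) (by omega)
    rw [key (2 * j) (by omega) (even_two_mul j), Complex.norm_natCast, pow_mul (Real.sqrt _), Real.sq_sqrt (by positivity)] at h1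
    have hq1 : 1 < Q ^ (2 * j) := Nat.one_lt_pow (by omega) hQ
    have h2 : Q ^ (2 * j) ≤ ((fixK K (Q ^ (2 * j))).filter (fun a => aeval a f ≠ 0)).card + f.natDegree := by
      have hcf := card_fixK (K := K) p hq1 (dvd_pow hpQ (by omega))
      rw [← Finset.card_filter_add_card_filter_not (s := fixK K (Q ^ (2 * j))) (fun a => aeval a f ≠ 0)] at hcf
      refine hcf.symm.le.trans ?_
      apply Nat.add_le_add_left
      have hsub : (fixK K (Q ^ (2 * j))).filter (fun a => ¬ aeval a f ≠ 0) ⊆ (f.map (algebraMap F K)).roots.toFinset := by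
        intro a ha
        rw [Finset.mem_filter, not_not] at ha
        rw [Multiset.mem_toFinset, mem_roots (hf.map _).ne_zero, IsRoot, eval_map_algebraMap, ha.2]
      calc _ ≤ _ := Finset.card_le_card hsub
        _ ≤ _ := Multiset.toFinset_card_le _
        _ ≤ _ := card_roots' _
        _ = _ := by simp
    have h3 : ((Q : ℝ) ^ j) * (Q : ℝ) ^ j ≤ ((fixK K (Q ^ (2 * j))).filter (fun a => aeval a f ≠ 0)).card + f.natDegree := by
      rw [← pow_add, ← two_mul]; exact_mod_cast h2
    have h4 : (1 : ℝ) ≤ (Q : ℝ) ^ j := one_le_pow₀ (by exact_mod_cast hQ.le)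
    have h5 : (f.natDegree : ℝ) ≤ f.natDegree * (Q : ℝ) ^ j := le_mul_of_one_le_right (by positivity) h4
    have h6 : (Q : ℝ) ^ j * (Q : ℝ) ^ j ≤ (C + f.natDegree) * (Q : ℝ) ^ j := by linarith
    exact le_of_mul_le_mul_right h6 (by linarith)
  obtain ⟨j, hj⟩ := pow_unbounded_of_one_lt (C + f.natDegree) (by exact_mod_cast hQ : (1 : ℝ) < Q)
  have h1 := key2 (j + 1) (by omega)
  have h2 : (Q : ℝ) ^ j ≤ (Q : ℝ) ^ (j + 1) := pow_le_pow_right₀ (by exact_mod_cast hQ.le) (by omega)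
  linarith

theorem newton_root (c S : ℕ → ℂ) (D : ℕ) (C R : ℝ) (hR : 0 < R) (hC : 0 ≤ C)
    (h0 : c 0 = 1) (hD : ∀ m, D ≤ m → c m = 0) (hS : ∀ k, 0 < k → ‖S k‖ ≤ C * R ^ k)
    (hN : ∀ m : ℕ, (m : ℂ) * c m = ∑ k ∈ Finset.Icc 1 m, S k * c (m - k))
    (L : ℂ[X]) (hL : ∀ m, L.coeff m = c m) (ρ : ℂ) (hρ : L.eval ρ = 0) : 1 ≤ R * ‖ρ‖ := by
  by_contra hcon
  push Not at hcon
  have hL0 : L ≠ 0 := by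
    intro h; have := hL 0; rw [h, h0] at this; simp at this
  have hρ0 : ρ ≠ 0 := by
    rintro rfl
    rw [← coeff_zero_eq_eval_zero, hL, h0] at hρ
    exact one_ne_zero hρ
  set S' : ℕ → ℂ := fun k => if k = 0 then 0 else S k with hS'
  have hS'b : ∀ k, ‖S' k‖ ≤ C * R ^ k := by
    intro k
    by_cases hk : k = 0
    · simp [hS', hk, hC]
    · simp only [hS', hk, if_false]; exact hS k (Nat.pos_of_ne_zero hk)
  -- the basic identity
  have hid : ∀ t : ℂ, R * ‖t‖ < 1 → L.eval t * (∑' k, S' k * t ^ k) = t * (derivative L).eval t := by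
    intro t ht
    have hsumS : Summable (fun k => ‖S' k * t ^ k‖) := by
      refine Summable.of_nonneg_of_le (fun _ => norm_nonneg _) (fun k => ?_)
        ((summable_geometric_of_lt_one (r := R * ‖t‖) (by positivity) ht).mul_left C)
      rw [norm_mul, norm_pow, mul_pow, ← mul_assoc]
      exact mul_le_mul_of_nonneg_right (hS'b k) (by positivity)
    have hsupp : ∀ k ∉ Finset.range D, c k * t ^ k = 0 := by
      intro k hk
      rw [Finset.mem_range, not_lt] at hk
      rw [hD k hk, zero_mul]
    have hsumc : Summable (fun k => ‖c k * t ^ k‖) := by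
      apply summable_of_ne_finset_zero (s := Finset.range D)
      intro k hk
      rw [hsupp k hk, norm_zero]
    have hdeg : L.natDegree < D + 1 := by
      rw [Nat.lt_succ_iff, natDegree_le_iff_coeff_eq_zero]
      intro N hN
      rw [hL, hD N hN.le]
    have hLe : L.eval t = ∑' k, c k * t ^ k := by
      rw [tsum_eq_sum (s := Finset.range (D + 1)), eval_eq_sum_range' hdeg]
      · simp_rw [hL]
      · intro k hk
        rw [Finset.mem_range, not_lt] at hk
        rw [hD k (by omega), zero_mul]
    have hLd : t * (derivative L).eval t = ∑' m : ℕ, ((m : ℂ) * c m) * t ^ m := by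
      have h1 : t * (derivative L).eval t = (X * derivative L).eval t := by simp
      have h2 : ∀ m : ℕ, (X * derivative L).coeff m = (m : ℂ) * c m := by
        intro m
        cases m with
        | zero => simp
        | succ m => rw [coeff_X_mul, coeff_derivative, hL]; push_cast; ring
      have h3 : (X * derivative L).natDegree < D + 1 := by
        rw [Nat.lt_succ_iff, natDegree_le_iff_coeff_eq_zero]
        intro N hN
        rw [h2, hD N hN.le, mul_zero]
      rw [h1, tsum_eq_sum (s := Finset.range (D + 1)), eval_eq_sum_range' h3]
      · simp_rw [h2]
      · intro k hk
        rw [Finset.mem_range, not_lt] at hk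
        rw [hD k (by omega), mul_zero, zero_mul]
    rw [hLe, hLd, mul_comm, tsum_mul_tsum_eq_tsum_sum_antidiagonal_of_summable_norm hsumS hsumc]
    apply tsum_congr
    intro m
    rw [hN m, Finset.sum_mul, Finset.Nat.sum_antidiagonal_eq_sum_range_succ_mk, Finset.sum_range_succ']
    simp only [hS', if_true, zero_mul, add_zero, Nat.succ_ne_zero, if_false]
    rw [← Finset.Ico_add_one_right_eq_Icc, Finset.sum_Ico_eq_sum_range]
    simp only [Nat.add_sub_cancel]
    apply Finset.sum_congr rfl
    intro k hk
    rw [Finset.mem_range] at hk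
    rw [add_comm 1 k]
    have : t ^ m = t ^ (k + 1) * t ^ (m - (k + 1)) := by rw [← pow_add]; congr 1; omega
    rw [this]; ring
  obtain ⟨G, hG1, hG2⟩ := exists_eq_pow_rootMultiplicity_mul_and_not_dvd L hL0 ρ
  set μ := rootMultiplicity ρ L with hμ
  have hμ0 : μ ≠ 0 := by
    have := (rootMultiplicity_pos hL0).2 hρ
    omega
  rw [dvd_iff_isRoot, IsRoot] at hG2
  obtain ⟨r, hr1, hr2⟩ := exists_between hcon
  have hopen : ∀ᶠ t in nhdsWithin ρ {ρ}ᶜ, R * ‖t‖ < r := by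
    apply Filter.Eventually.filter_mono nhdsWithin_le_nhds
    have hcont : Continuous (fun t : ℂ => R * ‖t‖) := by fun_prop
    exact hcont.continuousAt.eventually_lt_const hr1
  have hr0 : 0 ≤ r := le_trans (by positivity) hr1.le
  set B := ∑' k, C * r ^ k with hB
  have hsB : Summable (fun k => C * r ^ k) := (summable_geometric_of_lt_one hr0 hr2).mul_left C
  have hineq : ∀ᶠ t in nhdsWithin ρ {ρ}ᶜ,
      ‖t * ((μ : ℂ) * G.eval t + (t - ρ) * (derivative G).eval t)‖ ≤ ‖(t - ρ) * G.eval t‖ * B := by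
    filter_upwards [hopen, self_mem_nhdsWithin] with t ht htρ
    have htρ' : t - ρ ≠ 0 := sub_ne_zero.2 htρ
    have h1 := hid t (ht.trans hr2)
    have hLt : L.eval t = (t - ρ) ^ μ * G.eval t := by
      conv_lhs => rw [hG1]
      simp
    have hLdt : (derivative L).eval t = (t - ρ) ^ (μ - 1) * ((μ : ℂ) * G.eval t + (t - ρ) * (derivative G).eval t) := by
      conv_lhs => rw [hG1]
      rw [derivative_mul, derivative_X_sub_C_pow]
      simp only [eval_add, eval_mul, eval_pow, eval_sub, eval_X, eval_C]
      have : (t - ρ) ^ μ = (t - ρ) ^ (μ - 1) * (t - ρ) := by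
        rw [← pow_succ, Nat.sub_add_cancel (by omega)]
      rw [this]; ring
    have h2 : (t - ρ) * G.eval t * (∑' k, S' k * t ^ k) = t * ((μ : ℂ) * G.eval t + (t - ρ) * (derivative G).eval t) := by
      have h3 : (t - ρ) ^ μ = (t - ρ) ^ (μ - 1) * (t - ρ) := by
        rw [← pow_succ, Nat.sub_add_cancel (by omega)]
      rw [hLt, hLdt, h3] at h1
      apply mul_left_cancel₀ (pow_ne_zero (μ - 1) htρ')
      linear_combination h1
    rw [← h2, norm_mul]
    apply mul_le_mul_of_nonneg_left _ (norm_nonneg _)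
    apply tsum_of_norm_bounded hsB.hasSum
    intro k
    rw [norm_mul, norm_pow]
    calc ‖S' k‖ * ‖t‖ ^ k ≤ C * R ^ k * ‖t‖ ^ k := mul_le_mul_of_nonneg_right (hS'b k) (by positivity)
      _ = C * (R * ‖t‖) ^ k := by rw [mul_pow]; ring
      _ ≤ C * r ^ k := by gcongr
  have hlim1 : Filter.Tendsto (fun t => ‖t * ((μ : ℂ) * G.eval t + (t - ρ) * (derivative G).eval t)‖)
      (nhdsWithin ρ {ρ}ᶜ) (nhds ‖ρ * ((μ : ℂ) * G.eval ρ + (ρ - ρ) * (derivative G).eval ρ)‖) := by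
    apply Filter.Tendsto.mono_left _ nhdsWithin_le_nhds
    apply Continuous.tendsto (f := fun t => ‖t * ((μ : ℂ) * G.eval t + (t - ρ) * (derivative G).eval t)‖)
    fun_prop
  have hlim2 : Filter.Tendsto (fun t => ‖(t - ρ) * G.eval t‖ * B)
      (nhdsWithin ρ {ρ}ᶜ) (nhds (‖(ρ - ρ) * G.eval ρ‖ * B)) := by
    apply Filter.Tendsto.mono_left _ nhdsWithin_le_nhds
    apply Continuous.tendsto (f := fun t => ‖(t - ρ) * G.eval t‖ * B)
    fun_prop
  have hfin := le_of_tendsto_of_tendsto hlim1 hlim2 hineq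
  rw [sub_self, zero_mul, zero_mul, norm_zero, zero_mul, add_zero, norm_le_zero_iff] at hfin
  have hμC : (μ : ℂ) ≠ 0 := by exact_mod_cast hμ0
  exact (mul_ne_zero hρ0 (mul_ne_zero hμC hG2)) hfin

theorem newton_bound (c S : ℕ → ℂ) (D : ℕ) (C R : ℝ) (hR : 0 < R) (hC : 0 ≤ C)
    (h0 : c 0 = 1) (hD : ∀ m, D ≤ m → c m = 0) (hS : ∀ k, 0 < k → ‖S k‖ ≤ C * R ^ k)
    (hN : ∀ m : ℕ, (m : ℂ) * c m = ∑ k ∈ Finset.Icc 1 m, S k * c (m - k)) :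
    ‖c 1‖ ≤ ((D : ℝ) - 1) * R := by
  have hDpos : D ≠ 0 := by
    rintro rfl
    have := hD 0 le_rfl
    rw [h0] at this
    exact one_ne_zero this
  obtain ⟨E, rfl⟩ := Nat.exists_eq_succ_of_ne_zero hDpos
  push_cast
  rw [add_sub_cancel_right]
  set L : ℂ[X] := ∑ m ∈ Finset.range (E + 1), Polynomial.C (c m) * X ^ m with hLdef
  have hL : ∀ m, L.coeff m = c m := by
    intro m
    rw [hLdef, finsetSum_coeff]
    simp only [coeff_C_mul, coeff_X_pow, mul_ite, mul_one, mul_zero]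
    rw [Finset.sum_ite_eq]
    split_ifs with h
    · rfl
    · rw [Finset.mem_range, not_lt] at h
      exact (hD m h).symm
  set P : ℂ[X] := ∑ m ∈ Finset.range (E + 1), Polynomial.C (c (E - m)) * X ^ m with hPdef
  have hP : ∀ m, P.coeff m = if m ≤ E then c (E - m) else 0 := by
    intro m
    rw [hPdef, finsetSum_coeff]
    simp only [coeff_C_mul, coeff_X_pow, mul_ite, mul_one, mul_zero]
    rw [Finset.sum_ite_eq]
    simp only [Finset.mem_range, Nat.lt_succ_iff]
  have hPdeg : P.natDegree ≤ E := by
    rw [natDegree_le_iff_coeff_eq_zero]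
    intro N hN
    rw [hP, if_neg (by omega)]
  have hPE : P.coeff E = 1 := by rw [hP, if_pos le_rfl, Nat.sub_self, h0]
  have hPm : P.Monic := monic_of_natDegree_le_of_coeff_eq_one E hPdeg hPE
  have hPd : P.natDegree = E := le_antisymm hPdeg (le_natDegree_of_ne_zero (by rw [hPE]; exact one_ne_zero))
  have hroots : ∀ ω ∈ P.roots, ‖ω‖ ≤ R := by
    intro ω hω
    rw [mem_roots hPm.ne_zero, IsRoot] at hω
    by_cases hω0 : ω = 0
    · rw [hω0, norm_zero]; exact hR.le
    have h1 : L.eval ω⁻¹ = 0 := by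
      have h2 : ω ^ E * L.eval ω⁻¹ = P.eval ω := by
        rw [hLdef, hPdef, eval_finsetSum, eval_finsetSum, Finset.mul_sum,
          ← Finset.sum_range_reflect]
        apply Finset.sum_congr rfl
        intro m hm
        rw [Finset.mem_range] at hm
        simp only [eval_mul, eval_C, eval_pow, eval_X]
        rw [show E + 1 - 1 - m = E - m by omega]
        have h3 : ω ^ E = ω ^ m * ω ^ (E - m) := by rw [← pow_add]; congr 1; omega
        rw [h3, inv_pow]
        field_simp
      rw [hω] at h2
      exact (mul_eq_zero.1 h2).resolve_left (pow_ne_zero _ hω0)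
    have h2 := newton_root c S (E + 1) C R hR hC h0 hD hS hN L hL _ h1
    rw [norm_inv, ← div_eq_mul_inv, le_div_iff₀ (norm_pos_iff.2 hω0), one_mul] at h2
    exact h2
  by_cases hE : E = 0
  · subst hE
    rw [hD 1 (by omega)]
    simp
  have hnext : P.nextCoeff = c 1 := by
    rw [nextCoeff_of_natDegree_pos (by omega), hPd, hP, if_pos (by omega)]
    congr 1; omega
  have hsplit : P.Splits := IsAlgClosed.splits P
  have h1 := hsplit.nextCoeff_eq_neg_sum_roots_of_monic hPm
  rw [← hnext, h1, norm_neg]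
  calc ‖P.roots.sum‖ ≤ (P.roots.map (fun ω => ‖ω‖)).sum := norm_multiset_sum_le _
    _ ≤ Multiset.card (P.roots.map (fun ω => ‖ω‖)) • R := by
        apply Multiset.sum_le_card_nsmul
        intro x hx
        obtain ⟨ω, hω, rfl⟩ := Multiset.mem_map.1 hx
        exact hroots ω hω
    _ = E * R := by
        rw [Multiset.card_map, ← hsplit.natDegree_eq_card_roots, hPd, nsmul_eq_mul]

theorem weil_core1 {F : Type*} [Field F] [Fintype F] (χ : MulChar F ℂ) (hχ : 1 < orderOf χ) (h M : F[X])
    (hmon : h.Monic) (hM : M.Monic) (N₁ N₂ : ℕ) (hfM : h ∣ M ^ N₁) (hMf : M ∣ h ^ N₂)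
    (hpow : ∀ l, l ∣ orderOf χ → l ≠ 1 → ∀ b : F[X], b.Monic → b ^ l ≠ h) :
    ‖∑ a : F, χ (h.eval a)‖ ≤ ((M.natDegree : ℝ) - 1) * Real.sqrt (Fintype.card F) := by
  obtain ⟨C, hC, hS⟩ := charS_bound (K := AlgebraicClosure F) χ hχ h hmon hpow
  obtain ⟨u, hu, hχu⟩ := exists_nontriv (AlgebraicClosure F) χ h hmon C hC hS
  rw [← cSum_one]
  have hcard : (0 : ℝ) < Fintype.card F := by exact_mod_cast Fintype.card_pos
  exact newton_bound (cSum χ h) (charS (AlgebraicClosure F) χ h) M.natDegree C _ (Real.sqrt_pos.2 hcard) hC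
    (cSum_zero χ h)
    (fun m hm => cSum_vanish (AlgebraicClosure F) χ h M hmon hM N₁ N₂ hfM hMf u hu hχu m hm) hS
    (newton_id (AlgebraicClosure F) χ h)

theorem weil_core2 {F : Type*} [Field F] [Fintype F] (χ : MulChar F ℂ) (f M : F[X])
    (hmon : f.Monic) (hM : M.Monic) (N₁ N₂ : ℕ) (hfM : f ∣ M ^ N₁) (hMf : M ∣ f ^ N₂)
    (hpow : ∀ b : F[X], b.Monic → b ^ orderOf χ ≠ f) :
    ‖∑ a : F, χ (f.eval a)‖ ≤ ((M.natDegree : ℝ) - 1) * Real.sqrt (Fintype.card F) := by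
  classical
  have hd : 0 < orderOf χ := χ.orderOf_pos
  set s := (Nat.divisors (orderOf χ)).filter (fun e => ∃ h : F[X], h.Monic ∧ h ^ e = f) with hs
  have hne : s.Nonempty := ⟨1, by
    rw [hs, Finset.mem_filter, Nat.mem_divisors]
    exact ⟨⟨one_dvd _, hd.ne'⟩, f, hmon, pow_one f⟩⟩
  obtain ⟨e, he, hmax⟩ := s.exists_max_image id hne
  rw [hs, Finset.mem_filter, Nat.mem_divisors] at he
  obtain ⟨⟨hed, _⟩, h, hh, hhe⟩ := he
  have he0 : e ≠ 0 := by rintro rfl; exact hd.ne' (Nat.eq_zero_of_zero_dvd hed)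
  have hord : orderOf (χ ^ e) = orderOf χ / e := orderOf_pow_of_dvd he0 hed
  obtain ⟨r, hr⟩ := hed
  have hr' : orderOf χ / e = r := by rw [hr]; exact Nat.mul_div_cancel_left _ (Nat.pos_of_ne_zero he0)
  have hr1 : 1 < r := by
    rcases Nat.lt_trichotomy r 1 with h1 | h1 | h1
    · have : r = 0 := by omega
      rw [this, mul_zero] at hr; omega
    · rw [h1, mul_one] at hr
      exact absurd (hr ▸ hhe) (hpow h hh)
    · exact h1
  have hsum : ∑ a : F, χ (f.eval a) = ∑ a : F, (χ ^ e) (h.eval a) := by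
    apply Finset.sum_congr rfl
    intro a _
    rw [MulChar.pow_apply' _ he0, ← hhe, eval_pow, map_pow]
  rw [hsum]
  apply weil_core1 (χ ^ e) (by rw [hord, hr']; exact hr1) h M hh hM N₁ (e * N₂)
  · exact ((dvd_pow_self h he0).trans hhe.dvd).trans hfM
  · rwa [pow_mul, hhe]
  · intro l hl hl1 b hb hbl
    rw [hord, hr'] at hl
    have hmem : l * e ∈ s := by
      rw [hs, Finset.mem_filter, Nat.mem_divisors]
      refine ⟨⟨?_, hd.ne'⟩, b, hb, by rw [pow_mul, hbl, hhe]⟩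
      rw [hr, mul_comm]
      exact Nat.mul_dvd_mul_left e hl
    have h1 : l * e ≤ e := hmax _ hmem
    have hl0 : l ≠ 0 := by rintro rfl; rw [Nat.zero_dvd] at hl; omega
    have : 2 * e ≤ l * e := Nat.mul_le_mul_right e (by omega)
    omega

theorem weil_final {F : Type*} [Field F] [Fintype F]
    (r : ℕ) (fi : Fin r → Polynomial F) (ai : Fin r → ℤ)
    (hfi : ∀ i, Irreducible (fi i)) 
    (χ : MulChar F ℂ) 
    (hnotpow : ¬ ∃ (c : F) (h : RatFunc F), c ≠ 0 ∧
      (∏ i, (algebraMap (Polynomial F) (RatFunc F) (fi i)) ^ ai i) = RatFunc.C c * h ^ orderOf χ)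
    (s : Finset F) (hs : ∀ ε, ε ∈ s ↔ ∀ i, ai i < 0 → (fi i).eval ε ≠ 0) (hai : ∀ i, ai i ≠ 0) :
    ‖(∑ ε ∈ s, χ (∏ i, (fi i).eval ε ^ ai i))‖ ≤
      ((∑ i, ((fi i).natDegree : ℝ)) - 1) * Real.sqrt (Fintype.card F) := by
  classical
  set d := orderOf χ with hd
  have hd0 : 0 < d := χ.orderOf_pos
  set l : Fin r → F := fun i => (fi i).leadingCoeff with hl
  have hl0 : ∀ i, l i ≠ 0 := fun i => leadingCoeff_ne_zero.2 (hfi i).ne_zero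
  set g : Fin r → F[X] := fun i => fi i * C (l i)⁻¹ with hg
  have hgm : ∀ i, (g i).Monic := fun i => monic_mul_leadingCoeff_inv (hfi i).ne_zero
  have hfg : ∀ i, fi i = C (l i) * g i := by
    intro i
    rw [hg]
    simp only
    rw [mul_left_comm, ← C_mul, mul_inv_cancel₀ (hl0 i), C_1, mul_one]
  have hgd : ∀ i, (g i).natDegree = (fi i).natDegree := by
    intro i
    rw [hfg i, natDegree_C_mul (hl0 i)]
  set b : Fin r → ℕ := fun i => (ai i % d).toNat + d with hb
  set t : Fin r → ℤ := fun i => 1 - ai i / d with ht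
  have hab : ∀ i, (b i : ℤ) = ai i + d * t i := by
    intro i
    have h1 : 0 ≤ ai i % d := Int.emod_nonneg _ (by omega)
    have h2 := Int.emod_add_mul_ediv (ai i) d
    rw [hb, ht]
    push_cast
    rw [Int.toNat_of_nonneg h1]
    linear_combination h2
  have hb0 : ∀ i, b i ≠ 0 := by intro i; simp only [hb]; omega
  set c : F := ∏ i, l i ^ ai i with hc
  have hc0 : c ≠ 0 := Finset.prod_ne_zero_iff.2 (fun i _ => zpow_ne_zero _ (hl0 i))
  set f : F[X] := ∏ i, g i ^ b i with hf
  set M : F[X] := ∏ i, g i with hM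
  have hfm : f.Monic := monic_prod_of_monic _ _ (fun i _ => (hgm i).pow _)
  have hMm : M.Monic := monic_prod_of_monic _ _ (fun i _ => hgm i)
  have hMd : (M.natDegree : ℝ) = ∑ i, ((fi i).natDegree : ℝ) := by
    rw [hM, natDegree_prod_of_monic _ _ (fun i _ => hgm i), Nat.cast_sum]
    simp_rw [hgd]
  have hfM : f ∣ M ^ (∑ i, b i) := by
    rw [hf, hM, ← Finset.prod_pow]
    apply Finset.prod_dvd_prod_of_dvd
    intro i _
    exact pow_dvd_pow _ (Finset.single_le_sum (f := b) (fun _ _ => Nat.zero_le _) (Finset.mem_univ i))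
  have hMf : M ∣ f ^ 1 := by
    rw [pow_one, hf, hM]
    apply Finset.prod_dvd_prod_of_dvd
    intro i _
    exact dvd_pow_self _ (hb0 i)
  have gen : ∀ {E : Type _} [Field E] (x y z : Fin r → E), (∀ i, z i ≠ 0) → (∀ i, x i = y i * z i) →
      (∏ i, x i ^ ai i) * (∏ i, z i ^ t i) ^ d = (∏ i, y i ^ ai i) * ∏ i, z i ^ b i := by
    intro E _ x y z hz hxy
    rw [← Finset.prod_pow, ← Finset.prod_mul_distrib, ← Finset.prod_mul_distrib]
    apply Finset.prod_congr rfl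
    intro i _
    rw [hxy i, mul_zpow, mul_assoc, ← zpow_natCast (z i ^ t i), ← zpow_mul, ← zpow_add₀ (hz i), ← zpow_natCast (z i), hab i,
      mul_comm (t i)]
  have hnp : ∀ v : F[X], v.Monic → v ^ d ≠ f := by
    intro v _ hv
    apply hnotpow
    have hz : ∀ i, algebraMap F[X] (RatFunc F) (g i) ≠ 0 := by
      intro i
      rw [Ne, FaithfulSMul.algebraMap_eq_zero_iff]
      exact (hgm i).ne_zero
    have h1 := gen (fun i => algebraMap F[X] (RatFunc F) (fi i)) (fun i => RatFunc.C (l i))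
      (fun i => algebraMap F[X] (RatFunc F) (g i)) hz (fun i => by
        rw [hfg i, map_mul, RatFunc.algebraMap_C])
    set w := ∏ i, algebraMap F[X] (RatFunc F) (g i) ^ t i with hw
    have hw0 : w ≠ 0 := Finset.prod_ne_zero_iff.2 (fun i _ => zpow_ne_zero _ (hz i))
    refine ⟨c, algebraMap F[X] (RatFunc F) v / w, hc0, ?_⟩
    rw [div_pow, ← map_pow, hv, ← mul_div_assoc, eq_div_iff (pow_ne_zero _ hw0), h1, hf, hc]
    simp only [map_prod, map_zpow₀, map_pow]
  have hχ1 : ∀ x : F, x ≠ 0 → χ x ^ d = 1 := by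
    intro x hx
    rw [← MulChar.pow_apply' _ hd0.ne', hd, pow_orderOf_eq_one, MulChar.one_apply (Ne.isUnit hx)]
  have hterm : ∀ ε : F, (if ε ∈ s then χ (∏ i, (fi i).eval ε ^ ai i) else 0) = χ c * χ (f.eval ε) := by
    intro ε
    by_cases h0 : ∃ i, (fi i).eval ε = 0
    · obtain ⟨i, hi⟩ := h0
      have hgi : (g i).eval ε = 0 := by simp only [hg, eval_mul, hi, zero_mul]
      have hfe : f.eval ε = 0 := by
        rw [hf, eval_prod]
        exact Finset.prod_eq_zero (Finset.mem_univ i) (by rw [eval_pow, hgi, zero_pow (hb0 i)])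
      rw [hfe, MulChar.map_zero, mul_zero]
      split_ifs with hε
      · rw [Finset.prod_eq_zero (Finset.mem_univ i), MulChar.map_zero]
        rw [hi, zero_zpow _ (hai i)]
      · rfl
    · push Not at h0
      rw [if_pos ((hs ε).2 (fun i _ => h0 i))]
      have hz : ∀ i, (g i).eval ε ≠ 0 := by
        intro i hi
        apply h0 i
        rw [hfg i, eval_mul, hi, mul_zero]
      have h1 := gen (fun i => (fi i).eval ε) l (fun i => (g i).eval ε) hz (fun i => by
        conv_lhs => rw [hfg i]
        rw [eval_mul, eval_C])
      have hw0 : ∏ i, (g i).eval ε ^ t i ≠ 0 := Finset.prod_ne_zero_iff.2 (fun i _ => zpow_ne_zero _ (hz i))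
      have h2 := congrArg χ h1
      rw [map_mul, map_pow, hχ1 _ hw0, mul_one, map_mul] at h2
      rw [h2, hf, eval_prod]
      simp only [eval_pow]
      rfl
  have hsum : ∑ ε ∈ s, χ (∏ i, (fi i).eval ε ^ ai i) = χ c * ∑ ε : F, χ (f.eval ε) := by
    rw [Finset.mul_sum, ← Finset.sum_congr rfl (fun ε _ => hterm ε), ← Finset.sum_filter, Finset.filter_mem_eq_inter,
      Finset.univ_inter]
  have hnc : ‖χ c‖ = 1 := Complex.norm_eq_one_of_pow_eq_one (hχ1 c hc0) hd0.ne'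
  rw [hsum, norm_mul, hnc, one_mul, ← hMd]
  exact weil_core2 χ f M hfm hMm _ 1 hfM hMf hnp

open scoped Classical in
theorem weil_bound_multiplicative_char (q n : ℕ)
    (hq : ∃ p k : ℕ, p.Prime ∧ 0 < k ∧ q = p ^ k) (hn : 0 < n)
    (F : Type) [Field F] [Fintype F] (hcardF : Fintype.card F = q ^ n)
    (r : ℕ) (fi : Fin r → Polynomial F) (ai : Fin r → ℤ)
    (hfi : ∀ i, Irreducible (fi i)) (hinj : Function.Injective fi)
    (hai : ∀ i, ai i ≠ 0)
    (χ : MulChar F ℂ) (d : ℕ) (hd : orderOf χ = d)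
    (hnotpow : ¬ ∃ (c : F) (h : RatFunc F), c ≠ 0 ∧
      (∏ i, (algebraMap (Polynomial F) (RatFunc F) (fi i)) ^ ai i) = RatFunc.C c * h ^ d) :
    ‖(∑ ε ∈ Finset.univ.filter (fun ε : F => ∀ i, ai i < 0 → (fi i).eval ε ≠ 0),
        χ (∏ i, (fi i).eval ε ^ ai i))‖ ≤
      ((∑ i, ((fi i).natDegree : ℝ)) - 1) * (q : ℝ) ^ ((n : ℝ) / 2) := by
  have h1 := weil_final r fi ai hfi χ (by rw [hd]; exact hnotpow)
    (Finset.univ.filter (fun ε : F => ∀ i, ai i < 0 → (fi i).eval ε ≠ 0)) (fun ε => by simp) hai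
  have h2 : Real.sqrt (Fintype.card F) = (q : ℝ) ^ ((n : ℝ) / 2) := by
    rw [hcardF, Nat.cast_pow, Real.sqrt_eq_rpow, ← Real.rpow_natCast, ← Real.rpow_mul (Nat.cast_nonneg q)]
    congr 1
    ring
  rw [h2] at h1
  exact h1
end

section
/- Let q = 7^k for some positive integer k, and let n' > 4 be an integer with 7 ∤ n'. Let n_1' = gcd(n', q − 1), let e be the multiplicative order of q modulo n', and let π(q,n') = N_0/n' where N_0 is the number of distinct monic irreducible factors of x^{n'} − 1 over F_q of degree strictly less than e. Then: (i) if n' = 2n_1', then e = 2 and π(q,n') = 1/2; (ii) if n' = 4n_1' and q ≡ 1 (mod 4), then e = 4 and π(q,n') = 3/8; (iii) if n' = 6n_1' and q ≡ 1 (mod 6), then e = 6 and π(q,n') = 13/36; (iv) in all other cases, π(q,n') ≤ 1/3. -/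
open Polynomial

lemma fac_sum {F : Type} [Field F] (f : F[X]) (hf : Squarefree f) :
    ∃ S : Finset F[X], (∀ p, p ∈ S ↔ p.Monic ∧ Irreducible p ∧ p ∣ f) ∧
      ∑ p ∈ S, p.natDegree = f.natDegree := by
  classical
  have h0 : f ≠ 0 := hf.ne_zero
  have hn := (UniqueFactorizationMonoid.squarefree_iff_nodup_normalizedFactors h0).1 hf
  refine ⟨(UniqueFactorizationMonoid.normalizedFactors f).toFinset, ?_, ?_⟩
  · intro p
    rw [Multiset.mem_toFinset, Polynomial.mem_normalizedFactors_iff h0]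
    tauto
  · have hp := UniqueFactorizationMonoid.prod_normalizedFactors h0
    rw [← Polynomial.natDegree_eq_of_degree_eq (Polynomial.degree_eq_degree_of_associated hp),
      Polynomial.natDegree_multiset_prod]
    · rw [Finset.sum, Multiset.toFinset_val, Multiset.dedup_eq_self.2 hn]
    · intro h
      exact (UniqueFactorizationMonoid.irreducible_of_normalized_factor _ h).ne_zero rfl

lemma dvd_gcd_iff' {F : Type} [Field F] (p : F[X]) (a b : ℕ) :
    p ∣ X ^ (Nat.gcd a b) - 1 ↔ p ∣ X ^ a - 1 ∧ p ∣ X ^ b - 1 := by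
  have key : ∀ m, p ∣ X ^ m - 1 ↔ (AdjoinRoot.root p) ^ m = 1 := by
    intro m
    rw [← AdjoinRoot.mk_eq_zero, map_sub, map_pow, AdjoinRoot.mk_X, map_one, sub_eq_zero]
  rw [key, key, key, ← orderOf_dvd_iff_pow_eq_one, ← orderOf_dvd_iff_pow_eq_one,
    ← orderOf_dvd_iff_pow_eq_one, Nat.dvd_gcd_iff]

lemma deg_dvd_iff {F : Type} [Field F] [Fintype F] (p : F[X]) (hp : Irreducible p) (n m : ℕ)
    (hn : 0 < n) (hd : p ∣ X ^ n - 1) :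
    p.natDegree ∣ m ↔ p ∣ X ^ (Fintype.card F ^ m - 1) - 1 := by
  rw [hp.natDegree_dvd_iff_dvd_X_pow_card_pow_sub_X, Nat.card_eq_fintype_card]
  have h1 : (X ^ Fintype.card F ^ m - X : F[X]) = X * (X ^ (Fintype.card F ^ m - 1) - 1) := by
    have : 0 < Fintype.card F ^ m := pow_pos Fintype.card_pos _
    obtain ⟨t, ht⟩ : ∃ t, Fintype.card F ^ m = t + 1 := ⟨_, (Nat.sub_add_cancel this).symm⟩
    rw [ht, Nat.add_sub_cancel]; ring
  rw [h1]
  constructor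
  · intro h
    rcases hp.prime.dvd_or_dvd h with h | h
    · exfalso
      have h2 : p ∣ (X ^ n : F[X]) := h.trans (dvd_pow_self _ hn.ne')
      have h3 : p ∣ 1 := by simpa using dvd_sub h2 hd
      exact hp.not_isUnit (isUnit_of_dvd_one h3)
    · exact h
  · intro h; exact h.mul_left _

lemma struct {F : Type} [Field F] [Fintype F] (n q e : ℕ) (hq : Fintype.card F = q)
    (hn : 0 < n) (hnF : (n : F) ≠ 0) (he0 : 0 < e) (he : n ∣ q ^ e - 1) :
    ∃ c : ℕ → ℕ, (∀ m, 0 < m → ∑ d ∈ m.divisors, d * c d = Nat.gcd n (q ^ m - 1)) ∧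
      {p : F[X] | p.Monic ∧ Irreducible p ∧ p ∣ (X ^ n - 1 : F[X]) ∧ p.natDegree < e}.ncard
        = ∑ d ∈ e.properDivisors, c d := by
  classical
  have hsq := (X_pow_sub_one_separable_iff.2 hnF).squarefree
  obtain ⟨S, hS, -⟩ := fac_sum _ hsq
  refine ⟨fun d => (S.filter fun p => p.natDegree = d).card, ?_, ?_⟩
  · intro m hm
    have hdv : (X ^ (Nat.gcd n (q ^ m - 1)) - 1 : F[X]) ∣ X ^ n - 1 :=
      ((dvd_gcd_iff' _ _ _).1 dvd_rfl).1
    obtain ⟨T, hT, hTs⟩ := fac_sum _ (hsq.squarefree_of_dvd hdv)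
    have hTS : T = S.filter fun p => p.natDegree ∣ m := by
      ext p
      rw [hT, Finset.mem_filter, hS, dvd_gcd_iff']
      constructor
      · rintro ⟨h1, h2, h3, h4⟩
        refine ⟨⟨h1, h2, h3⟩, ?_⟩
        rw [deg_dvd_iff p h2 n m hn h3, hq]; exact h4
      · rintro ⟨⟨h1, h2, h3⟩, h4⟩
        rw [deg_dvd_iff p h2 n m hn h3, hq] at h4
        exact ⟨h1, h2, h3, h4⟩
    have hdeg : (X ^ (Nat.gcd n (q ^ m - 1)) - 1 : F[X]).natDegree = Nat.gcd n (q ^ m - 1) := by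
      simpa using natDegree_X_pow_sub_C (n := Nat.gcd n (q ^ m - 1)) (r := (1 : F))
    rw [← hdeg, ← hTs, hTS]
    rw [← Finset.sum_fiberwise_of_maps_to (t := m.divisors) (g := fun p : F[X] => p.natDegree)]
    · refine Finset.sum_congr rfl fun d hd => ?_
      rw [Finset.sum_congr rfl (g := fun _ => d), Finset.sum_const, smul_eq_mul,
        mul_comm _ d, Finset.filter_filter]
      · refine congrArg (fun T : Finset F[X] => d * T.card) ?_
        ext p
        simp only [Finset.mem_filter]
        have := Nat.dvd_of_mem_divisors hd
        constructor
        · rintro ⟨h1, rfl⟩; exact ⟨h1, this, rfl⟩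
        · rintro ⟨h1, -, h⟩; exact ⟨h1, h⟩
      · intro p hp; exact (Finset.mem_filter.1 hp).2
    · intro p hp
      exact Nat.mem_divisors.2 ⟨(Finset.mem_filter.1 hp).2, hm.ne'⟩
  · have h1 : {p : F[X] | p.Monic ∧ Irreducible p ∧ p ∣ (X ^ n - 1 : F[X]) ∧ p.natDegree < e}
        = ((S.filter fun p => p.natDegree < e : Finset F[X]) : Set F[X]) := by
      ext p
      simp only [Set.mem_ofPred_eq, Finset.coe_filter, hS]
      tauto
    rw [h1, Set.ncard_coe_finset,
      Finset.card_eq_sum_card_fiberwise (t := e.properDivisors) (f := fun p => p.natDegree)]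
    · refine Finset.sum_congr rfl fun d hd => ?_
      rw [Finset.filter_filter]
      congr 1
      ext p
      simp only [Finset.mem_filter]
      have := (Nat.mem_properDivisors.1 hd).2
      constructor
      · rintro ⟨h1, -, h⟩; exact ⟨h1, h⟩
      · rintro ⟨h1, rfl⟩; exact ⟨h1, this, rfl⟩
    · intro p hp
      simp only [Finset.coe_filter, Set.mem_ofPred_eq, hS] at hp
      obtain ⟨⟨h1, h2, h3⟩, h4⟩ := hp
      simp only [Finset.mem_coe, Nat.mem_properDivisors]
      refine ⟨?_, h4⟩
      rw [deg_dvd_iff p h2 n e hn h3, hq]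
      obtain ⟨u, hu⟩ := he
      refine h3.trans ?_
      have := (dvd_gcd_iff' (X ^ n - 1 : F[X]) n (q ^ e - 1)).1 (by rw [Nat.gcd_eq_left ⟨u, hu⟩])
      exact this.2

/-- the orbit bound -/
lemma orb (n Q r : ℕ) (hn : 0 < n) (hQ : 0 < Q)
    (hinj : ∀ i < r, ∀ j < r, Q ^ i ≡ Q ^ j [MOD n] → i = j) :
    Nat.gcd n (Q - 1) * r ≤ n := by
  set M := Nat.gcd n (Q - 1) with hM
  have hMn : M ∣ n := Nat.gcd_dvd_left _ _
  have hMQ : M ∣ Q - 1 := Nat.gcd_dvd_right _ _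
  have hM0 : 0 < M := Nat.gcd_pos_of_pos_left _ hn
  have h1 : ∀ i, (Q ^ i % n) % M = 1 % M := by
    intro i
    rw [Nat.mod_mod_of_dvd _ hMn]
    have : Q ≡ 1 [MOD M] := ((Nat.modEq_iff_dvd' hQ).2 hMQ).symm
    have h := this.pow i
    rw [one_pow] at h
    exact h
  have h2 : r ≤ n / M := by
    have := Finset.card_le_card_of_injOn (s := Finset.range r) (t := Finset.range (n / M))
      (fun i => (Q ^ i % n) / M) ?_ ?_
    · simpa using this
    · intro i hi
      simp only [Finset.coe_range, Set.mem_Iio]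
      exact Nat.div_lt_div_of_lt_of_dvd hMn (Nat.mod_lt _ hn)
    · intro i hi j hj hij
      simp only [Finset.coe_range, Set.mem_Iio] at hi hj hij
      refine hinj i hi j hj ?_
      have a := Nat.div_add_mod (Q ^ i % n) M
      have b := Nat.div_add_mod (Q ^ j % n) M
      rw [h1] at a b
      rw [hij] at a
      exact a.symm.trans b
  calc M * r ≤ M * (n / M) := Nat.mul_le_mul_left _ h2
    _ = n := Nat.mul_div_cancel' hMn

lemma orb' (n q e m : ℕ) (hn : 0 < n) (hq : 0 < q) (he0 : 0 < e)
    (he : e = orderOf (q : ZMod n)) (hm : m ∣ e) : e * Nat.gcd n (q ^ m - 1) ≤ m * n := by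
  obtain ⟨r, rfl⟩ := hm
  have hm0 : 0 < m := Nat.pos_of_mul_pos_right he0
  have := orb n (q ^ m) r hn (pow_pos hq _) ?_
  · nlinarith
  · intro i hi j hj hij
    rw [← ZMod.natCast_eq_natCast_iff] at hij
    push_cast at hij
    rw [← pow_mul, ← pow_mul] at hij
    have h := pow_injOn_Iio_orderOf (x := (q : ZMod n)) (x₁ := m * i) (x₂ := m * j)
      (by rw [← he]; exact Nat.mul_lt_mul_of_pos_left hi hm0)
      (by rw [← he]; exact Nat.mul_lt_mul_of_pos_left hj hm0) hij
    exact Nat.eq_of_mul_eq_mul_left hm0 h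

lemma tau (e : ℕ) (h0 : 0 < e) (h2 : e ≠ 2) (h4 : e ≠ 4) (h6 : e ≠ 6) (h8 : e ≠ 8)
    (h12 : e ≠ 12) : 3 * e.properDivisors.card ≤ e := by
  by_cases h : e < 24
  · interval_cases e <;> first | contradiction | decide
  · push Not at h
    have hsub : e.properDivisors ⊆ {e / 2, e / 3, e / 4} ∪ Finset.Icc 1 (e / 5) := by
      intro d hd
      obtain ⟨⟨r, rfl⟩, hlt⟩ := Nat.mem_properDivisors.1 hd
      have hd0 : 0 < d := Nat.pos_of_mul_pos_right h0
      have hr : 1 < r := by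
        by_contra hc
        nlinarith
      simp only [Finset.mem_union, Finset.mem_insert, Finset.mem_singleton, Finset.mem_Icc]
      by_cases h5 : 5 ≤ r
      · right
        refine ⟨hd0, ?_⟩
        rw [Nat.le_div_iff_mul_le (by norm_num)]
        exact Nat.mul_le_mul_left _ h5
      · left
        have : r = 2 ∨ r = 3 ∨ r = 4 := by omega
        rcases this with rfl | rfl | rfl <;> omega
    have h1 := (Finset.card_le_card hsub).trans (Finset.card_union_le _ _)
    have h2 : ({e / 2, e / 3, e / 4} : Finset ℕ).card ≤ 3 := Finset.card_le_three
    simp only [Nat.card_Icc] at h1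
    omega

lemma mul_le_of' {n x a k : ℕ} (h : n = x * a) (hk : k ≤ a) : k * x ≤ n := by
  rw [h, mul_comm]; exact Nat.mul_le_mul_left _ hk

lemma gcd_aux' (n a b : ℕ) : Nat.gcd n (Nat.gcd a b) = Nat.gcd (Nat.gcd n a) (Nat.gcd n b) := by
  apply Nat.dvd_antisymm
  · simp only [Nat.dvd_gcd_iff]
    have h1 := Nat.gcd_dvd_left n (Nat.gcd a b)
    have h2 := Nat.gcd_dvd_right n (Nat.gcd a b)
    exact ⟨⟨h1, h2.trans (Nat.gcd_dvd_left _ _)⟩, h1, h2.trans (Nat.gcd_dvd_right _ _)⟩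
  · simp only [Nat.dvd_gcd_iff]
    have h1 := Nat.gcd_dvd_left (Nat.gcd n a) (Nat.gcd n b)
    have h2 := Nat.gcd_dvd_right (Nat.gcd n a) (Nat.gcd n b)
    exact ⟨h1.trans (Nat.gcd_dvd_left _ _), h1.trans (Nat.gcd_dvd_right _ _),
      h2.trans (Nat.gcd_dvd_right _ _)⟩

lemma divs_facts : Nat.divisors 1 = {1} ∧ Nat.divisors 2 = {1, 2} ∧ Nat.divisors 3 = {1, 3} ∧
    Nat.divisors 4 = {1, 2, 4} ∧ Nat.divisors 6 = {1, 2, 3, 6} ∧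
    Nat.properDivisors 1 = ∅ ∧ Nat.properDivisors 2 = {1} ∧ Nat.properDivisors 4 = {1, 2} ∧
    Nat.properDivisors 6 = {1, 2, 3} ∧ Nat.properDivisors 8 = {1, 2, 4} ∧
    Nat.properDivisors 12 = {1, 2, 3, 4, 6} := by decide

/-- writing `q = 1 + g t` with `t` coprime to `a` when `n = a g` -/
lemma split_q (q n g a : ℕ) (hq : 0 < q) (hg : g = Nat.gcd n (q - 1)) (hn : n = a * g)
    (hn0 : 0 < n) : ∃ t, q = g * t + 1 ∧ Nat.Coprime a t ∧ 0 < g := by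
  have hg0 : 0 < g := hg ▸ Nat.gcd_pos_of_pos_left _ hn0
  obtain ⟨t, ht⟩ : g ∣ q - 1 := hg ▸ Nat.gcd_dvd_right _ _
  refine ⟨t, by omega, ?_, hg0⟩
  rw [ht, hn, mul_comm a g, Nat.gcd_mul_left] at hg
  exact Nat.eq_of_mul_eq_mul_left hg0 (by rw [mul_one]; exact hg.symm)

lemma pow_eq_one_iff' (q n m : ℕ) (hq : 0 < q) : (q : ZMod n) ^ m = 1 ↔ n ∣ q ^ m - 1 := by
  have h : 1 ≤ q ^ m := Nat.one_le_pow _ _ hq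
  rw [← Nat.modEq_iff_dvd' h, ← ZMod.natCast_eq_natCast_iff]
  push_cast
  exact eq_comm

lemma gcd_scaled (a g u w : ℕ) (h : u = g * w) : Nat.gcd (a * g) u = g * Nat.gcd a w := by
  rw [h, mul_comm a g, Nat.gcd_mul_left]

lemma case1 (q n g e : ℕ) (hq : 0 < q) (hodd : q % 2 = 1) (hg : g = Nat.gcd n (q - 1))
    (hn : n = 2 * g) (hn0 : 0 < n) (he : e = orderOf (q : ZMod n)) : e = 2 := by
  obtain ⟨t, ht, hc, hg0⟩ := split_q q n g 2 hq hg hn hn0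
  rw [he]
  apply orderOf_eq_prime
  · rw [pow_eq_one_iff' _ _ _ hq]
    have h1 : (g * t) % 2 = 0 := by omega
    obtain ⟨s, hs⟩ := Nat.dvd_of_mod_eq_zero h1
    refine ⟨t * (s + 1), ?_⟩
    rw [Nat.sub_eq_iff_eq_add (Nat.one_le_pow _ _ hq), ht, hn]
    have : (g * t + 1) ^ 2 = (g * t) * (g * t + 2) + 1 := by ring
    rw [this]; nth_rewrite 2 [hs]; ring
  · intro h
    rw [← pow_one (q : ZMod n), pow_eq_one_iff' _ _ _ hq, pow_one] at h
    rw [Nat.gcd_eq_left h] at hg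
    omega

lemma gcd_two (q n g a t : ℕ) (ht : q = g * t + 1) (hn : n = a * g) :
    Nat.gcd n (q ^ 2 - 1) = g * Nat.gcd a (t * (g * t + 2)) := by
  rw [hn]
  apply gcd_scaled a g
  rw [Nat.sub_eq_iff_eq_add (Nat.one_le_pow _ _ (by omega)), ht]; ring

lemma gcd_three (q n g a t : ℕ) (ht : q = g * t + 1) (hn : n = a * g) :
    Nat.gcd n (q ^ 3 - 1) = g * Nat.gcd a (t * ((g * t) ^ 2 + 3 * (g * t) + 3)) := by
  rw [hn]
  apply gcd_scaled a g
  rw [Nat.sub_eq_iff_eq_add (Nat.one_le_pow _ _ (by omega)), ht]; ring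

lemma case2 (q n g e : ℕ) (hq : 0 < q) (hq4 : q % 4 = 1) (hg : g = Nat.gcd n (q - 1))
    (hn : n = 4 * g) (hn0 : 0 < n) (he : e = orderOf (q : ZMod n)) :
    e = 4 ∧ Nat.gcd n (q ^ 2 - 1) = 2 * g := by
  obtain ⟨t, ht, hc, hg0⟩ := split_q q n g 4 hq hg hn hn0
  have h1 : (g * t) % 4 = 0 := by omega
  have h2 : Nat.gcd n (q ^ 2 - 1) = 2 * g := by
    rw [gcd_two q n g 4 t ht hn, hc.symm.gcd_mul_left_cancel_right]
    obtain ⟨s, hs⟩ := Nat.dvd_of_mod_eq_zero h1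
    rw [hs]
    have : Nat.gcd 4 (4 * s + 2) = 2 := by simp
    rw [this, mul_comm]
  refine ⟨?_, h2⟩
  have := orderOf_eq_prime_pow (x := (q : ZMod n)) (p := 2) (n := 1) ?_ ?_
  · rw [he, this]; norm_num
  · rw [pow_eq_one_iff' _ _ _ hq]
    intro h
    rw [pow_one, ← Nat.gcd_eq_left_iff_dvd, h2] at h
    omega
  · rw [pow_eq_one_iff' _ _ _ hq]
    have hd : 2 * g ∣ q ^ 2 - 1 := h2 ▸ Nat.gcd_dvd_right _ _
    have hd2 : 2 ∣ q ^ 2 + 1 := by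
      have : q % 2 = 1 := by omega
      apply Nat.dvd_of_mod_eq_zero
      simp [Nat.add_mod, Nat.pow_mod, this]
    have : q ^ 2 ^ (1 + 1) - 1 = (q ^ 2 - 1) * (q ^ 2 + 1) := by
      obtain ⟨v, hv⟩ : ∃ v, q ^ 2 = v + 1 := ⟨q ^ 2 - 1, (Nat.sub_add_cancel (Nat.one_le_pow _ _ hq)).symm⟩
      have h : q ^ 2 ^ (1 + 1) = (q ^ 2) ^ 2 := by ring
      rw [h, hv, Nat.add_sub_cancel, Nat.sub_eq_iff_eq_add (Nat.one_le_pow _ _ (by omega))]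
      ring
    rw [this, hn]
    have := mul_dvd_mul hd hd2
    rwa [show 4 * g = 2 * g * 2 by ring]

lemma case3 (q n g e : ℕ) (hq : 0 < q) (hq6 : q % 6 = 1) (hg : g = Nat.gcd n (q - 1))
    (hn : n = 6 * g) (hn0 : 0 < n) (he : e = orderOf (q : ZMod n)) :
    e = 6 ∧ Nat.gcd n (q ^ 2 - 1) = 2 * g ∧ Nat.gcd n (q ^ 3 - 1) = 3 * g := by
  obtain ⟨t, ht, hc, hg0⟩ := split_q q n g 6 hq hg hn hn0
  have h1 : (g * t) % 6 = 0 := by omega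
  obtain ⟨s, hs⟩ := Nat.dvd_of_mod_eq_zero h1
  have h2 : Nat.gcd n (q ^ 2 - 1) = 2 * g := by
    rw [gcd_two q n g 6 t ht hn, hc.symm.gcd_mul_left_cancel_right, hs]
    have : Nat.gcd 6 (6 * s + 2) = 2 := by simp
    rw [this, mul_comm]
  have h3 : Nat.gcd n (q ^ 3 - 1) = 3 * g := by
    rw [gcd_three q n g 6 t ht hn, hc.symm.gcd_mul_left_cancel_right, hs]
    have : Nat.gcd 6 ((6 * s) ^ 2 + 3 * (6 * s) + 3) = 3 := by
      rw [show (6 * s) ^ 2 + 3 * (6 * s) + 3 = 6 * (6 * s ^ 2 + 3 * s) + 3 by ring]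
      simp
    rw [this, mul_comm]
  refine ⟨?_, h2, h3⟩
  have e2 : ¬ e ∣ 2 := by
    rw [he, orderOf_dvd_iff_pow_eq_one, pow_eq_one_iff' _ _ _ hq]
    intro h
    rw [← Nat.gcd_eq_left_iff_dvd, h2] at h
    omega
  have e3 : ¬ e ∣ 3 := by
    rw [he, orderOf_dvd_iff_pow_eq_one, pow_eq_one_iff' _ _ _ hq]
    intro h
    rw [← Nat.gcd_eq_left_iff_dvd, h3] at h
    omega
  have e6 : e ∣ 6 := by
    rw [he, orderOf_dvd_iff_pow_eq_one, pow_eq_one_iff' _ _ _ hq]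
    have hd : 3 * g ∣ q ^ 3 - 1 := h3 ▸ Nat.gcd_dvd_right _ _
    have hd2 : 2 ∣ q ^ 3 + 1 := by
      have : q % 2 = 1 := by omega
      apply Nat.dvd_of_mod_eq_zero
      simp [Nat.add_mod, Nat.pow_mod, this]
    have : q ^ 6 - 1 = (q ^ 3 - 1) * (q ^ 3 + 1) := by
      obtain ⟨v, hv⟩ : ∃ v, q ^ 3 = v + 1 := ⟨q ^ 3 - 1, (Nat.sub_add_cancel (Nat.one_le_pow _ _ hq)).symm⟩
      have h : q ^ 6 = (q ^ 3) ^ 2 := by ring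
      rw [h, hv, Nat.add_sub_cancel, Nat.sub_eq_iff_eq_add (Nat.one_le_pow _ _ (by omega))]
      ring
    rw [this, hn]
    have := mul_dvd_mul hd hd2
    rwa [show 6 * g = 3 * g * 2 by ring]
  have : e ≤ 6 := Nat.le_of_dvd (by norm_num) e6
  clear he
  interval_cases e <;> revert e2 e3 e6 <;> decide

lemma case4 (q n g : ℕ) (hq : 0 < q) (hq4 : q % 4 = 3) (hg : g = Nat.gcd n (q - 1))
    (hn : n = 4 * g) (hn0 : 0 < n) : orderOf (q : ZMod n) ∣ 2 := by
  obtain ⟨t, ht, hc, hg0⟩ := split_q q n g 4 hq hg hn hn0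
  rw [orderOf_dvd_iff_pow_eq_one, pow_eq_one_iff' _ _ _ hq, ← Nat.gcd_eq_left_iff_dvd,
    gcd_two q n g 4 t ht hn, hc.symm.gcd_mul_left_cancel_right]
  have h1 : 4 ∣ g * t + 2 := by omega
  rw [Nat.gcd_eq_left h1, hn, mul_comm]

set_option maxHeartbeats 1000000 in
theorem pi_ratio_factorization (k : ℕ) (hk : 0 < k) (q : ℕ) (hq : q = 7 ^ k)
    (n' : ℕ) (hn'4 : 4 < n') (h7 : ¬ 7 ∣ n')
    (Fq : Type) [Field Fq] [Fintype Fq] (hcard : Fintype.card Fq = q)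
    (n1' : ℕ) (hn1' : n1' = Nat.gcd n' (q - 1))
    (e : ℕ) (he : e = orderOf ((q : ZMod n')))
    (piq : ℝ)
    (hpi : piq = (({p : Polynomial Fq | p.Monic ∧ Irreducible p ∧
        p ∣ (X ^ n' - 1 : Polynomial Fq) ∧ p.natDegree < e}.ncard : ℝ)) / (n' : ℝ)) :
    (n' = 2 * n1' → e = 2 ∧ piq = 1 / 2) ∧
    (n' = 4 * n1' ∧ q % 4 = 1 → e = 4 ∧ piq = 3 / 8) ∧
    (n' = 6 * n1' ∧ q % 6 = 1 → e = 6 ∧ piq = 13 / 36) ∧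
    (¬ n' = 2 * n1' ∧ ¬ (n' = 4 * n1' ∧ q % 4 = 1) ∧ ¬ (n' = 6 * n1' ∧ q % 6 = 1) →
      piq ≤ 1 / 3) := by
  have hn0 : 0 < n' := by omega
  have hq0 : 0 < q := by rw [hq]; positivity
  have hq6 : q % 6 = 1 := by rw [hq, Nat.pow_mod]; simp
  have hcop : Nat.Coprime q n' := by
    rw [hq]
    exact Nat.Coprime.pow_left _ ((Nat.Prime.coprime_iff_not_dvd (by norm_num)).2 h7)
  have he0 : 0 < e := by
    have : NeZero n' := ⟨hn0.ne'⟩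
    have h := orderOf_pos (ZMod.unitOfCoprime q hcop)
    rwa [← orderOf_units, ZMod.coe_unitOfCoprime, ← he] at h
  have hdvd : n' ∣ q ^ e - 1 := by
    rw [← pow_eq_one_iff' _ _ _ hq0, he, pow_orderOf_eq_one]
  have hnF : (n' : Fq) ≠ 0 := by
    have : Fact (Nat.Prime 7) := ⟨by norm_num⟩
    have : CharP Fq 7 := by
      obtain ⟨p, hp⟩ := CharP.exists Fq
      obtain ⟨m, hpp, hm⟩ := FiniteField.card Fq p
      have : p = 7 := by
        have h1 : p ∣ 7 ^ k := by
          rw [← hq, ← hcard, hm]; exact dvd_pow_self _ m.pos.ne'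
        exact (Nat.prime_dvd_prime_iff_eq hpp (by norm_num)).1 (hpp.dvd_of_dvd_pow h1)
      exact this ▸ hp
    rw [Ne, CharP.cast_eq_zero_iff Fq 7]
    exact h7
  obtain ⟨c, hc, hN⟩ := struct n' q e hcard hn0 hnF he0 hdvd
  rw [hN] at hpi
  clear hN
  obtain ⟨D1, D2, D3, D4, D6, P1, P2, P4, P6, P8, P12⟩ := divs_facts
  have hnR : (0 : ℝ) < n' := by exact_mod_cast hn0
  have hc1 : c 1 = n1' := by
    have := hc 1 one_pos
    rw [D1, pow_one, ← hn1'] at this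
    simpa using this
  have hc2 : c 1 + 2 * c 2 = Nat.gcd n' (q ^ 2 - 1) := by
    have := hc 2 two_pos
    rw [D2] at this
    simpa using this
  have hc3 : c 1 + 3 * c 3 = Nat.gcd n' (q ^ 3 - 1) := by
    have := hc 3 three_pos
    rw [D3] at this
    simpa using this
  have hc4 : c 1 + (2 * c 2 + 4 * c 4) = Nat.gcd n' (q ^ 4 - 1) := by
    have := hc 4 four_pos
    rw [D4] at this
    simpa using this
  have hc6 : c 1 + (2 * c 2 + (3 * c 3 + 6 * c 6)) = Nat.gcd n' (q ^ 6 - 1) := by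
    have := hc 6 (by norm_num)
    rw [D6] at this
    simpa using this
  have horb := fun m hm => orb' n' q e m hn0 hq0 he0 he hm
  have hfin : ∀ a b : ℕ, 0 < b → b * (∑ d ∈ e.properDivisors, c d) = a * n' →
      piq = (a : ℝ) / b := by
    intro a b hb h
    rw [hpi, div_eq_div_iff hnR.ne' (by positivity)]
    have : ((b * (∑ d ∈ e.properDivisors, c d) : ℕ) : ℝ) = ((a * n' : ℕ) : ℝ) := by rw [h]
    push_cast at this ⊢
    linarith
  refine ⟨?_, ?_, ?_, ?_⟩
  · intro h
    have he2 := case1 q n' n1' e hq0 (by omega) hn1' h hn0 he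
    refine ⟨he2, ?_⟩
    have := hfin 1 2 (by norm_num) (by rw [he2, P2]; simp; omega)
    rw [this]; norm_num
  · rintro ⟨h, h4⟩
    obtain ⟨he2, hM⟩ := case2 q n' n1' e hq0 h4 hn1' h hn0 he
    refine ⟨he2, ?_⟩
    have := hfin 3 8 (by norm_num) (by rw [he2, P4]; simp; omega)
    rw [this]; norm_num
  · rintro ⟨h, h4⟩
    obtain ⟨he2, hM, hM'⟩ := case3 q n' n1' e hq0 h4 hn1' h hn0 he
    refine ⟨he2, ?_⟩
    have := hfin 13 36 (by norm_num) (by rw [he2, P6]; simp; omega)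
    rw [this]; norm_num
  · rintro ⟨g1, g2, g3⟩
    suffices H : 3 * (∑ d ∈ e.properDivisors, c d) ≤ n' by
      rw [hpi, div_le_div_iff₀ hnR (by norm_num)]
      have : ((3 * (∑ d ∈ e.properDivisors, c d) : ℕ) : ℝ) ≤ ((n' : ℕ) : ℝ) := by
        exact_mod_cast H
      push_cast at this ⊢
      linarith
    have o1 := horb 1 (one_dvd _)
    rw [pow_one, ← hn1'] at o1
    have d1 : n1' ∣ n' := hn1' ▸ Nat.gcd_dvd_left _ _
    have hn1pos : 0 < n1' := Nat.pos_of_dvd_of_pos d1 hn0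
    by_cases E2 : e = 2
    · rw [E2, P2, Finset.sum_singleton]
      rw [E2] at o1
      obtain ⟨a, ha⟩ := d1
      have : a ≠ 2 := by rintro rfl; omega
      have : 2 ≤ a := by
        by_contra hh
        have : a = 0 ∨ a = 1 := by omega
        rcases this with rfl | rfl <;> omega
      have h3 : 3 ≤ a := by omega
      have := mul_le_of' ha h3
      omega
    by_cases E4 : e = 4
    · rw [E4, P4, Finset.sum_pair (by norm_num)]
      have o2 := horb 2 (by rw [E4]; norm_num)
      rw [E4] at o1 o2
      rw [← hc2] at o2
      have d2 : c 1 + 2 * c 2 ∣ n' := hc2 ▸ Nat.gcd_dvd_left _ _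
      have d12 : n1' ∣ c 1 + 2 * c 2 := by
        rw [hc2, hn1']
        apply Nat.gcd_dvd_gcd_of_dvd_right
        simpa using Nat.sub_dvd_pow_sub_pow q 1 2
      obtain ⟨b, hb⟩ := d2
      obtain ⟨s, hs⟩ := d12
      by_cases hb3 : 3 ≤ b
      · have : 3 * (c 1 + 2 * c 2) ≤ n' := mul_le_of' hb hb3
        omega
      have hb2 : b = 2 := by
        have : b ≠ 0 := by rintro rfl; omega
        have : b ≠ 1 := by rintro rfl; omega
        omega
      subst hb2
      by_cases hs3 : 3 ≤ s
      · have : 3 * n1' ≤ c 1 + 2 * c 2 := mul_le_of' hs hs3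
        omega
      have hs2 : s = 2 := by
        have : s ≠ 0 := by rintro rfl; omega
        have : s ≠ 1 := by rintro rfl; omega
        omega
      subst hs2
      exfalso
      have h4n : n' = 4 * n1' := by omega
      have hh := case4 q n' n1' hq0 (by omega) hn1' h4n hn0
      rw [← he, E4] at hh
      revert hh; decide
    by_cases E6 : e = 6
    · rw [E6, P6]
      have : ∑ d ∈ ({1, 2, 3} : Finset ℕ), c d = c 1 + (c 2 + c 3) := by simp
      rw [this]
      have o2 := horb 2 (by rw [E6]; norm_num)
      have o3 := horb 3 (by rw [E6]; norm_num)
      rw [E6] at o1 o2 o3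
      rw [← hc2] at o2
      rw [← hc3] at o3
      have d2 : c 1 + 2 * c 2 ∣ n' := hc2 ▸ Nat.gcd_dvd_left _ _
      have d3 : c 1 + 3 * c 3 ∣ n' := hc3 ▸ Nat.gcd_dvd_left _ _
      have hgcd : n1' = Nat.gcd (c 1 + 2 * c 2) (c 1 + 3 * c 3) := by
        rw [hc2, hc3, hn1']
        have := Nat.pow_sub_one_gcd_pow_sub_one q 2 3
        rw [show Nat.gcd 2 3 = 1 from rfl, pow_one] at this
        rw [← gcd_aux', this]
      have hne : n' ≠ 6 * n1' := fun h => g3 ⟨h, hq6⟩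
      have o1' : 7 * n1' ≤ n' := by
        obtain ⟨a, ha⟩ := d1
        have : a ≠ 6 := by rintro rfl; omega
        have : 6 ≤ a := by
          by_contra hh
          have : a ≤ 5 := by omega
          nlinarith
        have h7 : 7 ≤ a := by omega
        exact mul_le_of' ha h7
      obtain ⟨a, ha⟩ := d2
      obtain ⟨b, hb⟩ := d3
      by_cases ha4 : 4 ≤ a
      · have : 4 * (c 1 + 2 * c 2) ≤ n' := mul_le_of' ha ha4
        omega
      by_cases hb4 : 3 ≤ b
      · have : 3 * (c 1 + 3 * c 3) ≤ n' := mul_le_of' hb hb4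
        omega
      exfalso
      have ha3 : a = 3 := by
        have : a ≠ 0 := by rintro rfl; omega
        have : a ≠ 1 := by rintro rfl; omega
        have : a ≠ 2 := by rintro rfl; omega
        omega
      have hb3 : b = 2 := by
        have : b ≠ 0 := by rintro rfl; omega
        have : b ≠ 1 := by rintro rfl; omega
        omega
      subst ha3 hb3
      obtain ⟨w, hw⟩ : ∃ w, n' = 6 * w := ⟨n' / 6, by omega⟩
      rw [show c 1 + 2 * c 2 = w * 2 by omega, show c 1 + 3 * c 3 = w * 3 by omega,
        Nat.gcd_mul_left] at hgcd
      norm_num at hgcd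
      omega
    by_cases E8 : e = 8
    · rw [E8, P8]
      have : ∑ d ∈ ({1, 2, 4} : Finset ℕ), c d = c 1 + (c 2 + c 4) := by simp
      rw [this]
      have o2 := horb 2 (by rw [E8]; norm_num)
      have o4 := horb 4 (by rw [E8]; norm_num)
      rw [E8] at o1 o2 o4
      omega
    by_cases E12 : e = 12
    · rw [E12, P12]
      have : ∑ d ∈ ({1, 2, 3, 4, 6} : Finset ℕ), c d = c 1 + (c 2 + (c 3 + (c 4 + c 6))) := by simp
      rw [this]
      have o2 := horb 2 (by rw [E12]; norm_num)
      have o3 := horb 3 (by rw [E12]; norm_num)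
      have o4 := horb 4 (by rw [E12]; norm_num)
      have o6 := horb 6 (by rw [E12]; norm_num)
      rw [E12] at o1 o2 o3 o4 o6
      omega
    have ht := tau e he0 E2 E4 E6 E8 E12
    have hcd : ∀ d ∈ e.properDivisors, e * c d ≤ n' := by
      intro d hd
      have hde := (Nat.mem_properDivisors.1 hd).1
      have hd0 : 0 < d := Nat.pos_of_dvd_of_pos hde he0
      have h1 := horb d hde
      have h2 := hc d hd0
      have h3 : d * c d ≤ Nat.gcd n' (q ^ d - 1) := by
        rw [← h2]
        exact Finset.single_le_sum (f := fun d => d * c d) (fun _ _ => Nat.zero_le _)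
          (Nat.mem_divisors_self d hd0.ne')
      have h4 : d * (e * c d) ≤ d * n' := by
        calc d * (e * c d) = e * (d * c d) := by ring
          _ ≤ e * Nat.gcd n' (q ^ d - 1) := Nat.mul_le_mul_left _ h3
          _ ≤ d * n' := h1
      exact Nat.le_of_mul_le_mul_left h4 hd0
    have hsum := Finset.sum_le_sum hcd
    rw [← Finset.mul_sum, Finset.sum_const, smul_eq_mul] at hsum
    have : e * (3 * ∑ d ∈ e.properDivisors, c d) ≤ e * n' := by nlinarith
    exact Nat.le_of_mul_le_mul_left this he0
end
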